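/- Remark 4.4 (simpler one-arm bound): There exists C ∈ (0,∞) such that for all x ∈ G and R ≥ 2, ℙ(x ↔ B(x,R)^c in E^{≥0}) ≤ C R^{−ν/2} (log R)^{(ν + b₂(ν+1))/2}, where b₂ = 1 if α = 2ν and b₂ = 0 otherwise. In particular, for G = ℤ³ with unit weights this gives ℙ(0 ↔ B_R^c) ≤ C R^{−1/2} (log R)^{1/2}. -/

import Mathlib

open MeasureTheory ProbabilityTheory Real Filter Topology
open scoped ENNReal NNReal BigOperators Classical

noncomputable section

/-! ## Generic exponents and corrections -/

/-- The exponent `b₁`: equal to `1` if `ν = 1` and `0` otherwise. -/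
def bOne (ν : ℝ) : ℝ := if ν = 1 then 1 else 0

/-- The exponent `b₂`: equal to `1` if `α = 2ν` and `0` otherwise. -/
def bTwo (ν α : ℝ) : ℝ := if α = 2 * ν then 1 else 0

/-- The polylogarithmic correction `q(r)` from Theorem 1.1. -/
def qArm (ν α r : ℝ) : ℝ :=
  if ν = 1 then Real.log (Real.log r)
  else if ν < α / 2 then Real.log r ^ ((ν - 1) / 2) * Real.log (Real.log r) ^ ν
  else Real.log r ^ ν * Real.log (Real.log r) ^ ν

/-- `exp(-t)` for an extended nonnegative real `t`. -/
def expNegE (t : ℝ≥0∞) : ℝ≥0∞ := if t = ⊤ then 0 else ENNReal.ofReal (Real.exp (-t.toReal))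

/-! ## Transient weighted graphs

A weighted graph `𝒢 = (G, λ)`, connected and locally finite, with controlled weights,
equipped with a metric `d`, a distinguished base point `o`, and exponents `α` (volume
growth) and `ν` (Green's function decay). -/

structure WGraph where
  (V : Type) (countableV : Countable V) (o : V)
  (lam : V → V → ℝ)
  (lam_nonneg : ∀ x y, 0 ≤ lam x y)
  (lam_symm : ∀ x y, lam x y = lam y x)
  (locFin : ∀ x, (Function.support (lam x)).Finite)
  (connectedG : ∀ x y, Relation.ReflTransGen (fun u v => 0 < lam u v) x y)
  -- controlled weights: `λ_{x,y}/λ_x ≥ c₀` for all neighbours `x ∼ y`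
  (ctrl : ∃ c₀ > (0:ℝ), ∀ x y, 0 < lam x y → c₀ * (∑ᶠ z, lam x z) ≤ lam x y)
  (d : V → V → ℝ)
  (d_symm : ∀ x y, d x y = d y x)
  (d_self : ∀ x, d x x = 0)
  (d_pos : ∀ x y, x ≠ y → 0 < d x y)
  (d_triangle : ∀ x y z, d x z ≤ d x y + d y z)
  (α : ℝ) (ν : ℝ)

namespace WGraph

variable (M : WGraph)

/-- Total weight `λ_x = Σ_{y} λ_{x,y}` at a vertex. -/
def lamTot (x : M.V) : ℝ := ∑ᶠ y, M.lam x y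

/-- The (closed) ball `B(x,r)` for the metric `d`. -/
def ball (x : M.V) (r : ℝ) : Set M.V := {y | M.d x y ≤ r}

/-- One-step transition probability of the random walk on `(G,λ)`. -/
def p (x y : M.V) : ℝ := M.lam x y / M.lamTot x

/-- `n`-step transition probability of the random walk. -/
def pstep : ℕ → M.V → M.V → ℝ
  | 0, x, y => if x = y then 1 else 0
  | n + 1, x, y => ∑ᶠ z, M.p x z * pstep n z y

/-- The Green's function `g(x,y) = λ_y^{-1} Σ_{n ≥ 0} P_x[Z_n = y]` of the walk. -/
def green (x y : M.V) : ℝ := (∑' n, M.pstep n x y) / M.lamTot y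

/-- Transience of the random walk on `𝒢`. -/
def Transient : Prop := ∀ x, Summable fun n => M.pstep n x x

/-- The volume growth condition `(V_α)`. -/
def VolGrowth : Prop :=
  ∃ c > (0:ℝ), ∃ C > (0:ℝ), ∀ (x : M.V) (r : ℝ), 1 ≤ r →
    c * r ^ M.α ≤ (∑ᶠ y ∈ M.ball x r, M.lamTot y) ∧
      (∑ᶠ y ∈ M.ball x r, M.lamTot y) ≤ C * r ^ M.α

/-- The Green's function decay condition `(G_ν)`. -/
def GreenDecay : Prop :=
  ∃ c > (0:ℝ), ∃ C > (0:ℝ),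
    (∀ x : M.V, c ≤ M.green x x ∧ M.green x x ≤ C) ∧
    ∀ x y : M.V, x ≠ y →
      c * M.d x y ^ (-M.ν) ≤ M.green x y ∧ M.green x y ≤ C * M.d x y ^ (-M.ν)

/-- The standing assumptions on the graph: transience, `(V_α)` and `(G_ν)`. -/
def Standing : Prop := M.Transient ∧ M.VolGrowth ∧ M.GreenDecay

/-- The graph distance `d_gr` on `𝒢`. -/
def graphDist (x y : M.V) : ℝ :=
  sInf {r : ℝ | ∃ n : ℕ, r = n ∧ ∃ γ : Fin (n + 1) → M.V, γ 0 = x ∧ γ (Fin.last n) = y ∧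
    ∀ i : Fin n, 0 < M.lam (γ i.castSucc) (γ i.succ)}

/-- Capacity of a finite set of vertices, via the variational characterization
`cap(K) = (inf_μ Σ_{x,y} μ(x) g(x,y) μ(y))⁻¹`, the infimum being over probability
measures supported on `K`. -/
def capFinset (K : Finset M.V) : ℝ :=
  (sInf {E : ℝ | ∃ μ : M.V → ℝ, (∀ x, 0 ≤ μ x) ∧ (∀ x, x ∉ K → μ x = 0) ∧
    (∑ x ∈ K, μ x) = 1 ∧ E = ∑ x ∈ K, ∑ y ∈ K, μ x * M.green x y * μ y})⁻¹

/-- Capacity of an arbitrary set of vertices. -/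
def cap (S : Set M.V) : ℝ := ⨆ K : {K : Finset M.V // ↑K ⊆ S}, M.capFinset K.1

/-- Weight `∏_{i<n} p(x_i, x_{i+1})` of a finite random walk trajectory. -/
def pathWt {n : ℕ} (γ : Fin (n + 1) → M.V) : ℝ := ∏ i : Fin n, M.p (γ i.castSucc) (γ i.succ)

/-- `P_z[H_x < H_O]`: the probability that the random walk started at `z` hits `x`
strictly before hitting the set `O`, expressed through a first-passage path decomposition. -/
def hitBefore (z x : M.V) (O : Set M.V) : ℝ :=
  ∑' n : ℕ, ∑' γ : Fin (n + 1) → M.V,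
    if γ 0 = z ∧ γ (Fin.last n) = x ∧ x ∉ O ∧
        (∀ i : Fin (n + 1), i ≠ Fin.last n → γ i ∉ O ∧ γ i ≠ x)
      then M.pathWt γ else 0

/-- Distance from a point to a set. -/
def dSet (x : M.V) (S : Set M.V) : ℝ := sInf (M.d x '' S)

/-! ### Discrete (rooted) loops

A rooted discrete loop visiting `m + 2` vertices (`m ≥ 0`), i.e. making at least two
jumps, encoded by its skeleton `Z_0, …, Z_{n-1}` (with `Z_n = Z_0`, indices mod `n`). -/

/-- The type of rooted discrete loops on `G` making `n = m + 2 ≥ 2` jumps. -/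
abbrev DLoop : Type := Σ m : ℕ, Fin (m + 2) → M.V

/-- The mass `(1/n) ∏_{0 ≤ i < n} λ_{x_i,x_{i+1}}/λ_{x_i}` that the loop measure `μ`
assigns to a given rooted discrete loop (its discrete skeleton intensity). -/
def dloopWt (γ : M.DLoop) : ℝ≥0∞ :=
  ENNReal.ofReal ((1 / ((γ.1 : ℝ) + 2)) * ∏ i : Fin (γ.1 + 2), M.p (γ.2 i) (γ.2 (i + 1)))

/-- The set of vertices visited by a discrete loop (`range(γ) ∩ G` for the
corresponding continuous loop). -/
def dloopRange (γ : M.DLoop) : Set M.V := Set.range γ.2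

/-- The loop measure `μ` evaluated on a set of (skeletons of) loops: since the events of
interest only depend on the vertices visited by a loop, the measure under `μ` of such an
event coincides with the total mass of the corresponding discrete skeletons. -/
def loopMeas (S : Set M.DLoop) : ℝ≥0∞ := ∑' γ : S, M.dloopWt γ

end WGraph

/-! ## Graphs equipped with an approximate renormalized lattice `Λ(L)` -/

structure LGraph extends WGraph where
  (Lat : ℝ → Set V)
  (Lat_base : ∀ L : ℝ, 1 ≤ L → o ∈ Lat L)
  (Lat_cover : ∀ L : ℝ, 1 ≤ L → ∀ x, ∃ y ∈ Lat L, d y x ≤ L)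
  (Lat_disj : ∀ L : ℝ, 1 ≤ L → ∀ y ∈ Lat L, ∀ z ∈ Lat L, y ≠ z →
    ∀ w, d y w ≤ L / 2 → ¬ d z w ≤ L / 2)
  (Lat_card : ∃ CΛ > (0:ℝ), ∀ L : ℝ, 1 ≤ L → ∀ (x : V) (N : ℕ), 1 ≤ N →
    {y | y ∈ Lat L ∧ d x y ≤ L * N}.Finite ∧
      ({y | y ∈ Lat L ∧ d x y ≤ L * N}.ncard : ℝ) ≤ CΛ * (N : ℝ) ^ α)

namespace LGraph

variable (M : LGraph)

/-- A path `π = (x_i)_{1 ≤ i ≤ M}` in `Λ(L)` from the base point `0` to `A ⊆ G`. -/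
def IsLatPath (L : ℝ) (A : Set M.V) {m : ℕ} (pa : Fin (m + 1) → M.V) : Prop :=
  pa 0 = M.o ∧ pa (Fin.last m) ∈ A ∧ (∀ i, pa i ∈ M.Lat L) ∧
    ∀ i : Fin m, ∃ x y, M.d (pa i.castSucc) x ≤ L ∧ M.d (pa i.succ) y ≤ L ∧ 0 < M.lam x y

/-- `𝒪 ⊆ G` is an `(L,R,n,κ)`-good obstacle: every path in `Λ(L)` from `0` to `B_R^c`
contains at least `n` points `y` (within `B_R`) with `cap(𝒪 ∩ B(y,L)) ≥ κ`. -/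
def GoodObstacle (O : Set M.V) (L R : ℝ) (n : ℝ) (κ : ℝ) : Prop :=
  ∀ (m : ℕ) (pa : Fin (m + 1) → M.V), M.IsLatPath L {y | R < M.d M.o y} pa →
    ∃ A : Finset M.V, (∀ y ∈ A, (∃ i, pa i = y) ∧ M.d M.o y ≤ R) ∧ n ≤ (A.card : ℝ) ∧
      ∀ y ∈ A, κ ≤ M.toWGraph.cap (O ∩ {z | M.d y z ≤ L})

/-- The layer `𝒜_k ⊆ Λ(L)` of lattice points whose `L`-ball meets the interior
boundary `∂B(0, C₁ k L)`. -/
def layer (C₁ L : ℝ) (k : ℕ) : Set M.V :=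
  {x | x ∈ M.Lat L ∧ ∃ y, M.d x y ≤ L ∧ M.d M.o y ≤ C₁ * k * L ∧
    ∃ z, 0 < M.lam y z ∧ C₁ * k * L < M.d M.o z}

/-- The annulus `𝔸_k = ∪_{x ∈ 𝒜_k} B(x,L)`. -/
def annulus (C₁ L : ℝ) (k : ℕ) : Set M.V := {v | ∃ x ∈ M.layer C₁ L k, M.d x v ≤ L}

end LGraph

/-! ## The Gaussian free field and its associated bond percolation `E^{≥a}` -/

/-- A transient weighted graph together with a Gaussian free field `φ` (law `ℙ`) and,
conditionally on `φ`, independent bond percolation configurations: each edge `{x,y}` is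
retained in `E^{≥a}` (i.e. `opn a`) independently with probability
`1 - exp(-2 λ_{x,y} (φ_x - a)_+ (φ_y - a)_+)`. -/
structure Model extends WGraph where
  (Ω : Type) [mΩ : MeasurableSpace Ω] (P : Measure Ω) (Pprob : IsProbabilityMeasure P)
  (φ : Ω → V → ℝ)
  (φ_meas : ∀ x, Measurable fun ω => φ ω x)
  -- `φ` is the centered Gaussian field with covariance the Green's function `g`
  (φ_gauss : ∀ (s : Finset V) (c : V → ℝ),
    Measure.map (fun ω => ∑ x ∈ s, c x * φ ω x) P =
      gaussianReal 0 (Real.toNNReal (∑ x ∈ s, ∑ y ∈ s, c x * c y * toWGraph.green x y)))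
  (opn : ℝ → Ω → V → V → Prop)
  (opn_symm : ∀ a ω x y, opn a ω x y → opn a ω y x)
  (opn_edge : ∀ a ω x y, opn a ω x y → 0 < lam x y)
  (opn_meas : ∀ a x y, MeasurableSet {ω | opn a ω x y})
  -- conditionally on `φ`, edges are open independently with the prescribed probabilities
  (opn_law : ∀ (a : ℝ) (s t : Finset (V × V)), Disjoint s t →
    (∀ e ∈ s ∪ t, ∀ f ∈ s ∪ t, e ≠ f → e ≠ Prod.swap f) →
    ∀ B : Set (V → ℝ), MeasurableSet B →
      P ({ω | φ ω ∈ B} ∩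
          {ω | (∀ e ∈ s, opn a ω e.1 e.2) ∧ (∀ e ∈ t, ¬ opn a ω e.1 e.2)}) =
      ∫⁻ ω in {ω | φ ω ∈ B},
        ENNReal.ofReal
          ((∏ e ∈ s,
            (1 - Real.exp (-(2 * lam e.1 e.2 * max (φ ω e.1 - a) 0 * max (φ ω e.2 - a) 0)))) *
           ∏ e ∈ t,
            Real.exp (-(2 * lam e.1 e.2 * max (φ ω e.1 - a) 0 * max (φ ω e.2 - a) 0))) ∂P)

attribute [instance] Model.mΩ

namespace Model

variable (M : Model)

/-- `x` and `y` are connected by a path of open edges of `E^{≥a}`. -/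
def conn (a : ℝ) (ω : M.Ω) (x y : M.V) : Prop :=
  Relation.ReflTransGen (fun u v => M.opn a ω u v) x y

/-- The open cluster `𝒦^a` of `x` in `E^{≥a}`. -/
def cluster (a : ℝ) (ω : M.Ω) (x : M.V) : Set M.V := {y | M.conn a ω x y}

/-- The probability of an event. -/
def prob (s : Set M.Ω) : ℝ := (M.P s).toReal

/-- The one-arm event `{x ↔ B(x,R)^c}` in `E^{≥0}`. -/
def armEvent (x : M.V) (R : ℝ) : Set M.Ω := {ω | ∃ y, R < M.d x y ∧ M.conn 0 ω x y}

/-- The truncated two-point function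
`τ_a^tr(x,y) = ℙ(x ↔ y in E^{≥a}, x ↮ ∞ in E^{≥a})`. -/
def tau (a : ℝ) (x y : M.V) : ℝ :=
  M.prob {ω | M.conn a ω x y ∧ (M.cluster a ω x).Finite}

/-- The truncated expected cluster volume `𝔼[|𝒦^a| 1_{|𝒦^a| < ∞}]`. -/
def clusterVol (a : ℝ) (x : M.V) : ℝ≥0∞ :=
  ∫⁻ ω, (if (M.cluster a ω x).Finite then ((M.cluster a ω x).ncard : ℝ≥0∞) else 0) ∂M.P

end Model

/-! ## The concrete case `G = ℤ³` with unit weights and the Euclidean distance -/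

/-- The vertex set `ℤ³`. -/
abbrev Z3 : Type := Fin 3 → ℤ

/-- Euclidean distance on `ℤ³`. -/
def dZ (x y : Z3) : ℝ := Real.sqrt (∑ i, ((x i : ℝ) - (y i : ℝ)) ^ 2)

/-- Unit weights: `λ_{x,y} = 1_{|x-y| = 1}`. -/
def lamZ (x y : Z3) : ℝ := if dZ x y = 1 then 1 else 0

/-- Transition probabilities of simple random walk on `ℤ³`. -/
def pZ (x y : Z3) : ℝ := lamZ x y / 6

/-- `n`-step transition probabilities of simple random walk on `ℤ³`. -/
def pstepZ : ℕ → Z3 → Z3 → ℝ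
  | 0, x, y => if x = y then 1 else 0
  | n + 1, x, y => ∑ᶠ z, pZ x z * pstepZ n z y

/-- The Green's function of simple random walk on `ℤ³` (with the normalization
`g(x,y) = λ_y^{-1} Σ_n P_x[Z_n = y]`, `λ_y = 6`). -/
def greenZ (x y : Z3) : ℝ := (∑' n, pstepZ n x y) / 6

/-- Euclidean distance between a point of `ℝ³` and a point of `ℤ³`. -/
def dMix (u : Fin 3 → ℝ) (z : Z3) : ℝ := Real.sqrt (∑ i, (u i - (z i : ℝ)) ^ 2)

/-- The Gaussian free field on `ℤ³` together with the associated bond percolation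
configurations `E^{≥a}`. -/
structure PercZ3 where
  (Ω : Type) [mΩ : MeasurableSpace Ω] (P : Measure Ω) (Pprob : IsProbabilityMeasure P)
  (φ : Ω → Z3 → ℝ)
  (φ_meas : ∀ x, Measurable fun ω => φ ω x)
  (φ_gauss : ∀ (s : Finset Z3) (c : Z3 → ℝ),
    Measure.map (fun ω => ∑ x ∈ s, c x * φ ω x) P =
      gaussianReal 0 (Real.toNNReal (∑ x ∈ s, ∑ y ∈ s, c x * c y * greenZ x y)))
  (opn : ℝ → Ω → Z3 → Z3 → Prop)
  (opn_symm : ∀ a ω x y, opn a ω x y → opn a ω y x)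
  (opn_edge : ∀ a ω x y, opn a ω x y → 0 < lamZ x y)
  (opn_meas : ∀ a x y, MeasurableSet {ω | opn a ω x y})
  (opn_law : ∀ (a : ℝ) (s t : Finset (Z3 × Z3)), Disjoint s t →
    (∀ e ∈ s ∪ t, ∀ f ∈ s ∪ t, e ≠ f → e ≠ Prod.swap f) →
    ∀ B : Set (Z3 → ℝ), MeasurableSet B →
      P ({ω | φ ω ∈ B} ∩
          {ω | (∀ e ∈ s, opn a ω e.1 e.2) ∧ (∀ e ∈ t, ¬ opn a ω e.1 e.2)}) =
      ∫⁻ ω in {ω | φ ω ∈ B},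
        ENNReal.ofReal
          ((∏ e ∈ s,
            (1 - Real.exp (-(2 * lamZ e.1 e.2 * max (φ ω e.1 - a) 0 * max (φ ω e.2 - a) 0)))) *
           ∏ e ∈ t,
            Real.exp (-(2 * lamZ e.1 e.2 * max (φ ω e.1 - a) 0 * max (φ ω e.2 - a) 0))) ∂P)

attribute [instance] PercZ3.mΩ

namespace PercZ3

variable (M : PercZ3)

/-- Connectivity by open edges in `E^{≥a}`. -/
def conn (a : ℝ) (ω : M.Ω) (x y : Z3) : Prop :=
  Relation.ReflTransGen (fun u v => M.opn a ω u v) x y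

/-- The open cluster of `x` in `E^{≥a}`. -/
def cluster (a : ℝ) (ω : M.Ω) (x : Z3) : Set Z3 := {y | M.conn a ω x y}

/-- The truncated two-point function on `ℤ³`. -/
def tau (a : ℝ) (x y : Z3) : ℝ :=
  ((M.P {ω | M.conn a ω x y ∧ (M.cluster a ω x).Finite}).toReal)

end PercZ3

/-! ## The metric graph (cable system) `𝔾̃`, killed Green's functions and killed GFFs -/

/-- The cable system `𝔾̃` over a graph `𝒢` (with renormalized lattice), together with the
killed Green's functions `g_U` and the laws `ℙ_U` of the Gaussian free field on open sets
`U ⊆ 𝔾̃` (the field killed outside `U`). -/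
structure CableG extends LGraph where
  (Gt : Type) [topGt : TopologicalSpace Gt] [msGt : MeasurableSpace Gt]
  (ι : V → Gt) (ι_inj : Function.Injective ι)
  (gU : Set Gt → Gt → Gt → ℝ)
  (gU_symm : ∀ U x y, gU U x y = gU U y x)
  (gU_zero : ∀ U x y, x ∉ U → gU U x y = 0)
  -- the Green's function of the full cable system restricts to `g` on `G`
  (gU_univ : ∀ x y : V, gU Set.univ (ι x) (ι y) = toWGraph.green x y)
  (PU : Set Gt → Measure (Gt → ℝ))
  (PU_prob : ∀ U, IsProbabilityMeasure (PU U))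
  -- `ℙ_U` is the law of the centered Gaussian field with covariance `g_U`
  (PU_gauss : ∀ (U : Set Gt) (s : Finset Gt) (c : Gt → ℝ),
    Measure.map (fun h => ∑ q ∈ s, c q * h q) (PU U) =
      gaussianReal 0 (Real.toNNReal (∑ q ∈ s, ∑ q' ∈ s, c q * c q' * gU U q q')))

attribute [instance] CableG.topGt CableG.msGt

/-- A probability space. -/
structure ProbSpace where
  (Ω : Type) [mΩ : MeasurableSpace Ω] (P : Measure Ω) (Pprob : IsProbabilityMeasure P)

attribute [instance] ProbSpace.mΩ

/-- A cable system as above, together with the laws of the vacant sets `Ṽ^u` of random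
interlacements at level `u > 0` on `𝔾̃`, axiomatized through their characterizing
properties: `Ṽ^u` is open and `ℙ(F ⊆ Ṽ^u) = exp(-u cap(F))` for finite `F ⊆ G`. -/
structure CableRI extends CableG where
  [msSetGt : MeasurableSpace (Set Gt)]
  (RIVacant : ℝ → Measure (Set Gt))
  (RIVacant_prob : ∀ u : ℝ, 0 < u → IsProbabilityMeasure (RIVacant u))
  (RIVacant_open : ∀ u : ℝ, 0 < u → ∀ᵐ S ∂(RIVacant u), @IsOpen Gt topGt S)
  (RIVacant_cap : ∀ u : ℝ, 0 < u → ∀ F : Finset V,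
    (RIVacant u {S | ∀ x ∈ F, ι x ∈ S}).toReal =
      Real.exp (-(u * toWGraph.capFinset F)))

attribute [instance] CableRI.msSetGt

/-! ## The Markovian loop soup at intensity `1/2` on the cable system -/

/-- The Poisson loop soup `ℒ` of intensity `(1/2)μ` on the cable system `𝔾̃` of a graph
`𝒢` (with renormalized lattice), under the law `Q`.  Continuous loops are axiomatized
through their ranges in `𝔾̃` and their discrete skeletons; the intensity measure `μ` is
pinned down via its (concrete) discrete skeleton intensity, and the law of the soup via
its void probabilities `Q(ℒ ∩ S = ∅) = exp(-μ(S)/2)`. -/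
structure LoopSoup extends LGraph where
  -- the cable system
  (Gt : Type) [topGt : TopologicalSpace Gt]
  (ι : V → Gt) (ι_inj : Function.Injective ι)
  (cable : V → V → Set Gt)
  (cable_symm : ∀ x y, cable x y = cable y x)
  (cable_ends : ∀ x y, 0 < lam x y → ι x ∈ cable x y ∧ ι y ∈ cable x y)
  (cable_vertices : ∀ x y, 0 < lam x y → ∀ v : V, ι v ∈ cable x y → v = x ∨ v = y)
  (cable_cover : ∀ q : Gt, (∃ v, q = ι v) ∨ ∃ x y, 0 < lam x y ∧ q ∈ cable x y)
  -- continuous loops on the cable system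
  (CLoop : Type) [msLoop : MeasurableSpace CLoop]
  (crange : CLoop → Set Gt)
  (traceG : CLoop → Set V)
  (trace_spec : ∀ γ, traceG γ = {v | ι v ∈ crange γ})
  -- the loop measure `μ` and its discrete skeleton
  (μC : Measure CLoop)
  (skel : CLoop → Option (Σ m : ℕ, Fin (m + 2) → V))
  (skel_spec : ∀ γ dγ, skel γ = some dγ → traceG γ = Set.range dγ.2)
  (skel_trivial : ∀ γ, skel γ = none → (traceG γ).Subsingleton)
  (μC_skel : ∀ S : Set (Σ m : ℕ, Fin (m + 2) → V),
    μC {γ | ∃ dγ ∈ S, skel γ = some dγ} = toWGraph.loopMeas S)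
  -- the loop soup and its law
  (Ωq : Type) [mΩq : MeasurableSpace Ωq] (Q : Measure Ωq) (Qprob : IsProbabilityMeasure Q)
  (soup : Ωq → Set CLoop)
  (soup_void : ∀ S : Set CLoop, MeasurableSet S →
    Q {ω | ∀ γ ∈ soup ω, γ ∉ S} = expNegE (μC S / 2))

attribute [instance] LoopSoup.topGt LoopSoup.msLoop LoopSoup.mΩq

namespace LoopSoup

variable (M : LoopSoup)

/-- Two loops of the soup are linked if they can be joined by a finite chain of loops of
the soup whose ranges successively intersect. -/
def linked (ω : M.Ωq) (γ γ' : M.CLoop) : Prop :=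
  Relation.ReflTransGen
    (fun g g' => g ∈ M.soup ω ∧ g' ∈ M.soup ω ∧ (M.crange g ∩ M.crange g').Nonempty) γ γ'

/-- The trace `𝒞` on `𝔾̃` of the cluster of loops of `ℒ` containing the base point `0`. -/
def C0 (ω : M.Ωq) : Set M.Gt :=
  {q | ∃ γ ∈ M.soup ω, q ∈ M.crange γ ∧
    ∃ γ₀ ∈ M.soup ω, M.ι M.o ∈ M.crange γ₀ ∧ M.linked ω γ γ₀}

/-- A loop is big (for the parameters `δ, L`) if `cap(range(γ) ∩ G) ≥ δ L^ν (log L)^{-b₂}`. -/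
def isBig (δ L : ℝ) (γ : M.CLoop) : Prop :=
  δ * L ^ M.ν * Real.log L ^ (-(bTwo M.ν M.α)) ≤ M.toWGraph.cap (M.traceG γ)

/-- The box `B̃(x,L) ⊆ 𝔾̃`: the ball `B(x,L)` together with all cables joining
neighbouring vertices of `B(x,L)`. -/
def Btilde (x : M.V) (L : ℝ) : Set M.Gt :=
  (M.ι '' {y | M.d x y ≤ L}) ∪
    ⋃ (u : M.V) (v : M.V) (_ : 0 < M.lam u v ∧ M.d x u ≤ L ∧ M.d x v ≤ L), M.cable u v

/-- A loop belongs to (the support of) `ℒ_k^b`: it is big and its range is contained in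
`B̃(x,L)` for some `x ∈ 𝒜_k`. -/
def inLayerBig (C₁ δ L : ℝ) (k : ℕ) (γ : M.CLoop) : Prop :=
  M.isBig δ L γ ∧ ∃ x ∈ M.toLGraph.layer C₁ L k, M.crange γ ⊆ M.Btilde x L

/-- The event `𝐁_k`: the cluster `𝒞` of `0` reaches `B_R^c` but contains no big loop of
`ℒ_k^b`. -/
def Bk (C₁ δ L R : ℝ) (k : ℕ) : Set M.Ωq :=
  {ω | (∃ y : M.V, R < M.d M.o y ∧ M.ι y ∈ M.C0 ω) ∧
    ∀ γ ∈ M.soup ω, M.inLayerBig C₁ δ L k γ → ¬ M.crange γ ⊆ M.C0 ω}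

/-- The number `N` of bad annuli among `k ∈ {1, …, ℓ}`. -/
def Nbad (C₁ δ L R : ℝ) (ℓ : ℕ) (ω : M.Ωq) : ℕ :=
  ((Finset.Icc 1 ℓ).filter fun k => ω ∈ M.Bk C₁ δ L R k).card

/-- The obstacle set `𝒪 = G ∩ 𝐼̃_D^b`: all vertices visited by a big loop of the soup
contained in a box `B̃(x,L)` with `x ∈ 𝒜_k` for some `k ∈ D`. -/
def obstacleD (C₁ δ L : ℝ) (D : Finset ℕ) (ω : M.Ωq) : Set M.V :=
  {v | ∃ γ ∈ M.soup ω, (∃ k ∈ D, M.inLayerBig C₁ δ L k γ) ∧ M.ι v ∈ M.crange γ}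

end LoopSoup

set_option linter.unusedSectionVars false

/-! ## Bernoulli percolation on a finite set of edges -/

namespace FinPerc

lemma reflTransGen_imp {V : Type*} {r s : V → V → Prop} (h : ∀ x y, r x y → s x y) {x y : V}
    (hxy : Relation.ReflTransGen r x y) : Relation.ReflTransGen s x y := by
  induction hxy with
  | refl => exact .refl
  | tail _ h2 ih => exact ih.tail (h _ _ h2)

section Mean

variable {E : Type*} [Fintype E] [DecidableEq E]

/-- The probability of the open edge set `o`, when the edge `e` is closed with probability `q e`. -/
def wt (q : E → ℝ) (o : Finset E) : ℝ := ∏ e, if e ∈ o then 1 - q e else q e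

/-- The expectation of `F` for independent edges closed with probabilities `q`. -/
def mean (q : E → ℝ) (F : Finset E → ℝ) : ℝ := ∑ o, wt q o * F o

/-- Average of `F` over the state of `e`, closed with probability `t`. -/
def avgAt (e : E) (t : ℝ) (F : Finset E → ℝ) (o : Finset E) : ℝ :=
  t * F (o.erase e) + (1 - t) * F (insert e o)

lemma sum_split (e : E) (f : Finset E → ℝ) :
    ∑ o, f o = ∑ o ∈ (Finset.univ.erase e).powerset, (f o + f (insert e o)) := by
  rw [Finset.sum_add_distrib, ← Finset.sum_powerset_insert (Finset.notMem_erase e _),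
    Finset.insert_erase (Finset.mem_univ e), Finset.powerset_univ]

lemma mean_update (q : E → ℝ) (e : E) (t : ℝ) (F : Finset E → ℝ) :
    mean (Function.update q e t) F = mean q (avgAt e t F) := by
  unfold mean
  rw [sum_split e, sum_split e]
  refine Finset.sum_congr rfl fun o ho => ?_
  have heo : e ∉ o := fun h => by simpa using Finset.mem_powerset.1 ho h
  have h1 : ∀ p : E → ℝ, wt p o =
      p e * ∏ e' ∈ Finset.univ.erase e, if e' ∈ o then 1 - p e' else p e' := fun p => by
    rw [wt, ← Finset.mul_prod_erase _ _ (Finset.mem_univ e), if_neg heo]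
  have h2 : ∀ p : E → ℝ, wt p (insert e o) =
      (1 - p e) * ∏ e' ∈ Finset.univ.erase e, if e' ∈ o then 1 - p e' else p e' := fun p => by
    rw [wt, ← Finset.mul_prod_erase _ _ (Finset.mem_univ e), if_pos (Finset.mem_insert_self e o)]
    congr 1
    refine Finset.prod_congr rfl fun e' he' => ?_
    simp [Finset.mem_insert, (Finset.mem_erase.1 he').1]
  have h3 : ∏ e' ∈ Finset.univ.erase e,
      (if e' ∈ o then 1 - Function.update q e t e' else Function.update q e t e') =
      ∏ e' ∈ Finset.univ.erase e, if e' ∈ o then 1 - q e' else q e' :=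
    Finset.prod_congr rfl fun e' he' => by
      simp [Function.update_of_ne (Finset.mem_erase.1 he').1]
  rw [h1, h2, h1, h2, h3, Function.update_self]
  simp only [avgAt, Finset.erase_eq_of_notMem heo, Finset.erase_insert heo,
    Finset.insert_idem]
  ring

lemma mean_avgAt (q : E → ℝ) (e : E) (F : Finset E → ℝ) :
    mean q F = mean q (avgAt e (q e) F) := by
  rw [← mean_update, Function.update_eq_self]

lemma wt_nonneg {q : E → ℝ} (h0 : ∀ e, 0 ≤ q e) (h1 : ∀ e, q e ≤ 1) (o : Finset E) :
    0 ≤ wt q o :=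
  Finset.prod_nonneg fun e _ => by
    split_ifs
    · linarith [h1 e]
    · exact h0 e

lemma mean_mono {q : E → ℝ} (h0 : ∀ e, 0 ≤ q e) (h1 : ∀ e, q e ≤ 1) {F H : Finset E → ℝ}
    (h : ∀ o, F o ≤ H o) : mean q F ≤ mean q H :=
  Finset.sum_le_sum fun o _ => mul_le_mul_of_nonneg_left (h o) (wt_nonneg h0 h1 o)

lemma mean_one (q : E → ℝ) : mean q (fun _ => 1) = 1 := by
  have h := Finset.prod_add (fun e => 1 - q e) q Finset.univ
  simp only [sub_add_cancel, Finset.prod_const_one, Finset.powerset_univ] at h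
  refine Eq.trans ?_ h.symm
  refine Finset.sum_congr rfl fun o _ => ?_
  rw [mul_one, wt, Finset.prod_ite]
  congr 1
  · exact Finset.prod_congr (by ext; simp) fun _ _ => rfl
  · exact Finset.prod_congr (by ext; simp) fun _ _ => rfl

lemma piecewise_insert_eq_update (s : Finset E) (e : E) (q q' : E → ℝ) :
    (insert e s).piecewise q' q = Function.update (s.piecewise q' q) e (q' e) := by
  rw [Finset.piecewise_insert]

/-- Lowering closing probabilities increases the expectation of increasing functions. -/
lemma mean_antitone {q q' : E → ℝ} (h0 : ∀ e, 0 ≤ q' e) (hq : ∀ e, q' e ≤ q e)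
    (h1 : ∀ e, q e ≤ 1) {F : Finset E → ℝ} (hF : Monotone F) : mean q F ≤ mean q' F := by
  have key : ∀ s : Finset E, mean q F ≤ mean (s.piecewise q' q) F := by
    intro s
    induction s using Finset.induction_on with
    | empty => simp
    | insert e s hes ih =>
      refine ih.trans ?_
      rw [piecewise_insert_eq_update, mean_update, mean_avgAt _ e]
      refine mean_mono (fun e' => ?_) (fun e' => ?_) fun o => ?_
      · by_cases h : e' ∈ s <;> simp [h, h0 e', (h0 e').trans (hq e')]
      · by_cases h : e' ∈ s <;> simp [h, h1 e', (hq e').trans (h1 e')]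
      · have : F (o.erase e) ≤ F (insert e o) :=
          hF ((Finset.erase_subset _ _).trans (Finset.subset_insert _ _))
        simp only [avgAt, Finset.piecewise_eq_of_notMem _ _ _ hes]
        nlinarith [hq e]
  simpa using key Finset.univ

/-- `F` does not depend on the state of the edge `e`. -/
def Ignores (F : Finset E → ℝ) (e : E) : Prop := ∀ o, F (o.erase e) = F o ∧ F (insert e o) = F o

lemma mean_congr {q q' : E → ℝ} {F : Finset E → ℝ} (h : ∀ e, q e ≠ q' e → Ignores F e) :
    mean q F = mean q' F := by
  have key : ∀ s : Finset E, mean q F = mean (s.piecewise q' q) F := by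
    intro s
    induction s using Finset.induction_on with
    | empty => simp
    | insert e s hes ih =>
      rw [ih, piecewise_insert_eq_update]
      by_cases he : q e = q' e
      · rw [← he, ← Finset.piecewise_eq_of_notMem s q' q hes, Function.update_eq_self]
      · rw [mean_update]
        congr 1
        funext o
        rw [avgAt, (h e he o).1, (h e he o).2]
        ring
  simpa using key Finset.univ

lemma mean_closed_mul (q : E → ℝ) (B : Finset E) {F : Finset E → ℝ} (hF : ∀ e ∈ B, Ignores F e) :
    mean q (fun o => if ∀ e ∈ B, e ∉ o then F o else 0) = (∏ e ∈ B, q e) * mean q F := by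
  induction B using Finset.induction_on with
  | empty => simp
  | insert e B heB ih =>
    rw [Finset.prod_insert heB, mul_assoc, ← ih fun e' he' => hF e' (Finset.mem_insert_of_mem he'),
      mean_avgAt q e]
    unfold mean
    rw [Finset.mul_sum]
    refine Finset.sum_congr rfl fun o _ => ?_
    have h1 : (∀ e' ∈ insert e B, e' ∉ o.erase e) ↔ ∀ e' ∈ B, e' ∉ o := by
      rw [Finset.forall_mem_insert, and_iff_right (by simp)]
      refine forall₂_congr fun e' he' => ?_
      have : e' ≠ e := fun h => heB (h ▸ he')
      simp [this]
    have h2 : ¬ ∀ e' ∈ insert e B, e' ∉ insert e o := by simp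
    simp only [avgAt, if_neg h2, h1, (hF e (Finset.mem_insert_self e B) o).1]
    ring

lemma mean_nonneg {q : E → ℝ} (h0 : ∀ e, 0 ≤ q e) (h1 : ∀ e, q e ≤ 1) {F : Finset E → ℝ}
    (h : ∀ o, 0 ≤ F o) : 0 ≤ mean q F :=
  Finset.sum_nonneg fun o _ => mul_nonneg (wt_nonneg h0 h1 o) (h o)

lemma mean_sum {κ : Type*} (s : Finset κ) (q : E → ℝ) (F : κ → Finset E → ℝ) :
    mean q (fun o => ∑ k ∈ s, F k o) = ∑ k ∈ s, mean q (F k) := by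
  simp only [mean, Finset.mul_sum]
  exact Finset.sum_comm

end Mean

section Cluster

variable {ι : Type*} [Fintype ι] [DecidableEq ι]

/-- The cluster of `z` in the open edge set `o`. -/
def cl (o : Finset (Sym2 ι)) (z : ι) : Finset ι :=
  Finset.univ.filter fun y => Relation.ReflTransGen (fun u v => s(u, v) ∈ o) z y

/-- `K` is connected to `z` by open edges inside `K`. -/
def inner (z : ι) (K : Finset ι) (o : Finset (Sym2 ι)) : Prop :=
  z ∈ K ∧ ∀ y ∈ K, Relation.ReflTransGen (fun u v => u ∈ K ∧ v ∈ K ∧ s(u, v) ∈ o) z y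

/-- The edges between `K` and its complement. -/
def bdry (K : Finset ι) : Finset (Sym2 ι) :=
  (K ×ˢ Kᶜ).image fun p => s(p.1, p.2)

lemma mem_bdry {K : Finset ι} {x y : ι} (hx : x ∈ K) (hy : y ∉ K) : s(x, y) ∈ bdry K :=
  Finset.mem_image.2 ⟨(x, y), by simp [hx, hy], rfl⟩

lemma prod_bdry (K : Finset ι) (f : Sym2 ι → ℝ) :
    ∏ e ∈ bdry K, f e = ∏ x ∈ K, ∏ y ∈ Kᶜ, f s(x, y) := by
  rw [bdry, Finset.prod_image, Finset.prod_product]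
  rintro ⟨a, b⟩ hab ⟨c, d⟩ hcd h
  simp only [Finset.coe_product, Finset.coe_compl, Set.mem_prod, Finset.mem_coe,
    Set.mem_compl_iff] at hab hcd
  simp only [Sym2.eq_iff] at h
  rcases h with ⟨rfl, rfl⟩ | ⟨rfl, rfl⟩
  · rfl
  · exact absurd hab.1 hcd.2

lemma cl_eq_iff (z : ι) (K : Finset ι) (o : Finset (Sym2 ι)) :
    cl o z = K ↔ inner z K o ∧ ∀ e ∈ bdry K, e ∉ o := by
  constructor
  · rintro rfl
    refine ⟨⟨by simp [cl, Relation.ReflTransGen.refl], fun y hy => ?_⟩, fun e he heo => ?_⟩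
    · have hy' : Relation.ReflTransGen (fun u v => s(u, v) ∈ o) z y := by simpa [cl] using hy
      clear hy
      induction hy' with
      | refl => exact .refl
      | tail h1 h2 ih => exact ih.tail ⟨by simpa [cl] using h1, by simpa [cl] using h1.tail h2, h2⟩
    · obtain ⟨⟨x, y⟩, hxy, rfl⟩ := Finset.mem_image.1 he
      simp only [Finset.mem_product, Finset.mem_compl, cl, Finset.mem_filter, Finset.mem_univ,
        true_and] at hxy
      exact hxy.2 (hxy.1.tail heo)
  · rintro ⟨⟨hz, hK⟩, hB⟩
    ext y
    simp only [cl, Finset.mem_filter, Finset.mem_univ, true_and]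
    constructor
    · intro h
      induction h with
      | refl => exact hz
      | tail h1 h2 ih =>
        by_contra hc
        exact hB _ (mem_bdry ih hc) h2
    · exact fun hy => reflTransGen_imp (fun _ _ h => h.2.2) (hK y hy)

/-- The probability that `K` is connected to `z` inside `K`. -/
def innerProb (q : Sym2 ι → ℝ) (z : ι) (K : Finset ι) : ℝ :=
  mean q fun o => if inner z K o then 1 else 0

/-- The probability that the cluster of `z` is `K`. -/
def clProb (q : Sym2 ι → ℝ) (z : ι) (K : Finset ι) : ℝ :=
  mean q fun o => if cl o z = K then 1 else 0

lemma inner_ignores (z : ι) (K : Finset ι) (e : Sym2 ι) (he : ¬ ∀ x ∈ e, x ∈ K) :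
    Ignores (fun o => if inner z K o then (1 : ℝ) else 0) e := by
  have h : ∀ o o' : Finset (Sym2 ι), (∀ e' ≠ e, e' ∈ o ↔ e' ∈ o') →
      (inner z K o ↔ inner z K o') := by
    intro o o' hoo
    have : (fun u v => u ∈ K ∧ v ∈ K ∧ s(u, v) ∈ o) = fun u v => u ∈ K ∧ v ∈ K ∧ s(u, v) ∈ o' := by
      funext u v
      refine propext (and_congr_right fun hu => and_congr_right fun hv => hoo _ ?_)
      rintro rfl
      exact he fun x hx => by rcases Sym2.mem_iff.1 hx with rfl | rfl <;> assumption
    simp only [inner, this]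
  intro o
  refine ⟨?_, ?_⟩
  · simp only [h (o.erase e) o fun e' he' => by simp [he']]
  · simp only [h (insert e o) o fun e' he' => by simp [he']]

lemma clProb_eq (q : Sym2 ι → ℝ) (z : ι) (K : Finset ι) :
    clProb q z K = (∏ x ∈ K, ∏ y ∈ Kᶜ, q s(x, y)) * innerProb q z K := by
  rw [clProb, innerProb, ← prod_bdry, ← mean_closed_mul q (bdry K)]
  · congr 1
    funext o
    by_cases h1 : inner z K o <;> by_cases h2 : ∀ e ∈ bdry K, e ∉ o <;> simp [cl_eq_iff, h1, h2]
  · intro e he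
    obtain ⟨⟨x, y⟩, hxy, rfl⟩ := Finset.mem_image.1 he
    refine inner_ignores z K _ fun h => ?_
    simp only [Finset.mem_product, Finset.mem_compl] at hxy
    exact hxy.2 (h y (Sym2.mem_mk_right x y))

lemma innerProb_congr {q q' : Sym2 ι → ℝ} (z : ι) (K : Finset ι)
    (h : ∀ x ∈ K, ∀ y ∈ K, q s(x, y) = q' s(x, y)) : innerProb q z K = innerProb q' z K := by
  refine mean_congr fun e he => inner_ignores z K e fun hK => he ?_
  induction e using Sym2.inductionOn with
  | hf x y => exact h x (hK x (Sym2.mem_mk_left x y)) y (hK y (Sym2.mem_mk_right x y))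

lemma innerProb_nonneg {q : Sym2 ι → ℝ} (h0 : ∀ e, 0 ≤ q e) (h1 : ∀ e, q e ≤ 1) (z : ι)
    (K : Finset ι) : 0 ≤ innerProb q z K :=
  mean_nonneg h0 h1 fun o => by split_ifs <;> norm_num

lemma innerProb_of_notMem (q : Sym2 ι → ℝ) {z : ι} {K : Finset ι} (h : z ∉ K) :
    innerProb q z K = 0 := by
  simp [innerProb, mean, inner, h]

lemma sum_clProb (q : Sym2 ι → ℝ) (z : ι) : ∑ K, clProb q z K = 1 := by
  simp only [clProb]
  rw [← mean_sum]
  simpa using mean_one q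

lemma clProb_nonneg {q : Sym2 ι → ℝ} (h0 : ∀ e, 0 ≤ q e) (h1 : ∀ e, q e ≤ 1) (z : ι)
    (K : Finset ι) : 0 ≤ clProb q z K :=
  mean_nonneg h0 h1 fun o => by split_ifs <;> norm_num

/-- A set in which some vertex other than the root has only almost surely closed edges is not
connected. -/
lemma innerProb_eq_zero {q : Sym2 ι → ℝ} {z v : ι} {K : Finset ι} (hv : v ∈ K) {y : ι}
    (hy : y ∈ K) (hyv : y ≠ v) (h : ∀ x, q s(x, v) = 1) : innerProb q z K = 0 := by
  refine Finset.sum_eq_zero fun o _ => ?_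
  by_cases hi : inner z K o
  · have : ∃ x, s(x, v) ∈ o := by
      by_cases hzv : z = v
      · subst hzv
        have := hi.2 y hy
        rcases Relation.ReflTransGen.cases_head this with h | ⟨c, hc, -⟩
        · exact absurd h.symm hyv
        · exact ⟨c, Sym2.eq_swap ▸ hc.2.2⟩
      · rcases Relation.ReflTransGen.cases_tail (hi.2 v hv) with h | ⟨c, -, hc⟩
        · exact absurd h.symm hzv
        · exact ⟨c, hc.2.2⟩
    obtain ⟨x, hx⟩ := this
    rw [wt, Finset.prod_eq_zero (Finset.mem_univ s(x, v)) (by rw [if_pos hx, h, sub_self]),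
      zero_mul]
  · simp only [if_neg hi, mul_zero]

end Cluster

end FinPerc

/-! ## Gaussian measures with a given precision matrix -/

namespace GaussMat

open Matrix

variable {ι : Type*} [Fintype ι] [DecidableEq ι]

lemma exists_transpose_mul_self {A : Matrix ι ι ℝ} (hA : A.PosDef) :
    ∃ B : Matrix ι ι ℝ, A = Bᵀ * B ∧ B.det ≠ 0 := by
  open scoped MatrixOrder Matrix.Norms.L2Operator in
  obtain ⟨B, hB⟩ := CStarAlgebra.nonneg_iff_eq_star_mul_self.mp hA.posSemidef.nonneg
  have hB' : A = Bᵀ * B := by rw [hB, star_eq_conjTranspose, conjTranspose_eq_transpose_of_trivial]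
  refine ⟨B, hB', fun h => ?_⟩
  have := hA.det_pos
  rw [hB', det_mul, h, mul_zero] at this
  exact lt_irrefl _ this

/-- The unnormalised Gaussian density with precision matrix `A`. -/
def dens (A : Matrix ι ι ℝ) (φ : ι → ℝ) : ℝ≥0∞ := ENNReal.ofReal (Real.exp (-(φ ⬝ᵥ A *ᵥ φ) / 2))

/-- The unnormalised Gaussian measure with precision matrix `A`. -/
def meas (A : Matrix ι ι ℝ) : Measure (ι → ℝ) := volume.withDensity (dens A)

lemma measurable_quad (A : Matrix ι ι ℝ) : Measurable fun φ : ι → ℝ => φ ⬝ᵥ A *ᵥ φ := by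
  unfold dotProduct mulVec dotProduct
  fun_prop

@[fun_prop]
lemma measurable_dens (A : Matrix ι ι ℝ) : Measurable (dens A) :=
  (((measurable_quad A).neg.div_const 2).exp).ennreal_ofReal

lemma pi_gaussianReal :
    (Measure.pi fun _ : ι => gaussianReal 0 1) =
      ENNReal.ofReal ((√(2 * π))⁻¹ ^ Fintype.card ι) • meas (1 : Matrix ι ι ℝ) := by
  have hpdf : ∀ x : ι → ℝ, ∏ i, gaussianPDFReal 0 1 (x i) =
      (√(2 * π))⁻¹ ^ Fintype.card ι * Real.exp (-(x ⬝ᵥ (1 : Matrix ι ι ℝ) *ᵥ x) / 2) := fun x => by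
    simp only [gaussianPDFReal, Finset.prod_mul_distrib, Finset.prod_const, Finset.card_univ,
      ← Real.exp_sum, one_mulVec, dotProduct, NNReal.coe_one, mul_one, sub_zero]
    rw [← Finset.sum_div, ← Finset.sum_neg_distrib]
    simp only [pow_two]
  refine Measure.pi_eq fun s hs => ?_
  rw [Measure.smul_apply, meas, withDensity_apply _ (.univ_pi hs), smul_eq_mul,
    ← lintegral_const_mul _ (measurable_dens _)]
  have h1 : ∀ x : ι → ℝ, ENNReal.ofReal ((√(2 * π))⁻¹ ^ Fintype.card ι) *
      dens (1 : Matrix ι ι ℝ) x = ENNReal.ofReal (∏ i, gaussianPDFReal 0 1 (x i)) := fun x => by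
    rw [hpdf, dens, ← ENNReal.ofReal_mul (by positivity)]
  simp only [h1]
  have h2 : Integrable fun x : ι → ℝ => ∏ i, gaussianPDFReal 0 1 (x i) :=
    Integrable.fintype_prod fun _ => integrable_gaussianPDFReal _ _
  rw [← ofReal_integral_eq_lintegral_ofReal h2.restrict
    (ae_of_all _ fun x => Finset.prod_nonneg fun i _ => gaussianPDFReal_nonneg _ _ _),
    ← integral_indicator (.univ_pi hs)]
  have h3 : (Set.univ.pi s).indicator (fun x : ι → ℝ => ∏ i, gaussianPDFReal 0 1 (x i)) =
      fun x => ∏ i, (s i).indicator (gaussianPDFReal 0 1) (x i) := by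
    funext x
    by_cases hx : x ∈ Set.univ.pi s
    · rw [Set.indicator_of_mem hx]
      exact Finset.prod_congr rfl fun i _ => by rw [Set.indicator_of_mem (hx i trivial)]
    · rw [Set.indicator_of_notMem hx]
      simp only [Set.mem_pi, Set.mem_univ, true_imp_iff, not_forall] at hx
      obtain ⟨i, hi⟩ := hx
      exact (Finset.prod_eq_zero (Finset.mem_univ i) (Set.indicator_of_notMem hi _)).symm
  rw [h3, integral_fintype_prod_volume_eq_prod (fun i => (s i).indicator (gaussianPDFReal 0 1)),
    ENNReal.ofReal_prod_of_nonneg fun i _ => integral_nonneg fun x =>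
      Set.indicator_nonneg (fun _ _ => gaussianPDFReal_nonneg _ _ _) _]
  refine Finset.prod_congr rfl fun i _ => ?_
  rw [gaussianReal_apply_eq_integral _ one_ne_zero, integral_indicator (hs i)]

lemma map_dotProduct_pi (v : ι → ℝ) :
    (Measure.pi fun _ : ι => gaussianReal 0 1).map (fun φ => v ⬝ᵥ φ) =
      gaussianReal 0 (Real.toNNReal (v ⬝ᵥ v)) := by
  have hm : Measurable fun φ : ι → ℝ => v ⬝ᵥ φ := by unfold dotProduct; fun_prop
  have : IsProbabilityMeasure ((Measure.pi fun _ : ι => gaussianReal 0 1).map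
    (fun φ => v ⬝ᵥ φ)) := Measure.isProbabilityMeasure_map hm.aemeasurable
  refine Measure.ext_of_charFun ?_
  funext t
  rw [charFun_gaussianReal, charFun_apply_real, integral_map hm.aemeasurable (by fun_prop)]
  have h1 : ∀ φ : ι → ℝ, Complex.exp (t * ((v ⬝ᵥ φ : ℝ) : ℂ) * Complex.I) =
      ∏ i, Complex.exp ((t * v i : ℝ) * (φ i : ℝ) * Complex.I) := fun φ => by
    rw [← Complex.exp_sum, ← Finset.sum_mul]
    congr 2
    simp only [dotProduct, Complex.ofReal_sum, Complex.ofReal_mul, Finset.mul_sum, mul_assoc]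
  simp only [h1]
  rw [integral_fintype_prod_eq_prod (fun i (x : ℝ) =>
    Complex.exp ((t * v i : ℝ) * (x : ℝ) * Complex.I))]
  have h2 : ∀ i, ∫ x : ℝ, Complex.exp ((t * v i : ℝ) * (x : ℝ) * Complex.I) ∂(gaussianReal 0 1) =
      Complex.exp (-((t * v i) ^ 2 / 2 : ℝ)) := fun i => by
    rw [← charFun_apply_real, charFun_gaussianReal]
    push_cast
    congr 1
    ring
  rw [Finset.prod_congr rfl fun i _ => h2 i, ← Complex.exp_sum]
  congr 1
  have h3 : ((Real.toNNReal (v ⬝ᵥ v) : ℝ≥0) : ℝ) = v ⬝ᵥ v :=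
    Real.coe_toNNReal _ (Finset.sum_nonneg fun i _ => mul_self_nonneg _)
  have h4 : (((Real.toNNReal (v ⬝ᵥ v) : ℝ≥0) : ℝ) : ℂ) = ((v ⬝ᵥ v : ℝ) : ℂ) := by rw [h3]
  rw [h4]
  simp only [dotProduct]
  push_cast
  rw [Finset.sum_mul, Finset.sum_div, mul_zero, zero_mul, zero_sub, ← Finset.sum_neg_distrib]
  exact Finset.sum_congr rfl fun i _ => by ring

lemma ext_of_map_dotProduct {μ ρ : Measure (ι → ℝ)} [IsFiniteMeasure μ] [IsFiniteMeasure ρ]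
    (h : ∀ v : ι → ℝ, μ.map (fun φ => v ⬝ᵥ φ) = ρ.map (fun φ => v ⬝ᵥ φ)) : μ = ρ := by
  refine Measure.ext_of_charFunDual ?_
  funext L
  rw [charFunDual_eq_charFun_map_one, charFunDual_eq_charFun_map_one]
  have : (L : (ι → ℝ) → ℝ) = fun φ => (fun i => L (Pi.single i 1)) ⬝ᵥ φ := by
    funext φ
    conv_lhs => rw [pi_eq_sum_univ' φ]
    rw [map_sum]
    refine Finset.sum_congr rfl fun i _ => ?_
    rw [map_smul, smul_eq_mul, mul_comm]
  rw [this, h]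

/-- The normalised Gaussian measure with precision matrix `A` has covariance `A⁻¹`. -/
theorem exists_law {A : Matrix ι ι ℝ} (hA : A.PosDef) :
    ∃ c : ℝ≥0∞, c ≠ 0 ∧ c ≠ ⊤ ∧ IsProbabilityMeasure (c • meas A) ∧
      ∀ v : ι → ℝ, (c • meas A).map (fun φ => v ⬝ᵥ φ) =
        gaussianReal 0 (Real.toNNReal (v ⬝ᵥ A⁻¹ *ᵥ v)) := by
  obtain ⟨B, hAB, hB⟩ := exists_transpose_mul_self hA
  have hBi : B⁻¹.det ≠ 0 := by
    rw [det_nonsing_inv, Ring.inverse_eq_inv']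
    exact inv_ne_zero hB
  have hBu : IsUnit B.det := isUnit_iff_ne_zero.2 hB
  set γ : Measure (ι → ℝ) := Measure.pi fun _ : ι => gaussianReal 0 1 with hγ
  have hm : Measurable fun ψ : ι → ℝ => B⁻¹ *ᵥ ψ := by
    unfold mulVec dotProduct; fun_prop
  have key : ∃ c : ℝ≥0∞, c ≠ 0 ∧ c ≠ ⊤ ∧ c • meas A = γ.map (fun ψ => B⁻¹ *ᵥ ψ) := by
    refine ⟨ENNReal.ofReal ((√(2 * π))⁻¹ ^ Fintype.card ι) *
      ENNReal.ofReal (abs (B⁻¹.det)⁻¹), ?_, ?_, ?_⟩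
    · have : 0 < |(B⁻¹.det)⁻¹| := by
        have := inv_ne_zero hBi
        positivity
      have h2 : 0 < (√(2 * π))⁻¹ ^ Fintype.card ι := by positivity
      simp only [ne_eq, mul_eq_zero, ENNReal.ofReal_eq_zero, not_or, not_le]
      exact ⟨h2, this⟩
    · exact ENNReal.mul_ne_top ENNReal.ofReal_ne_top ENNReal.ofReal_ne_top
    · ext s hs
      rw [Measure.map_apply hm hs, hγ, pi_gaussianReal, Measure.smul_apply, Measure.smul_apply,
        smul_eq_mul, smul_eq_mul, mul_assoc, meas, meas, withDensity_apply _ hs,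
        withDensity_apply _ (hm hs), ← lintegral_indicator hs, ← lintegral_indicator (hm hs)]
      congr 1
      have h1 := Real.map_matrix_volume_pi_eq_smul_volume_pi hBi
      have h2 : ∫⁻ φ, s.indicator (dens A) φ ∂(Measure.map (toLin' B⁻¹) volume) =
          ∫⁻ ψ, s.indicator (dens A) (B⁻¹ *ᵥ ψ) := by
        rw [lintegral_map ((measurable_dens A).indicator hs) (by exact hm)]
        rfl
      rw [h1, lintegral_smul_measure, smul_eq_mul] at h2
      have h3 : ∀ ψ, s.indicator (dens A) (B⁻¹ *ᵥ ψ) =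
          ((fun ψ => B⁻¹ *ᵥ ψ) ⁻¹' s).indicator (dens 1) ψ := fun ψ => by
        have : dens A (B⁻¹ *ᵥ ψ) = dens 1 ψ := by
          rw [dens, dens, hAB, ← mulVec_mulVec, mulVec_mulVec _ B B⁻¹, mul_nonsing_inv _ hBu,
            one_mulVec, dotProduct_mulVec, vecMul_transpose, mulVec_mulVec,
            mul_nonsing_inv _ hBu, one_mulVec]
        by_cases h : B⁻¹ *ᵥ ψ ∈ s
        · rw [Set.indicator_of_mem h, Set.indicator_of_mem (show ψ ∈ _ from h), this]
        · rw [Set.indicator_of_notMem h, Set.indicator_of_notMem (show ψ ∉ _ from h)]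
      simp only [h3] at h2
      rw [← h2]
  obtain ⟨c, hc0, hct, hc⟩ := key
  refine ⟨c, hc0, hct, ?_, fun v => ?_⟩
  · rw [hc]
    exact Measure.isProbabilityMeasure_map hm.aemeasurable
  · have hmv : Measurable fun φ : ι → ℝ => v ⬝ᵥ φ := by unfold dotProduct; fun_prop
    rw [hc, Measure.map_map hmv hm]
    have : ((fun φ => v ⬝ᵥ φ) ∘ fun ψ => B⁻¹ *ᵥ ψ) = fun ψ => (B⁻¹ᵀ *ᵥ v) ⬝ᵥ ψ := by
      funext ψ
      simp only [Function.comp, dotProduct_mulVec, mulVec_transpose]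
    rw [this, hγ, map_dotProduct_pi]
    congr 2
    rw [hAB, Matrix.mul_inv_rev, ← mulVec_mulVec, dotProduct_mulVec v, ← mulVec_transpose,
      transpose_nonsing_inv]

end GaussMat

/-! ## Potential theory of a finite symmetric M-matrix -/

namespace GaussMat

open Matrix

variable {ι : Type*} [Fintype ι] [DecidableEq ι] {A : Matrix ι ι ℝ}

lemma posDef_symm (hA : A.PosDef) (i j : ι) : A i j = A j i := by
  have := hA.isHermitian.apply i j
  simpa using this.symm

lemma bilin_comm (hA : A.PosDef) (x y : ι → ℝ) : x ⬝ᵥ A *ᵥ y = y ⬝ᵥ A *ᵥ x := by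
  have hT : Aᵀ = A := by
    ext i j
    exact posDef_symm hA j i
  rw [dotProduct_mulVec, ← mulVec_transpose, hT, dotProduct_comm]

lemma quad_nonneg (hA : A.PosDef) (x : ι → ℝ) : 0 ≤ x ⬝ᵥ A *ᵥ x := by
  simpa using hA.posSemidef.dotProduct_mulVec_nonneg x

lemma eq_zero_of_quad_nonpos (hA : A.PosDef) {x : ι → ℝ} (h : x ⬝ᵥ A *ᵥ x ≤ 0) : x = 0 := by
  by_contra hx
  have := hA.dotProduct_mulVec_pos hx
  rw [star_trivial] at this
  exact absurd h (not_le.2 this)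

lemma quad_add (hA : A.PosDef) (x y : ι → ℝ) :
    (x + y) ⬝ᵥ A *ᵥ (x + y) = x ⬝ᵥ A *ᵥ x + 2 * (y ⬝ᵥ A *ᵥ x) + y ⬝ᵥ A *ᵥ y := by
  rw [mulVec_add, add_dotProduct, dotProduct_add, dotProduct_add, bilin_comm hA x y]
  ring

/-- Existence for the Dirichlet problem `Aθ = ρ` on `s`, `θ = ψ` off `s`. -/
lemma exists_dirichlet (hA : A.PosDef) (s : Finset ι) (ψ ρ : ι → ℝ) :
    ∃ θ : ι → ℝ, (∀ i ∉ s, θ i = ψ i) ∧ ∀ i ∈ s, (A *ᵥ θ) i = ρ i := by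
  let T : (ι → ℝ) →ₗ[ℝ] (ι → ℝ) :=
    { toFun := fun θ i => if i ∈ s then (A *ᵥ θ) i else θ i
      map_add' := fun x y => by
        funext i
        by_cases h : i ∈ s <;> simp [h, mulVec_add]
      map_smul' := fun c x => by
        funext i
        by_cases h : i ∈ s <;> simp [h, mulVec_smul] }
  have hT : Function.Injective T := by
    refine (injective_iff_map_eq_zero T).2 fun θ hθ => eq_zero_of_quad_nonpos hA (le_of_eq ?_)
    refine Finset.sum_eq_zero fun i _ => ?_
    have := congrFun hθ i
    by_cases h : i ∈ s
    · have h' : (A *ᵥ θ) i = 0 := by simpa [T, h] using this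
      rw [h', mul_zero]
    · have h' : θ i = 0 := by simpa [T, h] using this
      rw [h', zero_mul]
  obtain ⟨θ, hθ⟩ := LinearMap.injective_iff_surjective.1 hT fun i => if i ∈ s then ρ i else ψ i
  refine ⟨θ, fun i hi => ?_, fun i hi => ?_⟩
  · simpa [T, hi] using congrFun hθ i
  · simpa [T, hi] using congrFun hθ i

lemma dirichlet_unique (hA : A.PosDef) (s : Finset ι) {θ θ' : ι → ℝ}
    (h1 : ∀ i ∉ s, θ i = θ' i) (h2 : ∀ i ∈ s, (A *ᵥ θ) i = (A *ᵥ θ') i) : θ = θ' := by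
  rw [← sub_eq_zero]
  refine eq_zero_of_quad_nonpos hA (le_of_eq (Finset.sum_eq_zero fun i _ => ?_))
  by_cases h : i ∈ s
  · rw [mulVec_sub, Pi.sub_apply (A *ᵥ θ), h2 i h, sub_self, mul_zero]
  · rw [Pi.sub_apply, h1 i h, sub_self, zero_mul]

/-- A positive definite matrix with nonpositive off-diagonal entries and nonnegative row sums. -/
structure IsMMat (A : Matrix ι ι ℝ) : Prop where
  posDef : A.PosDef
  offdiag : ∀ i j, i ≠ j → A i j ≤ 0
  row : ∀ i, 0 ≤ (A *ᵥ 1) i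

/-- Maximum principle. -/
lemma max_principle (hA : IsMMat A) {u : ι → ℝ} (h : ∀ x, 0 ≤ u x ∨ 0 ≤ (A *ᵥ u) x) (x : ι) :
    0 ≤ u x := by
  set m : ι → ℝ := fun x => max (-u x) 0 with hm
  set p : ι → ℝ := fun x => max (u x) 0 with hp
  have hup : u = p - m := by
    funext x
    simp only [hm, hp, Pi.sub_apply]
    rcases le_total (u x) 0 with h | h
    · rw [max_eq_right h, max_eq_left (by linarith)]; ring
    · rw [max_eq_left h, max_eq_right (by linarith)]; ring
  have h1 : 0 ≤ m ⬝ᵥ A *ᵥ u := Finset.sum_nonneg fun x _ => by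
    rcases h x with h | h
    · have : m x = 0 := max_eq_right (by linarith)
      rw [this, zero_mul]
    · exact mul_nonneg (le_max_right _ _) h
  have h2 : m ⬝ᵥ A *ᵥ p ≤ 0 := by
    refine Finset.sum_nonpos fun x _ => ?_
    rw [mulVec, dotProduct, Finset.mul_sum]
    refine Finset.sum_nonpos fun y _ => ?_
    by_cases hxy : x = y
    · subst hxy
      have : m x * p x = 0 := by
        simp only [hm, hp]
        rcases le_total (u x) 0 with h | h
        · rw [max_eq_right h, mul_zero]
        · rw [max_eq_right (by linarith : -u x ≤ 0), zero_mul]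
      exact le_of_eq (by linear_combination A x x * this)
    · exact mul_nonpos_of_nonneg_of_nonpos (le_max_right _ _)
        (mul_nonpos_of_nonpos_of_nonneg (hA.offdiag x y hxy) (le_max_right _ _))
  have h3 : m = 0 := by
    refine eq_zero_of_quad_nonpos hA.posDef ?_
    rw [hup, mulVec_sub, dotProduct_sub] at h1
    linarith
  have := congrFun h3 x
  simp only [hm, Pi.zero_apply] at this
  linarith [le_max_left (-u x) 0]

lemma mul_inv_of_posDef (hA : A.PosDef) : A * A⁻¹ = 1 :=
  mul_nonsing_inv _ (isUnit_iff_ne_zero.2 hA.det_pos.ne')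

lemma inv_mul_of_posDef (hA : A.PosDef) : A⁻¹ * A = 1 :=
  nonsing_inv_mul _ (isUnit_iff_ne_zero.2 hA.det_pos.ne')

lemma mulVec_inv_col (hA : A.PosDef) (y : ι) : A *ᵥ (fun x => A⁻¹ x y) = Pi.single y 1 := by
  have h := congrFun₂ (mul_inv_of_posDef hA)
  funext x
  have := h x y
  rw [mul_apply] at this
  rw [mulVec, dotProduct, this, one_apply, Pi.single_apply]

lemma inv_mulVec_mulVec (hA : A.PosDef) (u : ι → ℝ) : A⁻¹ *ᵥ (A *ᵥ u) = u := by
  rw [mulVec_mulVec, inv_mul_of_posDef hA, one_mulVec]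

lemma inv_nonneg' (hA : IsMMat A) (x y : ι) : 0 ≤ A⁻¹ x y :=
  max_principle hA (u := fun x => A⁻¹ x y) (fun x => Or.inr (by
    rw [mulVec_inv_col hA.posDef, Pi.single_apply]
    split_ifs <;> norm_num)) x

lemma inv_symm (hA : A.PosDef) (x y : ι) : A⁻¹ x y = A⁻¹ y x := posDef_symm hA.inv x y

lemma inv_diag_pos (hA : A.PosDef) (x : ι) : 0 < A⁻¹ x x := by
  have h := hA.inv.dotProduct_mulVec_pos (x := Pi.single x 1) (by
    intro h
    simpa using congrFun h x)
  simpa using h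

/-- The equilibrium potential of `K`. -/
def eqPot (A : Matrix ι ι ℝ) (K : Finset ι) : ι → ℝ :=
  if h : ∃ θ : ι → ℝ, (∀ i ∉ Kᶜ, θ i = (1 : ι → ℝ) i) ∧ ∀ i ∈ Kᶜ, (A *ᵥ θ) i = (0 : ι → ℝ) i
  then h.choose else 0

/-- The capacity of `K`. -/
def capM (A : Matrix ι ι ℝ) (K : Finset ι) : ℝ := ∑ x ∈ K, (A *ᵥ eqPot A K) x

/-- The Green's function killed on `F`. -/
def gKill (A : Matrix ι ι ℝ) (F : Finset ι) (y : ι) : ι → ℝ :=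
  if h : ∃ θ : ι → ℝ, (∀ i ∉ Fᶜ, θ i = (0 : ι → ℝ) i) ∧
    ∀ i ∈ Fᶜ, (A *ᵥ θ) i = (Pi.single y 1 : ι → ℝ) i
  then h.choose else 0

lemma eqPot_on (hA : A.PosDef) {K : Finset ι} {x : ι} (hx : x ∈ K) : eqPot A K x = 1 := by
  have h := exists_dirichlet hA Kᶜ 1 0
  rw [eqPot, dif_pos h]
  exact h.choose_spec.1 x (by simpa using hx)

lemma eqPot_off (hA : A.PosDef) {K : Finset ι} {x : ι} (hx : x ∉ K) : (A *ᵥ eqPot A K) x = 0 := by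
  have h := exists_dirichlet hA Kᶜ 1 0
  rw [eqPot, dif_pos h]
  exact h.choose_spec.2 x (by simpa using hx)

lemma gKill_on (hA : A.PosDef) {F : Finset ι} (y : ι) {x : ι} (hx : x ∈ F) : gKill A F y x = 0 := by
  have h := exists_dirichlet hA Fᶜ 0 (Pi.single y 1)
  rw [gKill, dif_pos h]
  exact h.choose_spec.1 x (by simpa using hx)

lemma gKill_off (hA : A.PosDef) {F : Finset ι} (y : ι) {x : ι} (hx : x ∉ F) :
    (A *ᵥ gKill A F y) x = (Pi.single y 1 : ι → ℝ) x := by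
  have h := exists_dirichlet hA Fᶜ 0 (Pi.single y 1)
  rw [gKill, dif_pos h]
  exact h.choose_spec.2 x (by simpa using hx)

lemma gKill_nonneg (hA : IsMMat A) (F : Finset ι) (y x : ι) : 0 ≤ gKill A F y x := by
  refine max_principle hA (fun x => ?_) x
  by_cases hx : x ∈ F
  · exact Or.inl (gKill_on hA.posDef y hx).ge
  · refine Or.inr ?_
    rw [gKill_off hA.posDef y hx, Pi.single_apply]
    split_ifs <;> norm_num

lemma gKill_le (hA : IsMMat A) (F : Finset ι) (y x : ι) : gKill A F y x ≤ A⁻¹ x y := by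
  have := max_principle hA (u := (fun x => A⁻¹ x y) - gKill A F y) (fun x => ?_) x
  · simpa using this
  by_cases hx : x ∈ F
  · left
    rw [Pi.sub_apply, gKill_on hA.posDef y hx, sub_zero]
    exact inv_nonneg' hA x y
  · right
    rw [mulVec_sub, Pi.sub_apply, gKill_off hA.posDef y hx, mulVec_inv_col hA.posDef, sub_self]

lemma eqPot_le_one (hA : IsMMat A) (K : Finset ι) (x : ι) : eqPot A K x ≤ 1 := by
  have := max_principle hA (u := 1 - eqPot A K) (fun x => ?_) x
  · simpa using this
  by_cases hx : x ∈ K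
  · left
    rw [Pi.sub_apply, eqPot_on hA.posDef hx, Pi.one_apply, sub_self]
  · right
    rw [mulVec_sub, Pi.sub_apply, eqPot_off hA.posDef hx, sub_zero]
    exact hA.row x

lemma eqMeas_nonneg (hA : IsMMat A) (K : Finset ι) (x : ι) : 0 ≤ (A *ᵥ eqPot A K) x := by
  by_cases hx : x ∈ K
  · have h1 : A *ᵥ eqPot A K = A *ᵥ 1 - A *ᵥ (1 - eqPot A K) := by rw [mulVec_sub]; abel
    have h2 : (A *ᵥ (1 - eqPot A K)) x ≤ 0 := by
      rw [mulVec, dotProduct]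
      refine Finset.sum_nonpos fun y _ => ?_
      by_cases hxy : x = y
      · subst hxy
        rw [Pi.sub_apply, eqPot_on hA.posDef hx, Pi.one_apply, sub_self, mul_zero]
      · refine mul_nonpos_of_nonpos_of_nonneg (hA.offdiag x y hxy) ?_
        rw [Pi.sub_apply, Pi.one_apply, sub_nonneg]
        exact eqPot_le_one hA K y
    rw [h1, Pi.sub_apply]
    linarith [hA.row x]
  · exact (eqPot_off hA.posDef hx).ge

lemma eqPot_eq_sum (hA : A.PosDef) (K : Finset ι) (z : ι) :
    eqPot A K z = ∑ x ∈ K, A⁻¹ z x * (A *ᵥ eqPot A K) x := by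
  conv_lhs => rw [← inv_mulVec_mulVec hA (eqPot A K)]
  rw [mulVec, dotProduct]
  refine (Finset.sum_subset (Finset.subset_univ K) fun x _ hx => ?_).symm
  rw [eqPot_off hA hx, mul_zero]

lemma capM_nonneg (hA : IsMMat A) (K : Finset ι) : 0 ≤ capM A K :=
  Finset.sum_nonneg fun x _ => eqMeas_nonneg hA K x

lemma quad_eqPot (hA : A.PosDef) (K : Finset ι) :
    eqPot A K ⬝ᵥ A *ᵥ eqPot A K = capM A K := by
  rw [dotProduct, capM]
  rw [← Finset.sum_subset (Finset.subset_univ K) fun x _ hx => by rw [eqPot_off hA hx, mul_zero]]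
  exact Finset.sum_congr rfl fun x hx => by rw [eqPot_on hA hx, one_mul]

lemma cauchy_schwarz (hA : A.PosDef) (x y : ι → ℝ) :
    (x ⬝ᵥ A *ᵥ y) ^ 2 ≤ (x ⬝ᵥ A *ᵥ x) * (y ⬝ᵥ A *ᵥ y) := by
  by_cases hy : y ⬝ᵥ A *ᵥ y = 0
  · have := eq_zero_of_quad_nonpos hA hy.le
    subst this
    simp
  · have hpos : 0 < y ⬝ᵥ A *ᵥ y := lt_of_le_of_ne (quad_nonneg hA y) (Ne.symm hy)
    set t := (x ⬝ᵥ A *ᵥ y) / (y ⬝ᵥ A *ᵥ y) with ht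
    have h := quad_nonneg hA (x + (-t) • y)
    rw [quad_add hA, mulVec_smul, smul_dotProduct, dotProduct_smul, smul_dotProduct,
      bilin_comm hA y x] at h
    simp only [smul_eq_mul] at h
    have h2 : t * (y ⬝ᵥ A *ᵥ y) = x ⬝ᵥ A *ᵥ y := div_mul_cancel₀ _ hy
    nlinarith [h, h2, hpos]

lemma card_sq_le_capM_mul (hA : IsMMat A) {K K' : Finset ι} (hK : K' ⊆ K) :
    (K'.card : ℝ) ^ 2 ≤ capM A K * ∑ x ∈ K', ∑ y ∈ K', A⁻¹ x y := by
  set m : ι → ℝ := fun x => if x ∈ K' then 1 else 0 with hm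
  have h1 : m ⬝ᵥ A⁻¹ *ᵥ (A *ᵥ eqPot A K) = K'.card := by
    rw [inv_mulVec_mulVec hA.posDef, dotProduct]
    simp only [hm, ite_mul, one_mul, zero_mul, Finset.sum_ite_mem, Finset.univ_inter]
    rw [Finset.sum_congr rfl fun x hx => eqPot_on hA.posDef (hK hx)]
    simp
  have h2 : m ⬝ᵥ A⁻¹ *ᵥ m = ∑ x ∈ K', ∑ y ∈ K', A⁻¹ x y := by
    simp only [hm, dotProduct, mulVec, ite_mul, one_mul, zero_mul, Finset.sum_ite_mem,
      Finset.univ_inter, mul_ite, mul_one, mul_zero]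
  have h3 := cauchy_schwarz hA.posDef.inv m (A *ᵥ eqPot A K)
  rw [h1, h2, inv_mulVec_mulVec hA.posDef, dotProduct_comm, quad_eqPot hA.posDef] at h3
  linarith

lemma eqPot_singleton (hA : A.PosDef) (v z : ι) : eqPot A {v} z = A⁻¹ z v / A⁻¹ v v := by
  have h1 := eqPot_eq_sum hA {v} z
  have h2 := eqPot_eq_sum hA {v} v
  rw [Finset.sum_singleton] at h1 h2
  rw [eqPot_on hA (Finset.mem_singleton_self v)] at h2
  rw [h1, eq_div_iff (inv_diag_pos hA v).ne']
  linear_combination -A⁻¹ z v * h2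

lemma eqPot_pair (hA : IsMMat A) {v v' : ι} (hv : v ≠ v') (z : ι) :
    eqPot A {v} z + eqPot A {v'} z - eqPot A {v, v'} z ≤
      A⁻¹ v v' * (A⁻¹ z v + A⁻¹ z v') / (A⁻¹ v v * A⁻¹ v' v') := by
  have h1 := eqPot_eq_sum hA.posDef {v, v'} z
  have h2 := eqPot_eq_sum hA.posDef {v, v'} v
  have h3 := eqPot_eq_sum hA.posDef {v, v'} v'
  rw [Finset.sum_pair hv] at h1 h2 h3
  rw [eqPot_on hA.posDef (by simp)] at h2
  rw [eqPot_on hA.posDef (by simp)] at h3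
  rw [eqPot_singleton hA.posDef, eqPot_singleton hA.posDef, h1]
  set e := (A *ᵥ eqPot A {v, v'}) v
  set e' := (A *ᵥ eqPot A {v, v'}) v'
  have he : 0 ≤ e := eqMeas_nonneg hA _ _
  have he' : 0 ≤ e' := eqMeas_nonneg hA _ _
  have p1 := inv_diag_pos hA.posDef v
  have p2 := inv_diag_pos hA.posDef v'
  have q1 := inv_nonneg' hA v v'
  have q2 := inv_nonneg' hA z v
  have q3 := inv_nonneg' hA z v'
  rw [inv_symm hA.posDef v' v] at h3
  set a := A⁻¹ v v
  set b := A⁻¹ v' v'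
  set g := A⁻¹ v v'
  have k1 : b * e' ≤ 1 := by nlinarith
  have k2 : a * e ≤ 1 := by nlinarith
  rw [show A⁻¹ z v / a + A⁻¹ z v' / b - (A⁻¹ z v * e + A⁻¹ z v' * e') =
    (g * (A⁻¹ z v * (b * e') + A⁻¹ z v' * (a * e))) / (a * b) by
      field_simp
      linear_combination A⁻¹ z v * b * h2 + A⁻¹ z v' * a * h3]
  gcongr <;> nlinarith

end GaussMat

/-! ## A random set whose hitting probabilities are equilibrium potentials -/

namespace GaussMat

open Matrix

variable {ι : Type*} [Fintype ι] [DecidableEq ι] {A : Matrix ι ι ℝ}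

/-- Transition probabilities of the (killed) walk attached to `A`. -/
def step (A : Matrix ι ι ℝ) (x y : ι) : ℝ := if x = y then 0 else -A x y / A x x

/-- Probability of avoiding `K` up to time `n`. -/
def avoid (A : Matrix ι ι ℝ) (K : Finset ι) : ℕ → ι → ℝ
  | 0, x => if x ∈ K then 0 else 1
  | n + 1, x => if x ∈ K then 0 else (1 - ∑ y, step A x y) + ∑ y, step A x y * avoid A K n y

lemma diag_pos (hA : A.PosDef) (x : ι) : 0 < A x x := by
  have h := hA.dotProduct_mulVec_pos (x := Pi.single x 1) (by
    intro h
    simpa using congrFun h x)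
  simpa using h

lemma mulVec_eq_step (hA : A.PosDef) (u : ι → ℝ) (x : ι) :
    (A *ᵥ u) x = A x x * (u x - ∑ y, step A x y * u y) := by
  have h := (diag_pos hA x).ne'
  rw [mul_sub, Finset.mul_sum, mulVec, dotProduct]
  rw [← Finset.add_sum_erase _ _ (Finset.mem_univ x), ← Finset.add_sum_erase
    (a := x) Finset.univ (fun y => A x x * (step A x y * u y)) (Finset.mem_univ x)]
  have h2 : ∑ y ∈ Finset.univ.erase x, A x x * (step A x y * u y) =
      - ∑ y ∈ Finset.univ.erase x, A x y * u y := by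
    rw [← Finset.sum_neg_distrib]
    refine Finset.sum_congr rfl fun y hy => ?_
    rw [step, if_neg (Finset.ne_of_mem_erase hy).symm]
    field_simp
  rw [h2]
  simp [step]

lemma step_nonneg (hA : IsMMat A) (x y : ι) : 0 ≤ step A x y := by
  unfold step
  split_ifs with h
  · exact le_rfl
  · exact div_nonneg (by linarith [hA.offdiag x y h]) (diag_pos hA.posDef x).le

lemma sum_step_le (hA : IsMMat A) (x : ι) : ∑ y, step A x y ≤ 1 := by
  have h := hA.row x
  rw [mulVec_eq_step hA.posDef] at h
  have := nonneg_of_mul_nonneg_right h (diag_pos hA.posDef x)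
  simp only [Pi.one_apply, mul_one] at this
  linarith

lemma avoid_nonneg (hA : IsMMat A) (K : Finset ι) (n : ℕ) (x : ι) : 0 ≤ avoid A K n x := by
  induction n generalizing x with
  | zero => unfold avoid; split_ifs <;> norm_num
  | succ n ih =>
    unfold avoid
    split_ifs
    · exact le_rfl
    · have := sum_step_le hA x
      have := Finset.sum_nonneg fun y (_ : y ∈ Finset.univ) => mul_nonneg (step_nonneg hA x y) (ih y)
      linarith

lemma avoid_succ_le (hA : IsMMat A) (K : Finset ι) (n : ℕ) (x : ι) :
    avoid A K (n + 1) x ≤ avoid A K n x := by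
  induction n generalizing x with
  | zero =>
    simp only [avoid]
    split_ifs
    · exact le_rfl
    · have : ∑ y, step A x y * (if y ∈ K then (0:ℝ) else 1) ≤ ∑ y, step A x y :=
        Finset.sum_le_sum fun y _ => mul_le_of_le_one_right (step_nonneg hA x y)
          (by split_ifs <;> norm_num)
      linarith
  | succ n ih =>
    rw [avoid, avoid]
    split_ifs
    · exact le_rfl
    · gcongr with y
      · exact step_nonneg hA x y
      · exact ih y

lemma tendsto_avoid (hA : IsMMat A) (K : Finset ι) (x : ι) :
    Tendsto (fun n => avoid A K n x) atTop (𝓝 (1 - eqPot A K x)) := by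
  have h1 : ∀ x, ∃ l, Tendsto (fun n => avoid A K n x) atTop (𝓝 l) := fun x =>
    ⟨_, tendsto_atTop_ciInf (antitone_nat_of_succ_le fun n => avoid_succ_le hA K n x)
      ⟨0, by rintro _ ⟨n, rfl⟩; exact avoid_nonneg hA K n x⟩⟩
  choose l hl using h1
  have h2 : ∀ x, l x = if x ∈ K then 0 else (1 - ∑ y, step A x y) + ∑ y, step A x y * l y := by
    intro x
    refine tendsto_nhds_unique ((tendsto_add_atTop_iff_nat 1).2 (hl x)) ?_
    simp only [avoid]
    split_ifs
    · exact tendsto_const_nhds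
    · exact tendsto_const_nhds.add (tendsto_finsetSum _ fun y _ => tendsto_const_nhds.mul (hl y))
  have h3 : l = 1 - eqPot A K := by
    refine dirichlet_unique hA.posDef Kᶜ (fun i hi => ?_) (fun i hi => ?_)
    · have hi : i ∈ K := by simpa using hi
      rw [h2, if_pos hi, Pi.sub_apply, eqPot_on hA.posDef hi, Pi.one_apply, sub_self]
    · have hi : i ∉ K := by simpa using hi
      rw [mulVec_sub, Pi.sub_apply, eqPot_off hA.posDef hi, sub_zero, mulVec_eq_step hA.posDef,
        mulVec_eq_step hA.posDef]
      conv_lhs => rw [h2 i, if_neg hi]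
      simp
  have := hl x
  rwa [h3] at this

lemma exists_law_avoid (hA : IsMMat A) (n : ℕ) (x : ι) : ∃ ρ : Finset ι → ℝ, (∀ F, 0 ≤ ρ F) ∧
    ∑ F, ρ F = 1 ∧ ∀ K, (∑ F, ρ F * if Disjoint F K then 1 else 0) = avoid A K n x := by
  induction n generalizing x with
  | zero =>
    refine ⟨fun F => if F = {x} then 1 else 0, fun F => by positivity, by simp, fun K => ?_⟩
    simp only [avoid, ite_mul, one_mul, zero_mul, Finset.sum_ite_eq', Finset.mem_univ, if_true,
      Finset.disjoint_singleton_left, ite_not]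
  | succ n ih =>
    choose ρ h0 h1 h2 using ih
    have key : ∀ f : Finset ι → ℝ, (∑ F, ((1 - ∑ y, step A x y) * (if F = {x} then 1 else 0) +
        ∑ y, step A x y * ∑ F', ρ y F' * if insert x F' = F then 1 else 0) * f F) =
        (1 - ∑ y, step A x y) * f {x} + ∑ y, step A x y * ∑ F', ρ y F' * f (insert x F') := by
      intro f
      simp only [add_mul, Finset.sum_add_distrib]
      congr 1
      · simp [ite_mul]
      · simp only [Finset.sum_mul, Finset.mul_sum]
        rw [Finset.sum_comm]
        refine Finset.sum_congr rfl fun y _ => ?_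
        rw [Finset.sum_comm]
        refine Finset.sum_congr rfl fun F' _ => ?_
        simp [mul_assoc]
    refine ⟨fun F => (1 - ∑ y, step A x y) * (if F = {x} then 1 else 0) +
        ∑ y, step A x y * ∑ F', ρ y F' * if insert x F' = F then 1 else 0,
      fun F => ?_, ?_, fun K => ?_⟩
    rotate_left 1
    · have := key (fun _ => 1)
      simp only [mul_one] at this
      rw [this]
      simp [h1]
    · rw [key (fun F => if Disjoint F K then 1 else 0), avoid]
      by_cases hx : x ∈ K
      · simp [hx]
      · simp only [hx, Finset.disjoint_singleton_left, Finset.disjoint_insert_left, h2,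
          not_false_eq_true, true_and, if_true, if_false, mul_one]
    · have := sum_step_le hA x
      refine add_nonneg (mul_nonneg (by linarith) (by positivity)) (Finset.sum_nonneg fun y _ =>
        mul_nonneg (step_nonneg hA x y) (Finset.sum_nonneg fun F' _ => mul_nonneg (h0 _ _)
          (by positivity)))

/-- The law of the range of the walk started at `z`. -/
lemma exists_range_law (hA : IsMMat A) (z : ι) : ∃ ρ : Finset ι → ℝ, (∀ F, 0 ≤ ρ F) ∧
    ∑ F, ρ F = 1 ∧ ∀ K, (∑ F, ρ F * if Disjoint F K then 1 else 0) = 1 - eqPot A K z := by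
  choose ρ h0 h1 h2 using fun n => exists_law_avoid hA n z
  obtain ⟨l, hl, f, hf, hlim⟩ := (isCompact_stdSimplex ℝ (Finset ι)).tendsto_subseq
    (x := ρ) (fun n => ⟨h0 n, h1 n⟩)
  refine ⟨l, hl.1, hl.2, fun K => ?_⟩
  refine tendsto_nhds_unique (f := fun n => ∑ F, ρ (f n) F * if Disjoint F K then 1 else 0)
    (l := atTop) ?_ ?_
  · exact tendsto_finsetSum _ fun F _ => (tendsto_pi_nhds.1 hlim F).mul_const _
  · simp only [h2]
    exact (tendsto_avoid hA K z).comp hf.tendsto_atTop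

lemma range_law_mem (hA : IsMMat A) {z : ι} {ρ : Finset ι → ℝ} (h1 : ∑ F, ρ F = 1)
    (h2 : ∀ K, (∑ F, ρ F * if Disjoint F K then 1 else 0) = 1 - eqPot A K z) (v : ι) :
    (∑ F, ρ F * if v ∈ F then 1 else 0) = A⁻¹ z v / A⁻¹ v v := by
  have h := h2 {v}
  rw [eqPot_singleton hA.posDef, ← h1, eq_sub_iff_add_eq, ← eq_sub_iff_add_eq'] at h
  rw [h, ← Finset.sum_sub_distrib]
  refine Finset.sum_congr rfl fun F _ => ?_
  by_cases hv : v ∈ F <;> simp [hv, h1]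

lemma range_law_pair (hA : IsMMat A) {z : ι} {ρ : Finset ι → ℝ} (h1 : ∑ F, ρ F = 1)
    (h2 : ∀ K, (∑ F, ρ F * if Disjoint F K then 1 else 0) = 1 - eqPot A K z) {v v' : ι}
    (hv : v ≠ v') : (∑ F, ρ F * if v ∈ F ∧ v' ∈ F then 1 else 0) ≤
      A⁻¹ v v' * (A⁻¹ z v + A⁻¹ z v') / (A⁻¹ v v * A⁻¹ v' v') := by
  refine le_trans (le_of_eq ?_) (eqPot_pair hA hv z)
  have e1 := h2 {v}
  have e2 := h2 {v'}
  have e3 := h2 {v, v'}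
  rw [show eqPot A {v} z + eqPot A {v'} z - eqPot A {v, v'} z =
    1 - (1 - eqPot A {v} z) - (1 - eqPot A {v'} z) + (1 - eqPot A {v, v'} z) by ring,
    ← e1, ← e2, ← e3, ← h1, ← Finset.sum_sub_distrib, ← Finset.sum_sub_distrib,
    ← Finset.sum_add_distrib]
  refine Finset.sum_congr rfl fun F _ => ?_
  by_cases h : v ∈ F <;> by_cases h' : v' ∈ F <;> simp [h, h', h1]

end GaussMat

/-! ## Unions of independent random sets and a second moment bound -/

namespace GaussMat

open Matrix

variable {ι : Type*} [Fintype ι] [DecidableEq ι] {A : Matrix ι ι ℝ}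

/-- The law of a union of `N` independent copies of a random set. -/
lemma exists_union_law {ρ : Finset ι → ℝ} (h0 : ∀ F, 0 ≤ ρ F) (h1 : ∑ F, ρ F = 1) (N : ℕ) :
    ∃ ρN : Finset ι → ℝ, (∀ F, 0 ≤ ρN F) ∧ ∑ F, ρN F = 1 ∧
      (∀ K, (∑ F, ρN F * if Disjoint F K then 1 else 0) =
        (∑ F, ρ F * if Disjoint F K then 1 else 0) ^ N) ∧
      ∀ Q : Finset ι → Prop, (∀ F F', F ⊆ F' → Q F → Q F') →
        (∑ F, ρN F * if Q F then 0 else 1) ≤ (∑ F, ρ F * if Q F then 0 else 1) ^ N := by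
  induction N with
  | zero =>
    refine ⟨fun F => if F = ∅ then 1 else 0, fun F => by positivity, by simp, fun K => ?_,
      fun Q _ => ?_⟩
    · simp only [ite_mul, one_mul, zero_mul, Finset.sum_ite_eq', Finset.mem_univ, if_true]
      simp
    · simp only [ite_mul, one_mul, zero_mul, Finset.sum_ite_eq', Finset.mem_univ, if_true]
      split_ifs <;> simp
  | succ N ih =>
    obtain ⟨ρN, k0, k1, k2, k3⟩ := ih
    have key : ∀ f : Finset ι → ℝ,
        (∑ F, (∑ F₁, ∑ F₂, ρN F₁ * ρ F₂ * if F₁ ∪ F₂ = F then 1 else 0) * f F) =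
        ∑ F₁, ∑ F₂, ρN F₁ * ρ F₂ * f (F₁ ∪ F₂) := by
      intro f
      simp only [Finset.sum_mul]
      rw [Finset.sum_comm]
      refine Finset.sum_congr rfl fun F₁ _ => ?_
      rw [Finset.sum_comm]
      refine Finset.sum_congr rfl fun F₂ _ => ?_
      simp [mul_assoc]
    refine ⟨fun F => ∑ F₁, ∑ F₂, ρN F₁ * ρ F₂ * if F₁ ∪ F₂ = F then 1 else 0, fun F => ?_, ?_,
      fun K => ?_, fun Q hQ => ?_⟩
    · exact Finset.sum_nonneg fun _ _ => Finset.sum_nonneg fun _ _ =>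
        mul_nonneg (mul_nonneg (k0 _) (h0 _)) (by positivity)
    · have := key (fun _ => 1)
      simp only [mul_one] at this
      rw [this, ← Finset.sum_mul_sum, h1, k1, mul_one]
    · rw [key (fun F => if Disjoint F K then 1 else 0), pow_succ, ← k2 K, Finset.sum_mul_sum]
      refine Finset.sum_congr rfl fun F₁ _ => Finset.sum_congr rfl fun F₂ _ => ?_
      by_cases a : Disjoint F₁ K <;> by_cases b : Disjoint F₂ K <;>
        simp [Finset.disjoint_union_left, a, b]
    · rw [key (fun F => if Q F then 0 else 1), pow_succ]
      refine le_trans ?_ (mul_le_mul_of_nonneg_right (k3 Q hQ) (Finset.sum_nonneg fun F _ =>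
        mul_nonneg (h0 F) (by positivity)))
      rw [Finset.sum_mul_sum]
      refine Finset.sum_le_sum fun F₁ _ => Finset.sum_le_sum fun F₂ _ => ?_
      rw [show ρN F₁ * (if Q F₁ then 0 else 1) * (ρ F₂ * if Q F₂ then 0 else 1) =
        ρN F₁ * ρ F₂ * ((if Q F₁ then 0 else 1) * if Q F₂ then 0 else 1) by ring]
      refine mul_le_mul_of_nonneg_left ?_ (mul_nonneg (k0 _) (h0 _))
      by_cases a : Q F₁
      · rw [if_pos (hQ _ _ Finset.subset_union_left a)]
        positivity
      · by_cases b : Q F₂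
        · rw [if_pos (hQ _ _ Finset.subset_union_right b)]
          positivity
        · simp only [a, b, if_false, mul_one]
          split_ifs <;> norm_num

lemma weighted_cauchy_schwarz {Ω : Type*} [Fintype Ω] {ρ : Ω → ℝ} (h0 : ∀ F, 0 ≤ ρ F)
    (f g : Ω → ℝ) : (∑ F, ρ F * (f F * g F)) ^ 2 ≤ (∑ F, ρ F * f F ^ 2) * ∑ F, ρ F * g F ^ 2 := by
  have := Finset.sum_mul_sq_le_sq_mul_sq Finset.univ (fun F => √(ρ F) * f F)
    (fun F => √(ρ F) * g F)
  have e : ∀ F, √(ρ F) ^ 2 = ρ F := fun F => Real.sq_sqrt (h0 F)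
  simp only [mul_pow, e] at this
  rwa [show ∑ F, ρ F * (f F * g F) = ∑ F, √(ρ F) * f F * (√(ρ F) * g F) from
    Finset.sum_congr rfl fun F _ => by linear_combination -(f F * g F) * e F]

/-- A second moment bound with a control of the energy. -/
lemma second_moment {Ω : Type*} [Fintype Ω] {ρ X E : Ω → ℝ} (h0 : ∀ F, 0 ≤ ρ F)
    (hE : ∀ F, 0 ≤ E F) {m₁ m₂ e H κ : ℝ} (hm₁ : 0 ≤ m₁) (hκ : 0 ≤ κ)
    (he : 0 ≤ e) (h1 : m₁ ≤ ∑ F, ρ F * X F) (h2 : ∑ F, ρ F * X F ^ 2 ≤ m₂) (h3 : ∑ F, ρ F * E F ≤ e)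
    (h4 : (∑ F, ρ F * if 0 < X F then 1 else 0) ≤ H) (h5 : κ * (4 * (e * H)) ≤ m₁ ^ 2) :
    m₁ ^ 2 ≤ 4 * m₂ * ∑ F, ρ F * if 0 < X F ∧ κ * E F ≤ X F ^ 2 then 1 else 0 := by
  set p := ∑ F, ρ F * if 0 < X F ∧ κ * E F ≤ X F ^ 2 then (1:ℝ) else 0 with hp
  have hp0 : 0 ≤ p := Finset.sum_nonneg fun F _ => mul_nonneg (h0 F) (by positivity)
  have hH0 : 0 ≤ ∑ F, ρ F * if 0 < X F then (1:ℝ) else 0 :=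
    Finset.sum_nonneg fun F _ => mul_nonneg (h0 F) (by positivity)
  have hbad : (∑ F, ρ F * (√(κ * E F) * if 0 < X F then 1 else 0)) ≤ m₁ / 2 := by
    refine le_of_abs_le (abs_le_of_sq_le_sq (le_trans (weighted_cauchy_schwarz h0 _ _) ?_)
      (by positivity))
    have a1 : ∑ F, ρ F * √(κ * E F) ^ 2 = κ * ∑ F, ρ F * E F := by
      rw [Finset.mul_sum]
      refine Finset.sum_congr rfl fun F _ => ?_
      rw [Real.sq_sqrt (mul_nonneg hκ (hE F))]; ring
    have a2 : (∑ F, ρ F * (if 0 < X F then (1:ℝ) else 0) ^ 2) =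
        ∑ F, ρ F * if 0 < X F then (1:ℝ) else 0 := by
      refine Finset.sum_congr rfl fun F _ => ?_
      split_ifs <;> simp
    rw [a1, a2]
    have a3 : (∑ F, ρ F * E F) * (∑ F, ρ F * if 0 < X F then (1:ℝ) else 0) ≤ e * H :=
      mul_le_mul h3 h4 hH0 he
    nlinarith [mul_le_mul_of_nonneg_left a3 hκ]
  have hgood : m₁ / 2 ≤ ∑ F, ρ F * (X F * if 0 < X F ∧ κ * E F ≤ X F ^ 2 then 1 else 0) := by
    have : ∑ F, ρ F * X F ≤ (∑ F, ρ F * (√(κ * E F) * if 0 < X F then 1 else 0)) +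
        ∑ F, ρ F * (X F * if 0 < X F ∧ κ * E F ≤ X F ^ 2 then 1 else 0) := by
      rw [← Finset.sum_add_distrib]
      refine Finset.sum_le_sum fun F _ => ?_
      rw [← mul_add]
      refine mul_le_mul_of_nonneg_left ?_ (h0 F)
      by_cases a : 0 < X F
      · by_cases b : κ * E F ≤ X F ^ 2
        · simp only [a, b, and_self, if_true, mul_one]
          linarith [Real.sqrt_nonneg (κ * E F)]
        · simp only [a, b, and_false, if_true, if_false, mul_one, mul_zero, add_zero]
          exact Real.le_sqrt_of_sq_le (not_le.1 b).le
      · simp only [a, false_and, if_false, mul_zero, add_zero]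
        exact not_lt.1 a
    linarith
  have hcs := weighted_cauchy_schwarz h0 X
    (fun F => if 0 < X F ∧ κ * E F ≤ X F ^ 2 then (1:ℝ) else 0)
  have a2 : (∑ F, ρ F * (if 0 < X F ∧ κ * E F ≤ X F ^ 2 then (1:ℝ) else 0) ^ 2) = p := by
    refine Finset.sum_congr rfl fun F _ => ?_
    split_ifs <;> simp
  rw [a2] at hcs
  have a4 : (m₁ / 2) ^ 2 ≤ m₂ * p :=
    (pow_le_pow_left₀ (by positivity) hgood 2).trans
      (hcs.trans (mul_le_mul_of_nonneg_right h2 hp0))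
  linarith

lemma card_inter_eq (F B : Finset ι) : ((F ∩ B).card : ℝ) = ∑ v ∈ B, if v ∈ F then 1 else 0 := by
  rw [Finset.sum_boole, Finset.filter_mem_eq_inter, Finset.inter_comm]

lemma sum_inter_eq (F B : Finset ι) (f : ι → ℝ) :
    ∑ x ∈ F ∩ B, f x = ∑ x ∈ B, if x ∈ F then f x else 0 := by
  rw [← Finset.sum_filter, Finset.filter_mem_eq_inter, Finset.inter_comm]

/-- Lower bound for the probability that the range of the walk has large capacity in `B`. -/
lemma range_law_cap (hA : IsMMat A) {z : ι} {ρ : Finset ι → ℝ} (h0 : ∀ F, 0 ≤ ρ F)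
    (h1 : ∑ F, ρ F = 1)
    (h2 : ∀ K, (∑ F, ρ F * if Disjoint F K then 1 else 0) = 1 - eqPot A K z) (B : Finset ι)
    {c₀ C₀ a b S₁ S₂ H κ : ℝ} (hc₀ : 0 < c₀) (hC₀ : 0 < C₀) (ha : 0 < a) (hκ : 0 ≤ κ)
    (hd : ∀ v ∈ B, c₀ ≤ A⁻¹ v v ∧ A⁻¹ v v ≤ C₀)
    (hz : ∀ v ∈ B, a ≤ A⁻¹ z v ∧ A⁻¹ z v ≤ b)
    (hS₁ : ∀ v ∈ B, ∑ v' ∈ B, A⁻¹ v v' ≤ S₁)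
    (hS₂ : ∀ v ∈ B, ∑ v' ∈ B, A⁻¹ v v' ^ 2 ≤ S₂) (hH : eqPot A B z ≤ H)
    (hB : B.Nonempty)
    (hκ2 : κ * (4 * ((B.card * (2 * b / c₀ ^ 2 * S₂)) * H)) ≤ (a / C₀ * B.card) ^ 2) :
    (a / C₀ * B.card) ^ 2 ≤ 4 * (B.card * (2 * b / c₀ ^ 2 * S₁)) *
      ∑ F, ρ F * if κ ≤ capM A (F ∩ B) then 1 else 0 := by
  obtain ⟨v₀, hv₀⟩ := hB
  have hb : 0 < b := ha.trans_le ((hz v₀ hv₀).1.trans (hz v₀ hv₀).2)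
  have hpair : ∀ v ∈ B, ∀ v' ∈ B, (∑ F, ρ F * if v ∈ F ∧ v' ∈ F then 1 else 0) ≤
      2 * b / c₀ ^ 2 * A⁻¹ v v' := by
    intro v hv v' hv'
    have hg := inv_nonneg' hA v v'
    have hmain : A⁻¹ v v' * (A⁻¹ z v + A⁻¹ z v') / (A⁻¹ v v * A⁻¹ v' v') ≤
        2 * b / c₀ ^ 2 * A⁻¹ v v' := by
      rw [div_mul_eq_mul_div, sq]
      refine div_le_div₀ (by positivity) ?_ (by positivity)
        (mul_le_mul (hd v hv).1 (hd v' hv').1 hc₀.le (hc₀.le.trans (hd v hv).1))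
      nlinarith [(hz v hv).2, (hz v' hv').2]
    by_cases hvv : v = v'
    · subst hvv
      simp only [and_self]
      rw [range_law_mem hA h1 h2]
      refine le_trans ?_ hmain
      have := inv_diag_pos hA.posDef v
      rw [show A⁻¹ v v * (A⁻¹ z v + A⁻¹ z v) / (A⁻¹ v v * A⁻¹ v v) = 2 * (A⁻¹ z v / A⁻¹ v v) by
        field_simp; ring]
      have := div_nonneg (inv_nonneg' hA z v) this.le
      linarith
    · exact (range_law_pair hA h1 h2 hvv).trans hmain
  have hexp : ∀ f : ι → ι → ℝ, (∑ F, ρ F * ∑ v ∈ F ∩ B, ∑ v' ∈ F ∩ B, f v v') =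
      ∑ v ∈ B, ∑ v' ∈ B, f v v' * ∑ F, ρ F * if v ∈ F ∧ v' ∈ F then 1 else 0 := by
    intro f
    have e1 : ∀ F : Finset ι, ∑ v ∈ F ∩ B, ∑ v' ∈ F ∩ B, f v v' =
        ∑ v ∈ B, ∑ v' ∈ B, f v v' * if v ∈ F ∧ v' ∈ F then 1 else 0 := by
      intro F
      rw [sum_inter_eq]
      refine Finset.sum_congr rfl fun v _ => ?_
      by_cases hv : v ∈ F
      · rw [if_pos hv, sum_inter_eq]
        simp [hv]
      · simp [hv]
    simp only [e1, Finset.mul_sum]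
    rw [Finset.sum_comm]
    refine Finset.sum_congr rfl fun v _ => ?_
    rw [Finset.sum_comm]
    refine Finset.sum_congr rfl fun v' _ => Finset.sum_congr rfl fun F _ => ?_
    ring
  have hsecond : ∀ f : ι → ι → ℝ, (∀ v v', 0 ≤ f v v') → ∀ S, (∀ v ∈ B, ∑ v' ∈ B, f v v' * A⁻¹ v v' ≤ S) →
      (∑ F, ρ F * ∑ v ∈ F ∩ B, ∑ v' ∈ F ∩ B, f v v') ≤ B.card * (2 * b / c₀ ^ 2 * S) := by
    intro f hf S hS
    rw [hexp, ← nsmul_eq_mul]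
    refine Finset.sum_le_card_nsmul _ _ _ fun v hv => ?_
    refine le_trans ?_ (mul_le_mul_of_nonneg_left (hS v hv) (by positivity))
    rw [Finset.mul_sum]
    refine Finset.sum_le_sum fun v' hv' => ?_
    rw [show 2 * b / c₀ ^ 2 * (f v v' * A⁻¹ v v') = f v v' * (2 * b / c₀ ^ 2 * A⁻¹ v v') by ring]
    exact mul_le_mul_of_nonneg_left (hpair v hv v' hv') (hf v v')
  have hE0 : ∀ F : Finset ι, 0 ≤ ∑ v ∈ F ∩ B, ∑ v' ∈ F ∩ B, A⁻¹ v v' := fun F =>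
    Finset.sum_nonneg fun _ _ => Finset.sum_nonneg fun _ _ => inv_nonneg' hA _ _
  have hS₂0 : 0 ≤ S₂ := (Finset.sum_nonneg fun _ _ => sq_nonneg _).trans (hS₂ v₀ hv₀)
  have main := second_moment (ρ := ρ) (X := fun F => ((F ∩ B).card : ℝ))
    (E := fun F => ∑ v ∈ F ∩ B, ∑ v' ∈ F ∩ B, A⁻¹ v v') h0 hE0
    (m₁ := a / C₀ * B.card) (m₂ := B.card * (2 * b / c₀ ^ 2 * S₁))
    (e := B.card * (2 * b / c₀ ^ 2 * S₂)) (H := H) (κ := κ) (by positivity) hκ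
    (by positivity) ?_ ?_ ?_ ?_ hκ2
  · refine main.trans (mul_le_mul_of_nonneg_left (Finset.sum_le_sum fun F _ => ?_) ?_)
    · refine mul_le_mul_of_nonneg_left ?_ (h0 F)
      by_cases hF : 0 < ((F ∩ B).card : ℝ) ∧
          κ * (∑ v ∈ F ∩ B, ∑ v' ∈ F ∩ B, A⁻¹ v v') ≤ ((F ∩ B).card : ℝ) ^ 2
      · rw [if_pos hF, if_pos]
        have h6 := hF.2.trans (card_sq_le_capM_mul hA (subset_refl (F ∩ B)))
        refine le_of_mul_le_mul_right h6 (lt_of_le_of_ne (hE0 F) fun h => ?_)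
        have h7 := card_sq_le_capM_mul hA (subset_refl (F ∩ B))
        rw [← h, mul_zero] at h7
        nlinarith [hF.1]
      · rw [if_neg hF]
        positivity
    · have : 0 ≤ S₁ := (Finset.sum_nonneg fun _ _ => inv_nonneg' hA _ _).trans (hS₁ v₀ hv₀)
      positivity
  · simp only [card_inter_eq, Finset.mul_sum]
    rw [Finset.sum_comm, mul_comm, ← nsmul_eq_mul]
    refine Finset.card_nsmul_le_sum _ _ _ fun v hv => ?_
    rw [range_law_mem hA h1 h2]
    exact div_le_div₀ (inv_nonneg' hA z v) (hz v hv).1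
      (inv_diag_pos hA.posDef v) (hd v hv).2
  · refine le_trans (le_of_eq ?_) (hsecond (fun _ _ => 1) (fun _ _ => zero_le_one) S₁ (by
      simpa using hS₁))
    refine Finset.sum_congr rfl fun F _ => ?_
    simp [sq]
  · exact hsecond _ (inv_nonneg' hA) S₂ (by simpa [sq] using hS₂)
  · refine le_trans (le_of_eq ?_) hH
    have := h2 B
    rw [← h1, eq_sub_iff_add_eq, ← eq_sub_iff_add_eq'] at this
    rw [this, ← Finset.sum_sub_distrib]
    refine Finset.sum_congr rfl fun F _ => ?_
    simp only [Nat.cast_pos, Finset.card_pos, Finset.disjoint_iff_inter_eq_empty,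
      Finset.nonempty_iff_ne_empty]
    by_cases hF : F ∩ B = ∅ <;> simp [hF, h1]

end GaussMat

/-! ## An Anderson type inequality -/

namespace GaussMat

open Matrix

variable {τ : Type*} [Fintype τ] [DecidableEq τ]

lemma two_mul_le_sq_add_sq (a b : ℝ≥0∞) : 2 * (a * b) ≤ a * a + b * b := by
  by_cases ha : a = ⊤
  · simp [ha]
  by_cases hb : b = ⊤
  · simp [hb]
  lift a to ℝ≥0 using ha
  lift b to ℝ≥0 using hb
  norm_cast
  rw [← NNReal.coe_le_coe]
  push_cast
  nlinarith [sq_nonneg ((a:ℝ) - b)]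

lemma lintegral_mul_shift_le {Q : (τ → ℝ) → ℝ≥0∞} (hQ : Measurable Q) (θ : τ → ℝ) :
    ∫⁻ t, Q t * Q (t - θ) ≤ ∫⁻ t, Q t * Q t := by
  have h1 : ∫⁻ t, Q (t - θ) * Q (t - θ) = ∫⁻ t, Q t * Q t :=
    lintegral_sub_right_eq_self (fun t => Q t * Q t) θ
  have h2 : 2 * ∫⁻ t, Q t * Q (t - θ) ≤ 2 * ∫⁻ t, Q t * Q t := by
    rw [← lintegral_const_mul _ (by fun_prop)]
    refine (lintegral_mono fun t => two_mul_le_sq_add_sq _ _).trans ?_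
    rw [lintegral_add_left (by fun_prop), h1, two_mul]
  exact (ENNReal.mul_le_mul_iff_right two_ne_zero (by simp)).1 h2

lemma lintegral_conv_eq {G q : (τ → ℝ) → ℝ≥0∞} (hG : Measurable G) (hq : Measurable q)
    (θ : τ → ℝ) :
    ∫⁻ η, (∫⁻ v, G v * G (v + η + θ)) * (∫⁻ u, q u * q (u + η)) =
      ∫⁻ t, (∫⁻ v, G v * q (v + t)) * (∫⁻ v, G v * q (v + (t - θ))) := by
  calc ∫⁻ η, (∫⁻ v, G v * G (v + η + θ)) * (∫⁻ u, q u * q (u + η))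
      = ∫⁻ η, ∫⁻ v, ∫⁻ t, G v * G (v + η + θ) * (q (v + t) * q (v + t + η)) := by
        refine lintegral_congr fun η => ?_
        rw [← lintegral_mul_const _ (by fun_prop)]
        refine lintegral_congr fun v => ?_
        rw [← lintegral_add_left_eq_self _ v, ← lintegral_const_mul _ (by fun_prop)]
    _ = ∫⁻ v, ∫⁻ η, ∫⁻ t, G v * G (v + η + θ) * (q (v + t) * q (v + t + η)) :=
        lintegral_lintegral_swap (by fun_prop)
    _ = ∫⁻ v, ∫⁻ t, ∫⁻ η, G v * G (v + η + θ) * (q (v + t) * q (v + t + η)) :=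
        lintegral_congr fun v => lintegral_lintegral_swap (by fun_prop)
    _ = ∫⁻ t, ∫⁻ v, ∫⁻ η, G v * G (v + η + θ) * (q (v + t) * q (v + t + η)) :=
        lintegral_lintegral_swap (by fun_prop)
    _ = _ := by
        refine lintegral_congr fun t => ?_
        rw [← lintegral_mul_const _ (by fun_prop)]
        refine lintegral_congr fun v => ?_
        rw [← lintegral_add_right_eq_self (μ := volume) (fun w => G w * q (w + (t - θ))) (v + θ),
          ← lintegral_const_mul _ (by fun_prop)]
        refine lintegral_congr fun η => ?_
        rw [show v + t + η = η + (v + θ) + (t - θ) by abel, show v + η + θ = η + (v + θ) by abel]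
        ring

lemma lintegral_conv_le {G q : (τ → ℝ) → ℝ≥0∞} (hG : Measurable G) (hq : Measurable q)
    (θ : τ → ℝ) :
    ∫⁻ η, (∫⁻ v, G v * G (v + η + θ)) * (∫⁻ u, q u * q (u + η)) ≤
      ∫⁻ η, (∫⁻ v, G v * G (v + η)) * (∫⁻ u, q u * q (u + η)) := by
  have h0 := lintegral_conv_eq hG hq (0 : τ → ℝ)
  simp only [add_zero, sub_zero] at h0
  rw [h0, lintegral_conv_eq hG hq]
  exact lintegral_mul_shift_le (Q := fun t => ∫⁻ v, G v * q (v + t)) (by fun_prop) θ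

lemma integral_exp_conv {b : ℝ} (hb : 0 < b) (t : ℝ) :
    IntegrableOn (fun u => Real.exp (-(b * t)) * Real.exp (-(2 * b) * u)) (Set.Ioi (max 0 (-t))) ∧
    ∫ u in Set.Ioi (max 0 (-t)), Real.exp (-(b * t)) * Real.exp (-(2 * b) * u) =
      (2 * b)⁻¹ * Real.exp (-(b * |t|)) := by
  refine ⟨(integrableOn_exp_mul_Ioi (by linarith) _).const_mul _, ?_⟩
  rw [integral_const_mul, integral_exp_mul_Ioi (by linarith), neg_div_neg_eq, ← mul_div_assoc,
    ← Real.exp_add, div_eq_inv_mul]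
  congr 2
  rcases le_total 0 t with h | h
  · rw [max_eq_left (by linarith), abs_of_nonneg h]; ring
  · rw [max_eq_right (by linarith), abs_of_nonpos h]; ring

/-- The one sided exponential kernel. -/
def expKer (b : τ → ℝ) (u : τ → ℝ) : ℝ := ∏ i, if 0 < u i then Real.exp (-(b i * u i)) else 0

lemma expKer_nonneg (b u : τ → ℝ) : 0 ≤ expKer b u :=
  Finset.prod_nonneg fun _ _ => by positivity

@[fun_prop]
lemma measurable_expKer (b : τ → ℝ) : Measurable (expKer b) := by
  unfold expKer
  refine Finset.measurable_fun_prod _ fun i _ => Measurable.ite ?_ (by fun_prop) measurable_const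
  exact measurableSet_lt measurable_const (measurable_pi_apply i)

lemma lintegral_expKer {b : τ → ℝ} (hb : ∀ i, 0 < b i) (η : τ → ℝ) :
    ∫⁻ u, ENNReal.ofReal (expKer b u) * ENNReal.ofReal (expKer b (u + η)) =
      ENNReal.ofReal ((∏ i, (2 * b i)⁻¹) * Real.exp (-∑ i, b i * |η i|)) := by
  have h1 : ∀ u : τ → ℝ, ENNReal.ofReal (expKer b u) * ENNReal.ofReal (expKer b (u + η)) =
      ENNReal.ofReal (∏ i, (Set.Ioi (max 0 (-η i))).indicator
        (fun u => Real.exp (-(b i * η i)) * Real.exp (-(2 * b i) * u)) (u i)) := fun u => by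
    rw [← ENNReal.ofReal_mul (expKer_nonneg _ _), expKer, expKer, ← Finset.prod_mul_distrib]
    congr 1
    refine Finset.prod_congr rfl fun i _ => ?_
    rw [Set.indicator_apply]
    simp only [Set.mem_Ioi, max_lt_iff, Pi.add_apply]
    by_cases h : 0 < u i
    · by_cases h' : 0 < u i + η i
      · rw [if_pos h, if_pos h', if_pos ⟨h, by linarith⟩, ← Real.exp_add, ← Real.exp_add]
        congr 1; ring
      · rw [if_neg h', mul_zero, if_neg (show ¬(0 < u i ∧ -η i < u i) from
          fun k => h' (by linarith [k.2]))]
    · rw [if_neg h, zero_mul, if_neg (show ¬(0 < u i ∧ -η i < u i) from fun k => h k.1)]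
  have h2 : ∀ i, Integrable ((Set.Ioi (max 0 (-η i))).indicator
      (fun u => Real.exp (-(b i * η i)) * Real.exp (-(2 * b i) * u))) := fun i =>
    (integral_exp_conv (hb i) (η i)).1.integrable_indicator measurableSet_Ioi
  have h3 : Integrable (fun u : τ → ℝ => ∏ i, (Set.Ioi (max 0 (-η i))).indicator
      (fun u => Real.exp (-(b i * η i)) * Real.exp (-(2 * b i) * u)) (u i)) :=
    Integrable.fintype_prod h2
  simp only [h1]
  rw [← ofReal_integral_eq_lintegral_ofReal h3
    (ae_of_all _ fun u => Finset.prod_nonneg fun i _ => Set.indicator_nonneg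
      (fun _ _ => by positivity) _)]
  rw [integral_fintype_prod_volume_eq_prod (fun i => (Set.Ioi (max 0 (-η i))).indicator
      (fun u => Real.exp (-(b i * η i)) * Real.exp (-(2 * b i) * u))), ← Finset.sum_neg_distrib,
    Real.exp_sum, ← Finset.prod_mul_distrib]
  congr 1
  refine Finset.prod_congr rfl fun i _ => ?_
  rw [integral_indicator measurableSet_Ioi, (integral_exp_conv (hb i) (η i)).2]

lemma meas_univ_pos {B : Matrix τ τ ℝ} (hB : B.PosDef) :
    (∫⁻ φ, dens B φ) ≠ 0 ∧ (∫⁻ φ, dens B φ) ≠ ⊤ := by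
  obtain ⟨c, hc0, hct, hp, -⟩ := exists_law hB
  have h := hp.measure_univ
  rw [Measure.smul_apply, meas, withDensity_apply _ MeasurableSet.univ, Measure.restrict_univ,
    smul_eq_mul] at h
  constructor
  · intro h0
    rw [h0, mul_zero] at h
    exact zero_ne_one h
  · intro h0
    rw [h0, ENNReal.mul_top hc0] at h
    exact ENNReal.top_ne_one h

lemma lintegral_gauss_conv {B : Matrix τ τ ℝ} (hB : B.PosDef) : ∃ c : ℝ≥0∞, c ≠ 0 ∧ c ≠ ⊤ ∧
    ∀ η : τ → ℝ, ∫⁻ v, dens ((2:ℝ) • B) v * dens ((2:ℝ) • B) (v + η) = c * dens B η := by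
  have h4 : ((4:ℝ) • B).PosDef := hB.smul (by norm_num)
  refine ⟨_, (meas_univ_pos h4).1, (meas_univ_pos h4).2, fun η => ?_⟩
  rw [← lintegral_add_right_eq_self (μ := volume) (dens ((4:ℝ) • B)) ((2:ℝ)⁻¹ • η),
    ← lintegral_mul_const _ (by fun_prop)]
  refine lintegral_congr fun v => ?_
  simp only [dens]
  rw [← ENNReal.ofReal_mul (Real.exp_pos _).le, ← ENNReal.ofReal_mul (Real.exp_pos _).le,
    ← Real.exp_add, ← Real.exp_add]
  congr 2
  simp only [smul_mulVec, dotProduct_smul, quad_add hB, mulVec_smul, smul_dotProduct, smul_eq_mul]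
  ring

lemma anderson_pos {B : Matrix τ τ ℝ} (hB : B.PosDef) {b : τ → ℝ} (hb : ∀ i, 0 < b i)
    (θ : τ → ℝ) :
    ∫⁻ η, dens B (η + θ) * ENNReal.ofReal (Real.exp (-∑ i, b i * |η i|)) ≤
      ∫⁻ η, dens B η * ENNReal.ofReal (Real.exp (-∑ i, b i * |η i|)) := by
  obtain ⟨c, hc0, hct, hc⟩ := lintegral_gauss_conv hB
  have h := lintegral_conv_le (G := dens ((2:ℝ) • B)) (q := fun u => ENNReal.ofReal (expKer b u))
    (by fun_prop) (by fun_prop) θ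
  have hp : 0 < ∏ i, (2 * b i)⁻¹ := Finset.prod_pos fun i _ => inv_pos.2 (by linarith [hb i])
  simp only [add_assoc, hc, lintegral_expKer hb, ENNReal.ofReal_mul hp.le] at h
  set k := ENNReal.ofReal (∏ i, (2 * b i)⁻¹)
  have hk : c * k ≠ 0 := mul_ne_zero hc0 (ENNReal.ofReal_pos.2 hp).ne'
  have hkt : c * k ≠ ⊤ := ENNReal.mul_ne_top hct ENNReal.ofReal_ne_top
  refine (ENNReal.mul_le_mul_iff_right hk hkt).1 ?_
  rw [← lintegral_const_mul _ (by fun_prop), ← lintegral_const_mul _ (by fun_prop)]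
  convert h using 3
  · ring
  · ring

lemma anderson {B : Matrix τ τ ℝ} (hB : B.PosDef) {b : τ → ℝ} (hb : ∀ i, 0 ≤ b i)
    (θ : τ → ℝ) :
    ∫⁻ η, dens B (η + θ) * ENNReal.ofReal (Real.exp (-∑ i, b i * |η i|)) ≤
      ∫⁻ η, dens B η * ENNReal.ofReal (Real.exp (-∑ i, b i * |η i|)) := by
  set f : ℕ → (τ → ℝ) → ℝ≥0∞ := fun n η =>
    dens B (η + θ) * ENNReal.ofReal (Real.exp (-∑ i, (b i + 1 / (n + 1 : ℝ)) * |η i|))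
  have hlim : Tendsto (fun n => ∫⁻ η, f n η) atTop
      (𝓝 (∫⁻ η, dens B (η + θ) * ENNReal.ofReal (Real.exp (-∑ i, b i * |η i|)))) := by
    refine lintegral_tendsto_of_tendsto_of_monotone (fun n => by fun_prop) (ae_of_all _ fun η => ?_)
      (ae_of_all _ fun η => ?_)
    · intro n m hnm
      simp only [f]
      gcongr
    · refine ENNReal.Tendsto.const_mul (ENNReal.tendsto_ofReal ?_) (Or.inr ENNReal.ofReal_ne_top)
      refine (Real.continuous_exp.tendsto _).comp (Tendsto.neg (tendsto_finsetSum _ fun i _ => ?_))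
      have := (tendsto_one_div_add_atTop_nhds_zero_nat (𝕜 := ℝ)).const_add (b i)
      rw [add_zero] at this
      exact this.mul_const _
  refine le_of_tendsto' hlim fun n => ?_
  refine (anderson_pos hB (fun i => ?_) θ).trans (lintegral_mono fun η => ?_)
  · have := hb i
    positivity
  · gcongr with i
    exact le_add_of_nonneg_right (by positivity)

end GaussMat

/-! ## Comparison of Gaussian integrals along fibres -/

namespace GaussMat

open Matrix

variable {ι : Type*} [Fintype ι] [DecidableEq ι] {A : Matrix ι ι ℝ}

/-- Extension by zero of a function on `s`. -/
def extZ (s : Finset ι) (y : s → ℝ) : ι → ℝ := fun i => if h : i ∈ s then y ⟨i, h⟩ else 0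

lemma sum_extZ (s : Finset ι) (f : ι → ℝ) (h : ∀ i ∉ s, f i = 0) :
    ∑ i, f i = ∑ i : s, f i := by
  rw [← Finset.sum_subset (Finset.subset_univ s) fun i _ hi => h i hi, ← Finset.sum_coe_sort s f]

lemma quad_extZ (s : Finset ι) (y : s → ℝ) :
    extZ s y ⬝ᵥ A *ᵥ extZ s y =
      y ⬝ᵥ (A.submatrix (fun i : s => (i : ι)) (fun i : s => (i : ι))) *ᵥ y := by
  have h0 : ∀ i : s, extZ s y i = y i := fun i => by simp [extZ]
  have h1 : ∀ i ∉ s, extZ s y i = 0 := fun i hi => by simp [extZ, hi]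
  simp only [dotProduct, mulVec]
  rw [sum_extZ s _ fun i hi => by rw [h1 i hi, zero_mul]]
  refine Finset.sum_congr rfl fun i _ => ?_
  rw [sum_extZ s _ fun i hi => by rw [h1 i hi, mul_zero], h0]
  simp only [h0, submatrix_apply]

lemma posDef_sub (hA : A.PosDef) (s : Finset ι) :
    (A.submatrix (fun i : s => (i : ι)) (fun i : s => (i : ι))).PosDef :=
  hA.submatrix Subtype.val_injective

lemma dens_extZ (s : Finset ι) (y : s → ℝ) :
    dens A (extZ s y) = dens (A.submatrix (fun i : s => (i : ι)) (fun i : s => (i : ι))) y := by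
  rw [dens, dens, quad_extZ]

lemma lintegral_le_of_extZ (s : Finset ι) {f g : (ι → ℝ) → ℝ≥0∞}
    (hf : Measurable f) (hg : Measurable g)
    (h : ∀ x : ι → ℝ, (∀ i ∈ s, x i = 0) →
      ∫⁻ y : s → ℝ, f (x + extZ s y) ≤ ∫⁻ y : s → ℝ, g (x + extZ s y)) :
    ∫⁻ φ, f φ ≤ ∫⁻ φ, g φ := by
  refine lintegral_le_of_lmarginal_le (μ := fun _ => volume) s hf hg fun x => ?_
  have e1 : ∀ y : s → ℝ, Function.updateFinset x s y =
      (fun i => if i ∈ s then 0 else x i) + extZ s y := fun y => by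
    funext i
    simp only [Function.updateFinset, Pi.add_apply, extZ]
    split_ifs <;> simp
  simp only [lmarginal, e1]
  exact h _ fun i hi => if_pos hi

lemma extZ_add (s : Finset ι) (y : s → ℝ) {θ : ι → ℝ} (hθ : ∀ i ∉ s, θ i = 0) :
    extZ s y + θ = extZ s (y + fun i : s => θ i) := by
  funext i
  simp only [Pi.add_apply, extZ]
  split_ifs with hi
  · rfl
  · simp [hθ i hi]

/-- Fibrewise comparison: if along every fibre `x + ℝˢ` the function `f` is bounded by a shifted
Gaussian damped by `exp (-∑ bᵢ|ηᵢ|)`, and `g` is bounded below by the unshifted one, then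
`∫ f ≤ ∫ g`. -/
lemma lintegral_le_of_fiber (hA : A.PosDef) (s : Finset ι) {f g : (ι → ℝ) → ℝ≥0∞}
    (hf : Measurable f) (hg : Measurable g)
    (h : ∀ x : ι → ℝ, (∀ i ∈ s, x i = 0) → ∃ θ : ι → ℝ, (∀ i ∉ s, θ i = 0) ∧
      ∃ b : ι → ℝ, (∀ i, 0 ≤ b i) ∧ ∃ c : ℝ≥0∞, ∀ η : ι → ℝ, (∀ i ∉ s, η i = 0) →
        f (x + η) ≤ c * (dens A (η + θ) * ENNReal.ofReal (Real.exp (-∑ i ∈ s, b i * |η i|))) ∧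
        c * (dens A η * ENNReal.ofReal (Real.exp (-∑ i ∈ s, b i * |η i|))) ≤ g (x + η)) :
    ∫⁻ φ, f φ ≤ ∫⁻ φ, g φ := by
  refine lintegral_le_of_extZ s hf hg fun x hx => ?_
  obtain ⟨θ, hθ, b, hb, c, hc⟩ := h x hx
  have e3 : ∀ y : s → ℝ, ∑ i ∈ s, b i * |extZ s y i| = ∑ i : s, b i * |y i| := fun y => by
    rw [← Finset.sum_coe_sort s]
    simp [extZ]
  have e4 : ∀ (y : s → ℝ), ∀ i ∉ s, extZ s y i = 0 := fun y i hi => by simp [extZ, hi]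
  calc ∫⁻ y : s → ℝ, f (x + extZ s y)
      ≤ ∫⁻ y : s → ℝ, c * (dens (A.submatrix (fun i : s => (i : ι)) (fun i : s => (i : ι)))
          (y + fun i : s => θ i) * ENNReal.ofReal (Real.exp (-∑ i : s, b i * |y i|))) := by
        refine lintegral_mono fun y => ?_
        have := (hc (extZ s y) (e4 y)).1
        rwa [extZ_add s y hθ, dens_extZ, e3] at this
    _ ≤ ∫⁻ y : s → ℝ, c * (dens (A.submatrix (fun i : s => (i : ι)) (fun i : s => (i : ι))) y *
          ENNReal.ofReal (Real.exp (-∑ i : s, b i * |y i|))) := by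
        rw [lintegral_const_mul _ (by fun_prop), lintegral_const_mul _ (by fun_prop)]
        exact mul_le_mul_right (anderson (posDef_sub hA s) (fun i : s => hb i) _) c
    _ ≤ ∫⁻ y : s → ℝ, g (x + extZ s y) := by
        refine lintegral_mono fun y => ?_
        have := (hc (extZ s y) (e4 y)).2
        rwa [dens_extZ, e3] at this

end GaussMat

/-! ## Bond percolation in a Gaussian environment -/

namespace GaussMat

open Matrix FinPerc

variable {ι : Type*} [Fintype ι] [DecidableEq ι] {A : Matrix ι ι ℝ}

/-- The probability that an edge is closed given the field. -/
def qE (A : Matrix ι ι ℝ) (φ : ι → ℝ) : Sym2 ι → ℝ :=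
  Sym2.lift ⟨fun x y => if x = y then 1 else
    Real.exp ((A x y + A y x) * max (φ x) 0 * max (φ y) 0), fun x y => by
      by_cases h : x = y
      · subst h; rfl
      · beta_reduce
        rw [if_neg h, if_neg (Ne.symm h)]
        congr 1; ring⟩

lemma qE_mk (A : Matrix ι ι ℝ) (φ : ι → ℝ) (x y : ι) : qE A φ s(x, y) =
    if x = y then 1 else Real.exp ((A x y + A y x) * max (φ x) 0 * max (φ y) 0) := rfl

lemma qE_nonneg (A : Matrix ι ι ℝ) (φ : ι → ℝ) (e : Sym2 ι) : 0 ≤ qE A φ e := by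
  induction e using Sym2.inductionOn with
  | hf x y => rw [qE_mk]; split_ifs <;> positivity

lemma qE_le_one (hA : IsMMat A) (φ : ι → ℝ) (e : Sym2 ι) : qE A φ e ≤ 1 := by
  induction e using Sym2.inductionOn with
  | hf x y =>
    rw [qE_mk]
    split_ifs with h
    · exact le_rfl
    · refine Real.exp_le_one_iff.2 ?_
      rw [mul_assoc]
      exact mul_nonpos_of_nonpos_of_nonneg
        (add_nonpos (hA.offdiag x y h) (hA.offdiag y x (Ne.symm h))) (by positivity)

lemma measurable_qE (A : Matrix ι ι ℝ) (e : Sym2 ι) : Measurable fun φ : ι → ℝ => qE A φ e := by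
  induction e using Sym2.inductionOn with
  | hf x y =>
    simp only [qE_mk]
    split_ifs <;> fun_prop

@[fun_prop]
lemma measurable_clProb (A : Matrix ι ι ℝ) (z : ι) (K : Finset ι) :
    Measurable fun φ : ι → ℝ => clProb (qE A φ) z K := by
  unfold clProb mean wt
  refine Finset.measurable_fun_sum _ fun o _ => Measurable.mul_const ?_ _
  refine Finset.measurable_fun_prod _ fun e _ => ?_
  have := measurable_qE A e
  split_ifs <;> fun_prop

lemma clProb_eq_zero {φ : ι → ℝ} {z : ι} {K : Finset ι} (hz : 0 < φ z) {v : ι} (hv : v ∈ K)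
    (hφ : φ v ≤ 0) : clProb (qE A φ) z K = 0 := by
  rw [clProb_eq]
  by_cases hzK : z ∈ K
  · rw [innerProb_eq_zero hv hzK (fun h => by subst h; linarith), mul_zero]
    intro x
    rw [qE_mk, max_eq_right hφ]
    simp
  · rw [innerProb_of_notMem _ hzK, mul_zero]

lemma clProb_eq_zero' {φ : ι → ℝ} {z : ι} {K : Finset ι} (hz : z ∉ K) :
    clProb (qE A φ) z K = 0 := by
  rw [clProb_eq, innerProb_of_notMem _ hz, mul_zero]

/-- The interaction of the cluster with a site. -/
def bd (A : Matrix ι ι ℝ) (K : Finset ι) (ψ : ι → ℝ) (y : ι) : ℝ :=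
  if y ∈ K then 0 else -∑ x ∈ K, A y x * ψ x

lemma bd_nonneg (hA : IsMMat A) {K : Finset ι} {ψ : ι → ℝ} (hψ : ∀ x ∈ K, 0 ≤ ψ x) (y : ι) :
    0 ≤ bd A K ψ y := by
  unfold bd
  split_ifs with h
  · exact le_rfl
  · rw [← Finset.sum_neg_distrib]
    refine Finset.sum_nonneg fun x hx => ?_
    have := hA.offdiag y x (fun e => h (e ▸ hx))
    nlinarith [hψ x hx]

lemma dot_mulVec_eq_bd {K : Finset ι} {ψ η : ι → ℝ} (hψ : ∀ x ∉ K, ψ x = 0)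
    (hη : ∀ x ∈ K, η x = 0) : η ⬝ᵥ A *ᵥ ψ = -∑ y ∈ Kᶜ, bd A K ψ y * η y := by
  rw [dotProduct, ← Finset.sum_neg_distrib,
    ← Finset.sum_subset (Finset.subset_univ Kᶜ) fun y _ hy => by
      rw [hη y (by simpa using hy), zero_mul]]
  refine Finset.sum_congr rfl fun y hy => ?_
  rw [bd, if_neg (by simpa using hy), mulVec, dotProduct,
    Finset.sum_subset (Finset.subset_univ K) fun x _ hx => by rw [hψ x hx, mul_zero]]
  ring

/-- The cluster weight, on the fibre of configurations extending `ψ` on `K`. -/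
lemma clProb_fiber (hA : A.PosDef) {K : Finset ι} {ψ η : ι → ℝ} (z : ι)
    (hψ : ∀ x ∉ K, ψ x = 0) (hψ' : ∀ x ∈ K, 0 ≤ ψ x) (hη : ∀ x ∈ K, η x = 0) :
    clProb (qE A (ψ + η)) z K =
      innerProb (qE A ψ) z K * Real.exp (-∑ y ∈ Kᶜ, bd A K ψ y * (2 * max (η y) 0)) := by
  rw [clProb_eq, mul_comm]
  congr 1
  · refine innerProb_congr z K fun x hx y hy => ?_
    simp [qE_mk, hη x hx, hη y hy]
  · rw [Finset.prod_comm, ← Finset.sum_neg_distrib, Real.exp_sum]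
    refine Finset.prod_congr rfl fun y hy => ?_
    have hy' : y ∉ K := by simpa using hy
    rw [bd, if_neg hy', neg_mul, neg_neg, Finset.sum_mul, Real.exp_sum]
    refine Finset.prod_congr rfl fun x hx => ?_
    rw [qE_mk, if_neg (fun e : x = y => hy' (e ▸ hx)), posDef_symm hA x y]
    simp only [Pi.add_apply, hη x hx, hψ y hy', add_zero, zero_add, max_eq_left (hψ' x hx)]
    congr 1; ring

lemma exp_quad_mul_clProb (hA : A.PosDef) {K : Finset ι} {ψ η : ι → ℝ} (z : ι)
    (hψ : ∀ x ∉ K, ψ x = 0) (hψ' : ∀ x ∈ K, 0 ≤ ψ x) (hη : ∀ x ∈ K, η x = 0) (t : ℝ) :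
    Real.exp (-(ψ ⬝ᵥ A *ᵥ ψ + 2 * (η ⬝ᵥ A *ᵥ ψ) + t) / 2) * clProb (qE A (ψ + η)) z K =
      Real.exp (-(ψ ⬝ᵥ A *ᵥ ψ) / 2) * innerProb (qE A ψ) z K *
        (Real.exp (-t / 2) * Real.exp (-∑ y ∈ Kᶜ, bd A K ψ y * |η y|)) := by
  rw [clProb_fiber hA z hψ hψ' hη, dot_mulVec_eq_bd hψ hη]
  have h : ∑ y ∈ Kᶜ, bd A K ψ y * |η y| =
      ∑ y ∈ Kᶜ, bd A K ψ y * (2 * max (η y) 0) - ∑ y ∈ Kᶜ, bd A K ψ y * η y := by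
    rw [← Finset.sum_sub_distrib]
    refine Finset.sum_congr rfl fun y _ => ?_
    rw [← mul_sub]
    congr 1
    rcases le_total 0 (η y) with h | h
    · rw [abs_of_nonneg h, max_eq_left h]; ring
    · rw [abs_of_nonpos h, max_eq_right h]; ring
  rw [h, mul_left_comm, ← Real.exp_add, mul_comm (Real.exp (-(ψ ⬝ᵥ A *ᵥ ψ) / 2)), mul_assoc,
    ← Real.exp_add, ← Real.exp_add]
  congr 2
  ring

end GaussMat

namespace GaussMat

open Matrix FinPerc

variable {ι : Type*} [Fintype ι] [DecidableEq ι] {A : Matrix ι ι ℝ}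

/-- The Gaussian density restricted to the event that the cluster of `z` is `K` and that the field
at `z` is positive. -/
def clDens (A : Matrix ι ι ℝ) (z : ι) (K : Finset ι) (φ : ι → ℝ) : ℝ≥0∞ :=
  if 0 < φ z then ENNReal.ofReal (clProb (qE A φ) z K) * dens A φ else 0

lemma measurableSet_pos (z : ι) : MeasurableSet {φ : ι → ℝ | 0 < φ z} :=
  measurableSet_lt measurable_const (measurable_pi_apply z)

@[fun_prop]
lemma measurable_clDens (A : Matrix ι ι ℝ) (z : ι) (K : Finset ι) : Measurable (clDens A z K) :=
  Measurable.ite (measurableSet_pos z) (by fun_prop) measurable_const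

lemma sum_clDens (hA : IsMMat A) (z : ι) (φ : ι → ℝ) :
    ∑ K, clDens A z K φ = if 0 < φ z then dens A φ else 0 := by
  unfold clDens
  split_ifs
  · rw [← Finset.sum_mul, ← ENNReal.ofReal_sum_of_nonneg fun K _ =>
      clProb_nonneg (qE_nonneg A φ) (qE_le_one hA φ) z K, sum_clProb, ENNReal.ofReal_one, one_mul]
  · simp

lemma dens_shift_fiber (hA : IsMMat A) {K : Finset ι} {ψ η : ι → ℝ} (hψ' : ∀ x, 0 ≤ ψ x)
    (hη : ∀ x ∈ K, η x = 0) {a : ℝ} (ha : 0 ≤ a) :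
    ψ ⬝ᵥ A *ᵥ ψ + 2 * (η ⬝ᵥ A *ᵥ ψ) + ((η + a • (1 - eqPot A K)) ⬝ᵥ A *ᵥ
      (η + a • (1 - eqPot A K)) + a ^ 2 * capM A K) ≤
    (ψ + η + a • 1) ⬝ᵥ A *ᵥ (ψ + η + a • 1) := by
  set u := eqPot A K with hu
  set ζ := η + a • (1 - u) with hζ
  have hζ0 : ∀ x ∈ K, ζ x = 0 := fun x hx => by
    simp [hζ, hη x hx, hu, eqPot_on hA.posDef hx]
  have e1 : ψ + η + a • (1 : ι → ℝ) = (ψ + a • u) + ζ := by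
    rw [hζ, smul_sub]; abel
  have e2 : ζ ⬝ᵥ A *ᵥ u = 0 := Finset.sum_eq_zero fun x _ => by
    by_cases hx : x ∈ K
    · rw [hζ0 x hx, zero_mul]
    · rw [hu, eqPot_off hA.posDef hx, mul_zero]
  have e3 : 0 ≤ ψ ⬝ᵥ A *ᵥ 1 := Finset.sum_nonneg fun x _ => mul_nonneg (hψ' x) (hA.row x)
  have e4 : ζ ⬝ᵥ A *ᵥ ψ = η ⬝ᵥ A *ᵥ ψ + a * (ψ ⬝ᵥ A *ᵥ 1) - a * (u ⬝ᵥ A *ᵥ ψ) := by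
    rw [hζ, add_dotProduct, smul_dotProduct, sub_dotProduct, bilin_comm hA.posDef 1 ψ, smul_eq_mul]
    ring
  have e5 : u ⬝ᵥ A *ᵥ u = capM A K := quad_eqPot hA.posDef K
  clear_value ζ u
  rw [e1, quad_add hA.posDef (ψ + a • u) ζ, quad_add hA.posDef ψ (a • u)]
  simp only [mulVec_add, mulVec_smul, dotProduct_add, dotProduct_smul, e2, smul_dotProduct, e5, e4,
    smul_eq_mul]
  nlinarith [mul_nonneg ha e3]

lemma lintegral_clDens_shift_le (hA : IsMMat A) (z : ι) (K : Finset ι) {a : ℝ} (ha : 0 ≤ a) :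
    ∫⁻ φ, (if 0 < φ z then ENNReal.ofReal (clProb (qE A φ) z K) * dens A (φ + a • 1) else 0) ≤
      ENNReal.ofReal (Real.exp (-(a ^ 2 * capM A K) / 2)) * ∫⁻ φ, clDens A z K φ := by
  rw [← lintegral_const_mul _ (by fun_prop)]
  refine lintegral_le_of_fiber hA.posDef Kᶜ
    (Measurable.ite (measurableSet_pos z) (by fun_prop) measurable_const) (by fun_prop)
    fun ψ hψ => ?_
  have hψ0 : ∀ x ∉ K, ψ x = 0 := fun x hx => hψ x (by simpa using hx)
  by_cases hpos : z ∈ K ∧ ∀ x ∈ K, 0 < ψ x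
  · obtain ⟨hzK, hpos⟩ := hpos
    have hψ' : ∀ x ∈ K, 0 ≤ ψ x := fun x hx => (hpos x hx).le
    refine ⟨a • (1 - eqPot A K), fun i hi => ?_, bd A K ψ, bd_nonneg hA hψ',
      ENNReal.ofReal (Real.exp (-(a ^ 2 * capM A K) / 2) *
        (Real.exp (-(ψ ⬝ᵥ A *ᵥ ψ) / 2) * innerProb (qE A ψ) z K)), fun η hη => ?_⟩
    · simp [eqPot_on hA.posDef (show i ∈ K by simpa using hi)]
    · have hη0 : ∀ x ∈ K, η x = 0 := fun x hx => hη x (by simpa using hx)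
      have hz : 0 < (ψ + η) z := by simpa [hη0 z hzK] using hpos z hzK
      have hi := innerProb_nonneg (qE_nonneg A ψ) (qE_le_one hA ψ) z K
      have hc := clProb_nonneg (qE_nonneg A (ψ + η)) (qE_le_one hA (ψ + η)) z K
      constructor
      · rw [if_pos hz, dens, dens, ← ENNReal.ofReal_mul hc, ← ENNReal.ofReal_mul (by positivity),
          ← ENNReal.ofReal_mul (by positivity)]
        refine ENNReal.ofReal_le_ofReal ?_
        calc _ ≤ clProb (qE A (ψ + η)) z K * Real.exp (-(ψ ⬝ᵥ A *ᵥ ψ + 2 * (η ⬝ᵥ A *ᵥ ψ) +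
              ((η + a • (1 - eqPot A K)) ⬝ᵥ A *ᵥ (η + a • (1 - eqPot A K)) +
                a ^ 2 * capM A K)) / 2) := by
              gcongr
              refine dens_shift_fiber hA (fun x => ?_) hη0 ha
              by_cases hx : x ∈ K
              · exact hψ' x hx
              · exact (hψ0 x hx).ge
          _ = _ := by
              rw [mul_comm, exp_quad_mul_clProb hA.posDef z hψ0 hψ' hη0, neg_add, add_div,
                Real.exp_add, neg_div (2:ℝ) (a ^ 2 * capM A K)]
              ring
      · rw [clDens, if_pos hz, dens, dens, ← ENNReal.ofReal_mul hc,
          ← ENNReal.ofReal_mul (by positivity),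
          ← ENNReal.ofReal_mul (by positivity), ← ENNReal.ofReal_mul (by positivity)]
        refine ENNReal.ofReal_le_ofReal (le_of_eq ?_)
        rw [quad_add hA.posDef, mul_comm (clProb _ _ _),
          exp_quad_mul_clProb hA.posDef z hψ0 hψ' hη0]
        ring
  · refine ⟨0, by simp, 0, by simp, 0, fun η hη => ⟨?_, by simp⟩⟩
    rw [zero_mul, nonpos_iff_eq_zero]
    have hη0 : ∀ x ∈ K, η x = 0 := fun x hx => hη x (by simpa using hx)
    split_ifs with hz
    · have : clProb (qE A (ψ + η)) z K = 0 := by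
        by_cases hzK : z ∈ K
        · obtain ⟨v, hv, hv'⟩ : ∃ v ∈ K, ψ v ≤ 0 := by
            by_contra! h
            exact hpos ⟨hzK, h⟩
          exact clProb_eq_zero hz hv (by simpa [hη0 v hv] using hv')
        · exact clProb_eq_zero' hzK
      rw [this, ENNReal.ofReal_zero, zero_mul]
    · rfl

lemma lintegral_dens_gt_le (hA : IsMMat A) (z : ι) {a : ℝ} (ha : 0 ≤ a) :
    ∫⁻ φ, (if a < φ z then dens A φ else 0) ≤
      ∑ K, ENNReal.ofReal (Real.exp (-(a ^ 2 * capM A K) / 2)) * ∫⁻ φ, clDens A z K φ := by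
  rw [← lintegral_add_right_eq_self (μ := volume) _ (a • (1 : ι → ℝ))]
  calc _ = ∫⁻ φ, ∑ K, (if 0 < φ z then
        ENNReal.ofReal (clProb (qE A φ) z K) * dens A (φ + a • 1) else 0) := by
        refine lintegral_congr fun φ => ?_
        have : (a < (φ + a • (1 : ι → ℝ)) z) ↔ 0 < φ z := by simp
        simp only [this]
        split_ifs
        · rw [← Finset.sum_mul, ← ENNReal.ofReal_sum_of_nonneg fun K _ =>
            clProb_nonneg (qE_nonneg A φ) (qE_le_one hA φ) z K, sum_clProb, ENNReal.ofReal_one,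
            one_mul]
        · simp
    _ = ∑ K, ∫⁻ φ, (if 0 < φ z then
        ENNReal.ofReal (clProb (qE A φ) z K) * dens A (φ + a • 1) else 0) :=
        lintegral_finsetSum _ fun K _ =>
          Measurable.ite (measurableSet_pos z) (by fun_prop) measurable_const
    _ ≤ _ := Finset.sum_le_sum fun K _ => lintegral_clDens_shift_le hA z K ha

/-- Clusters of large capacity are unlikely. -/
lemma sum_lintegral_clDens_le (hA : IsMMat A) (z : ι) {s : ℝ} (hs : 0 < s) :
    ∑ K with s ≤ capM A K, ∫⁻ φ, clDens A z K φ ≤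
      3 * ∫⁻ φ, (if 0 < φ z ∧ φ z ≤ (√s)⁻¹ then dens A φ else 0) := by
  set a := (√s)⁻¹ with ha
  have ha0 : 0 < a := inv_pos.2 (Real.sqrt_pos.2 hs)
  have has : a ^ 2 * s = 1 := by
    rw [ha, inv_pow, Real.sq_sqrt hs.le, inv_mul_cancel₀ hs.ne']
  set p : Finset ι → ℝ≥0∞ := fun K => ∫⁻ φ, clDens A z K φ with hp
  have hsum : ∑ K, p K = ∫⁻ φ, (if 0 < φ z then dens A φ else 0) := by
    rw [hp, ← lintegral_finsetSum _ fun K _ => by fun_prop]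
    exact lintegral_congr fun φ => sum_clDens hA z φ
  have hsplit : ∫⁻ φ, (if 0 < φ z then dens A φ else 0) =
      (∫⁻ φ, (if a < φ z then dens A φ else 0)) +
        ∫⁻ φ, (if 0 < φ z ∧ φ z ≤ a then dens A φ else 0) := by
    rw [← lintegral_add_left (Measurable.ite
      (measurableSet_lt measurable_const (measurable_pi_apply z)) (by fun_prop) measurable_const)]
    refine lintegral_congr fun φ => ?_
    by_cases h1 : a < φ z
    · simp [h1, ha0.trans h1, not_le.2 h1]
    · by_cases h2 : 0 < φ z <;> simp [h1, h2, not_lt.1 h1]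
  have hfin : ∫⁻ φ, (if 0 < φ z then dens A φ else 0) ≠ ⊤ := by
    refine ne_top_of_le_ne_top (meas_univ_pos hA.posDef).2 (lintegral_mono fun φ => ?_)
    beta_reduce
    split_ifs <;> simp
  have hgt : ∫⁻ φ, (if a < φ z then dens A φ else 0) ≤
      (∑ K with ¬ s ≤ capM A K, p K) + ENNReal.ofReal (2 / 3) * ∑ K with s ≤ capM A K, p K := by
    refine (lintegral_dens_gt_le hA z ha0.le).trans ?_
    rw [← Finset.sum_filter_add_sum_filter_not Finset.univ fun K => s ≤ capM A K, add_comm,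
      Finset.mul_sum]
    refine add_le_add (Finset.sum_le_sum fun K _ => ?_) (Finset.sum_le_sum fun K hK => ?_)
    · refine mul_le_of_le_one_left' (ENNReal.ofReal_le_one.2 (Real.exp_le_one_iff.2 ?_))
      have := mul_nonneg (sq_nonneg a) (capM_nonneg hA K)
      linarith
    · gcongr
      have hK' : s ≤ capM A K := by simpa using hK
      have h1 : 1 ≤ a ^ 2 * capM A K := by
        rw [← has]
        gcongr
      calc Real.exp (-(a ^ 2 * capM A K) / 2) ≤ Real.exp (-(1 / 2)) := by gcongr; linarith
        _ = (Real.exp (1 / 2))⁻¹ := Real.exp_neg _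
        _ ≤ (3 / 2)⁻¹ := by
          gcongr
          linarith [Real.add_one_le_exp (1 / 2 : ℝ)]
        _ = 2 / 3 := by norm_num
  have hsplit' : ∑ K, p K = (∑ K with s ≤ capM A K, p K) + ∑ K with ¬ s ≤ capM A K, p K :=
    (Finset.sum_filter_add_sum_filter_not _ _ _).symm
  set H := ∑ K with s ≤ capM A K, p K
  set L := ∑ K with ¬ s ≤ capM A K, p K
  set Q := ∫⁻ φ, (if 0 < φ z ∧ φ z ≤ a then dens A φ else 0)
  have hle : H + L ≤ (L + ENNReal.ofReal (2 / 3) * H) + Q := by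
    rw [← hsplit', hsum, hsplit]
    gcongr
  have htop : H + L ≠ ⊤ := by rw [← hsplit', hsum]; exact hfin
  have hQ : Q ≠ ⊤ := ne_top_of_le_ne_top hfin (hsplit ▸ le_add_self)
  have hH : H ≠ ⊤ := ne_top_of_le_ne_top htop le_self_add
  have hL : L ≠ ⊤ := ne_top_of_le_ne_top htop le_add_self
  clear_value H L Q
  lift H to ℝ≥0 using hH
  lift L to ℝ≥0 using hL
  lift Q to ℝ≥0 using hQ
  have h23 : ENNReal.ofReal (2 / 3) = ((2 / 3 : ℝ≥0) : ℝ≥0∞) := by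
    rw [ENNReal.ofReal]
    congr 1
    rw [Real.toNNReal_div (by norm_num)]
    norm_num
  rw [h23] at hle
  norm_cast at hle ⊢
  rw [← NNReal.coe_le_coe] at hle ⊢
  push_cast at hle ⊢
  linarith

end GaussMat

/-! ## Two point functions avoiding a set -/

namespace GaussMat

open Matrix FinPerc

variable {ι : Type*} [Fintype ι] [DecidableEq ι] {A : Matrix ι ι ℝ}

/-- The precision matrix in which `v` is decoupled, keeping its variance. -/
def decouple (A : Matrix ι ι ℝ) (v : ι) : Matrix ι ι ℝ := fun i j =>
  if i = v then (if j = v then (A⁻¹ v v)⁻¹ else 0) else if j = v then 0 else A i j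

lemma decouple_mulVec_self (v : ι) (x : ι → ℝ) :
    (decouple A v *ᵥ x) v = (A⁻¹ v v)⁻¹ * x v := by
  simp [mulVec, dotProduct, decouple]

lemma decouple_mulVec_ne {v i : ι} (hi : i ≠ v) (x : ι → ℝ) :
    (decouple A v *ᵥ x) i = (A *ᵥ Function.update x v 0) i := by
  simp only [mulVec, dotProduct, decouple, if_neg hi]
  refine Finset.sum_congr rfl fun j _ => ?_
  by_cases hj : j = v
  · subst hj; simp
  · simp [hj]

lemma quad_decouple (v : ι) (x : ι → ℝ) : x ⬝ᵥ decouple A v *ᵥ x =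
    Function.update x v 0 ⬝ᵥ A *ᵥ Function.update x v 0 + x v ^ 2 * (A⁻¹ v v)⁻¹ := by
  rw [dotProduct, dotProduct, Fintype.sum_eq_add_sum_compl v,
    Fintype.sum_eq_add_sum_compl v (fun i => Function.update x v 0 i * _), decouple_mulVec_self,
    Function.update_self, zero_mul, zero_add, add_comm]
  congr 1
  · refine Finset.sum_congr rfl fun i hi => ?_
    have hi' : i ≠ v := by simpa using hi
    rw [decouple_mulVec_ne hi', Function.update_of_ne hi']
  · ring

lemma isMMat_decouple (hA : IsMMat A) (v : ι) : IsMMat (decouple A v) := by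
  have hg := inv_pos.2 (inv_diag_pos hA.posDef v)
  refine ⟨.of_dotProduct_mulVec_pos ?_ fun x hx => ?_, fun i j hij => ?_, fun i => ?_⟩
  · ext i j
    simp only [conjTranspose_apply, decouple, star_trivial]
    rw [posDef_symm hA.posDef i j]
    split_ifs <;> rfl
  · rw [star_trivial, quad_decouple]
    by_cases hv : x v = 0
    · rw [← hv, Function.update_eq_self]
      have := hA.posDef.dotProduct_mulVec_pos hx
      rw [star_trivial] at this
      rw [hv]
      linarith
    · have := quad_nonneg hA.posDef (Function.update x v 0)
      have : 0 < x v ^ 2 * (A⁻¹ v v)⁻¹ := mul_pos (by positivity) hg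
      linarith
  · unfold decouple
    split_ifs with h1 h2
    · exact absurd (h1.trans h2.symm) hij
    · exact le_rfl
    · exact le_rfl
    · exact hA.offdiag i j hij
  · by_cases hi : i = v
    · subst hi
      rw [decouple_mulVec_self, Pi.one_apply, mul_one]
      exact hg.le
    · rw [decouple_mulVec_ne hi]
      have e : Function.update (1 : ι → ℝ) v 0 = 1 - Pi.single v 1 := by
        funext j
        by_cases hj : j = v
        · subst hj; simp
        · simp [hj]
      rw [e, mulVec_sub, Pi.sub_apply, mulVec_single_one, col_apply]
      linarith [hA.row i, hA.offdiag i v hi]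

/-- Energy of a function with prescribed value at `v`. -/
lemma le_quad_of_apply (hA : A.PosDef) (v : ι) (x : ι → ℝ) :
    x v ^ 2 * (A⁻¹ v v)⁻¹ ≤ x ⬝ᵥ A *ᵥ x := by
  have h := cauchy_schwarz hA x (fun i => A⁻¹ i v)
  rw [mulVec_inv_col hA, dotProduct_single, dotProduct_single, mul_one, mul_one] at h
  have hg := inv_diag_pos hA v
  rw [← div_eq_mul_inv, div_le_iff₀ hg]
  exact h

lemma lintegral_dens_decouple_le (hA : IsMMat A) (v : ι) :
    ∫⁻ φ, dens (decouple A v) φ ≤ ∫⁻ φ, dens A φ := by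
  have hg := inv_diag_pos hA.posDef v
  refine lintegral_le_of_extZ {v}ᶜ (by fun_prop) (by fun_prop) fun x hx => ?_
  set f := x v
  have hx' : x = f • Pi.single v 1 := by
    funext i
    by_cases hi : i = v
    · subst hi; simp [f]
    · simp [hi, hx i (by simpa using hi)]
  set m : ι → ℝ := fun i => A⁻¹ i v * (A⁻¹ v v)⁻¹ with hm
  have hmv : m v = 1 := mul_inv_cancel₀ hg.ne'
  set θ : ι → ℝ := f • (Pi.single v 1 - m) with hθ
  have hθ0 : ∀ i ∉ ({v}ᶜ : Finset ι), θ i = 0 := fun i hi => by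
    have : i = v := by simpa using hi
    subst this
    simp [hθ, hmv]
  have hAm : A *ᵥ m = (A⁻¹ v v)⁻¹ • Pi.single v 1 := by
    rw [← mulVec_inv_col hA.posDef v, ← mulVec_smul]
    congr 1
    funext i
    simp [hm, mul_comm]
  rw [← lintegral_add_right_eq_self (μ := volume) (fun y => dens (decouple A v) (x + extZ _ y))
    (fun i : ({v}ᶜ : Finset ι) => θ i)]
  refine lintegral_mono fun y => ?_
  rw [← extZ_add _ y hθ0]
  set η := extZ ({v}ᶜ : Finset ι) y with hη
  have hηv : η v = 0 := by simp [hη, extZ]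
  have hθv : θ v = 0 := hθ0 v (by simp)
  rw [dens, dens]
  refine ENNReal.ofReal_le_ofReal ?_
  gcongr
  rw [quad_decouple]
  have e1 : Function.update (x + (η + θ)) v 0 = η + θ := by
    funext i
    by_cases hi : i = v
    · subst hi; simp [hηv, hθv]
    · simp [hi, hx i (by simpa using hi)]
  have e2 : x + η = f • m + (η + θ) := by
    rw [hθ, smul_sub, ← hx']; abel
  have e3 : (η + θ) ⬝ᵥ A *ᵥ (f • m) = 0 := by
    rw [mulVec_smul, hAm, dotProduct_smul, dotProduct_smul, dotProduct_single]
    simp [hηv, hθv]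
  have e4 : (x + (η + θ)) v = f := by simp [hηv, hθv, f]
  rw [e1, e2, quad_add hA.posDef, e3, e4, mulVec_smul, smul_dotProduct, dotProduct_smul, hAm,
    dotProduct_smul, dotProduct_single, hmv]
  simp only [smul_eq_mul]
  linarith

/-- The two point integrand on the event that the cluster of `z` is `K`. -/
def twoPt (A : Matrix ι ι ℝ) (z y : ι) (K : Finset ι) (φ : ι → ℝ) : ℝ≥0∞ :=
  ENNReal.ofReal (max (φ z) 0 * max (φ y) 0 * clProb (qE A φ) z K) * dens A φ

@[fun_prop]
lemma measurable_twoPt (A : Matrix ι ι ℝ) (z y : ι) (K : Finset ι) :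
    Measurable (twoPt A z y K) := by
  unfold twoPt
  fun_prop

lemma twoPt_eq_zero {z y v : ι} {K : Finset ι} {φ : ι → ℝ} (hv : v ∈ K) (hφ : φ v ≤ 0) :
    twoPt A z y K φ = 0 := by
  by_cases hz : 0 < φ z
  · rw [twoPt, clProb_eq_zero hz hv hφ]
    simp
  · rw [twoPt, max_eq_right (not_lt.1 hz)]
    simp

lemma twoPt_fiber (hA : IsMMat A) {z y : ι} {K : Finset ι} (hz : z ∈ K) (hy : y ∈ K)
    {ψ η : ι → ℝ} (hψ : ∀ x ∉ K, ψ x = 0) (hψ' : ∀ x ∈ K, 0 ≤ ψ x) (hη : ∀ x ∈ K, η x = 0) :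
    twoPt A z y K (ψ + η) = ENNReal.ofReal (ψ z * ψ y *
      (Real.exp (-(ψ ⬝ᵥ A *ᵥ ψ) / 2) * innerProb (qE A ψ) z K) *
        (Real.exp (-(η ⬝ᵥ A *ᵥ η) / 2) * Real.exp (-∑ y ∈ Kᶜ, bd A K ψ y * |η y|))) := by
  have hc := clProb_nonneg (qE_nonneg A (ψ + η)) (qE_le_one hA (ψ + η)) z K
  rw [twoPt, dens, ← ENNReal.ofReal_mul (by positivity), mul_assoc (_ * _),
    mul_comm (clProb _ _ _), quad_add hA.posDef, exp_quad_mul_clProb hA.posDef z hψ hψ' hη]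
  simp only [Pi.add_apply, hη z hz, hη y hy, add_zero, max_eq_left (hψ' z hz),
    max_eq_left (hψ' y hy)]
  congr 1; ring

lemma lintegral_twoPt_le_decouple (hA : IsMMat A) {z y v : ι} {K : Finset ι} (hy : y ∈ K)
    (hv : v ∉ K) : ∫⁻ φ, twoPt A z y K φ ≤ ∫⁻ φ, twoPt (decouple A v) z y K φ := by
  have hg := inv_pos.2 (inv_diag_pos hA.posDef v)
  refine lintegral_le_of_fiber hA.posDef (Kᶜ.erase v) (by fun_prop) (by fun_prop) fun x hx => ?_
  have hx0 : ∀ i ∉ K, i ≠ v → x i = 0 := fun i hi hiv => hx i (by simp [hi, hiv])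
  by_cases hpos : z ∈ K ∧ ∀ i ∈ K, 0 < x i
  swap
  · refine ⟨0, by simp, 0, by simp, 0, fun η hη => ⟨?_, by simp⟩⟩
    rw [zero_mul, nonpos_iff_eq_zero]
    by_cases hzK : z ∈ K
    · obtain ⟨w, hw, hw'⟩ : ∃ w ∈ K, x w ≤ 0 := by
        by_contra! h
        exact hpos ⟨hzK, h⟩
      refine twoPt_eq_zero hw ?_
      rw [Pi.add_apply, hη w (by simp [hw]), add_zero]
      exact hw'
    · rw [twoPt, clProb_eq_zero' hzK]
      simp
  obtain ⟨hz, hpos⟩ := hpos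
  set f := x v with hf
  set ψ : ι → ℝ := Function.update x v 0 with hψdef
  have hψv : ψ v = 0 := by simp [hψdef]
  have hψK : ∀ i ∈ K, ψ i = x i := fun i hi =>
    Function.update_of_ne (fun e : i = v => hv (e ▸ hi)) _ _
  have hψ : ∀ i ∉ K, ψ i = 0 := fun i hi => by
    by_cases hiv : i = v
    · rw [hiv, hψv]
    · rw [hψdef, Function.update_of_ne hiv, hx0 i hi hiv]
  have hψ' : ∀ i ∈ K, 0 ≤ ψ i := fun i hi => by rw [hψK i hi]; exact (hpos i hi).le
  have hxψ : x = ψ + f • Pi.single v 1 := by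
    funext i
    by_cases hiv : i = v
    · subst hiv; simp [hψv, f]
    · simp [hψdef, hiv]
  obtain ⟨θ', hθ1, hθ2⟩ := exists_dirichlet hA.posDef (Kᶜ.erase v) (Pi.single v 1) 0
  have hθv : θ' v = 1 := by rw [hθ1 v (by simp)]; simp
  have hi := innerProb_nonneg (qE_nonneg A ψ) (qE_le_one hA ψ) z K
  refine ⟨f • (Pi.single v 1 - θ'), fun i hi => by simp [hθ1 i hi], bd A K ψ, bd_nonneg hA hψ',
    ENNReal.ofReal (ψ z * ψ y * (Real.exp (-(ψ ⬝ᵥ A *ᵥ ψ) / 2) * innerProb (qE A ψ) z K) *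
      Real.exp (-(f ^ 2 * (A⁻¹ v v)⁻¹) / 2)), fun η hη => ?_⟩
  have hzz := hψ' z hz
  have hyy := hψ' y hy
  have hηK : ∀ i ∈ K, η i = 0 := fun i hi => hη i (by simp [hi])
  have hηv : η v = 0 := hη v (by simp)
  set η' : ι → ℝ := f • Pi.single v 1 + η with hη'
  have hη'K : ∀ i ∈ K, η' i = 0 := fun i hi => by
    have : i ≠ v := fun e => hv (e ▸ hi)
    simp [hη', hηK i hi, this]
  have hxη : x + η = ψ + η' := by rw [hxψ, add_assoc]
  have hη's : ∀ i ∈ Kᶜ.erase v, η' i = η i := fun i hi => by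
    simp [hη', Finset.ne_of_mem_erase hi]
  have hη'v : η' v = f := by simp [hη', hηv]
  have hK : Kᶜ = insert v (Kᶜ.erase v) := (Finset.insert_erase (by simpa using hv)).symm
  have hsum : ∀ b : ι → ℝ, ∑ i ∈ Kᶜ, b i * |η' i| =
      b v * |f| + ∑ i ∈ Kᶜ.erase v, b i * |η i| := fun b => by
    conv_lhs => rw [hK]
    rw [Finset.sum_insert (Finset.notMem_erase _ _), hη'v]
    congr 1
    exact Finset.sum_congr rfl fun i hi => by rw [hη's i hi]
  constructor
  · rw [hxη, twoPt_fiber hA hz hy hψ hψ' hη'K, dens, ← ENNReal.ofReal_mul (by positivity),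
      ← ENNReal.ofReal_mul (by positivity), hsum, mul_assoc (ψ z * ψ y * _)]
    refine ENNReal.ofReal_le_ofReal ?_
    refine mul_le_mul_of_nonneg_left ?_ (by positivity)
    have hb := mul_nonneg (bd_nonneg hA hψ' v) (abs_nonneg f)
    have e1 : η' = f • θ' + (η + f • (Pi.single v 1 - θ')) := by
      rw [hη', smul_sub]; abel
    have e2 : (η + f • (Pi.single v 1 - θ')) ⬝ᵥ A *ᵥ (f • θ') = 0 :=
      Finset.sum_eq_zero fun i _ => by
        rw [mulVec_smul, Pi.smul_apply]
        by_cases his : i ∈ Kᶜ.erase v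
        · rw [hθ2 i his]; simp
        · simp [hη i his, hθ1 i his]
    have e3 := le_quad_of_apply hA.posDef v (f • θ')
    rw [Pi.smul_apply, hθv, smul_eq_mul, mul_one] at e3
    have e4 : η' ⬝ᵥ A *ᵥ η' = (f • θ') ⬝ᵥ A *ᵥ (f • θ') + 2 * 0 +
        (η + f • (Pi.single v 1 - θ')) ⬝ᵥ A *ᵥ (η + f • (Pi.single v 1 - θ')) := by
      rw [← e2, ← quad_add hA.posDef, ← e1]
    rw [← Real.exp_add, ← Real.exp_add, ← Real.exp_add]
    refine Real.exp_le_exp.2 ?_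
    linarith
  · have hbd : ∀ i, bd (decouple A v) K ψ i = if i = v then 0 else bd A K ψ i := fun i => by
      unfold bd
      by_cases hiK : i ∈ K
      · simp [hiK]
      rw [if_neg hiK, if_neg hiK]
      split_ifs with hiv
      · rw [neg_eq_zero]
        refine Finset.sum_eq_zero fun j hj => ?_
        have : j ≠ v := fun e => hv (e ▸ hj)
        simp [decouple, hiv, this]
      · congr 1
        refine Finset.sum_congr rfl fun j hj => ?_
        have : j ≠ v := fun e => hv (e ▸ hj)
        simp [decouple, hiv, this]
    have hin : innerProb (qE (decouple A v) ψ) z K = innerProb (qE A ψ) z K :=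
      innerProb_congr z K fun i hi j hj => by
        have h1 : i ≠ v := fun e => hv (e ▸ hi)
        have h2 : j ≠ v := fun e => hv (e ▸ hj)
        simp [qE_mk, decouple, h1, h2]
    have hq1 : ψ ⬝ᵥ decouple A v *ᵥ ψ = ψ ⬝ᵥ A *ᵥ ψ := by
      rw [quad_decouple, hψv, show Function.update ψ v 0 = ψ by rw [← hψv, Function.update_eq_self]]
      ring
    have hq2 : η' ⬝ᵥ decouple A v *ᵥ η' = η ⬝ᵥ A *ᵥ η + f ^ 2 * (A⁻¹ v v)⁻¹ := by
      rw [quad_decouple, hη'v]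
      congr 3 <;>
      · funext i
        by_cases hiv : i = v
        · subst hiv; simp [hηv]
        · simp [hη', hiv]
    have hs2 : ∑ i ∈ Kᶜ.erase v, (if i = v then 0 else bd A K ψ i) * |η i| =
        ∑ i ∈ Kᶜ.erase v, bd A K ψ i * |η i| :=
      Finset.sum_congr rfl fun i hi => by rw [if_neg (Finset.ne_of_mem_erase hi)]
    rw [hxη, twoPt_fiber (isMMat_decouple hA v) hz hy hψ hψ' hη'K, dens,
      ← ENNReal.ofReal_mul (by positivity), ← ENNReal.ofReal_mul (by positivity), hsum, hin, hq1,
      hq2]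
    simp only [hbd, hs2, if_true, zero_mul, zero_add]
    refine ENNReal.ofReal_le_ofReal (le_of_eq ?_)
    rw [neg_add, add_div, Real.exp_add]
    ring

end GaussMat

namespace GaussMat

open Matrix FinPerc

variable {ι : Type*} [Fintype ι] [DecidableEq ι] {A : Matrix ι ι ℝ}

/-- Flip the sign of all coordinates outside of `K`. -/
def flipOff (K : Finset ι) (φ : ι → ℝ) (i : ι) : ℝ := if i ∈ K then φ i else -φ i

lemma measurePreserving_flipOff (K : Finset ι) :
    MeasurePreserving (flipOff K) (volume : Measure (ι → ℝ)) volume := by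
  have := volume_preserving_pi (ι := ι) (α' := fun _ => ℝ) (β' := fun _ => ℝ)
    (f := fun i t => if i ∈ K then t else -t) fun i => by
      by_cases hi : i ∈ K
      · simp only [hi, if_true]; exact MeasurePreserving.id _
      · simp only [hi, if_false]; exact Measure.measurePreserving_neg _
  exact this

lemma clProb_mul_dens_flipOff (hA : IsMMat A) (z : ι) {K : Finset ι} {φ : ι → ℝ}
    (hφ : ∀ x ∈ K, 0 ≤ φ x) :
    ENNReal.ofReal (clProb (qE A (flipOff K φ)) z K) * dens A (flipOff K φ) =
      ENNReal.ofReal (clProb (qE A φ) z K) * dens A φ := by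
  set ψ : ι → ℝ := fun i => if i ∈ K then φ i else 0 with hψ
  set η : ι → ℝ := fun i => if i ∈ K then 0 else φ i with hη
  have e1 : φ = ψ + η := by
    funext i; by_cases hi : i ∈ K <;> simp [hψ, hη, hi]
  have e2 : flipOff K φ = ψ + -η := by
    funext i; by_cases hi : i ∈ K <;> simp [hψ, hη, hi, flipOff]
  have key : ∀ η' : ι → ℝ, (∀ x ∈ K, η' x = 0) →
      ENNReal.ofReal (clProb (qE A (ψ + η')) z K) * dens A (ψ + η') =
      ENNReal.ofReal (Real.exp (-(ψ ⬝ᵥ A *ᵥ ψ) / 2) * innerProb (qE A ψ) z K *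
        (Real.exp (-(η' ⬝ᵥ A *ᵥ η') / 2) *
          Real.exp (-∑ y ∈ Kᶜ, bd A K ψ y * |η' y|))) := fun η' hη' => by
    rw [dens, ← ENNReal.ofReal_mul (clProb_nonneg (qE_nonneg A _) (qE_le_one hA _) z K), mul_comm,
      quad_add hA.posDef,
      exp_quad_mul_clProb hA.posDef z (by simp +contextual [hψ])
        (by simp +contextual [hψ, hφ]) hη']
  rw [e2, e1, key _ (by simp +contextual [hη]), key _ (by simp +contextual [hη])]
  simp only [mulVec_neg, neg_dotProduct, dotProduct_neg, neg_neg, Pi.neg_apply, abs_neg]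

lemma memLp_of_map_gaussianReal {Ω : Type*} [MeasurableSpace Ω] {μ : Measure Ω} {X : Ω → ℝ}
    (hX : Measurable X) {v : ℝ≥0} (h : μ.map X = gaussianReal 0 v) : MemLp X 2 μ := by
  have := memLp_id_gaussianReal (μ := 0) (v := v) 2
  rw [← h] at this
  exact (memLp_map_measure_iff aestronglyMeasurable_id hX.aemeasurable).1 this

lemma integral_sq_of_map_gaussianReal {Ω : Type*} [MeasurableSpace Ω] {μ : Measure Ω}
    {X : Ω → ℝ} (hX : Measurable X) {v : ℝ≥0} (h : μ.map X = gaussianReal 0 v) :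
    ∫ ω, X ω ^ 2 ∂μ = v := by
  have h1 := variance_id_gaussianReal (μ := 0) (v := v)
  rw [variance_eq_integral (by fun_prop)] at h1
  simp only [integral_id_gaussianReal, id, sub_zero] at h1
  rw [← h1, ← h, integral_map hX.aemeasurable (by fun_prop)]

/-- The untruncated two point estimate for the product of positive parts. -/
lemma sum_lintegral_twoPt (hA : IsMMat A) (z y : ι) :
    ∑ K with y ∈ K, ∫⁻ φ, twoPt A z y K φ = ENNReal.ofReal (A⁻¹ z y / 2) * ∫⁻ φ, dens A φ := by
  obtain ⟨c, hc0, hct, hprob, hlaw⟩ := exists_law hA.posDef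
  set μ := c • meas A with hμ
  have toμ : ∀ f : (ι → ℝ) → ℝ≥0∞, Measurable f → c * ∫⁻ φ, f φ * dens A φ = ∫⁻ φ, f φ ∂μ := by
    intro f hf
    rw [hμ, lintegral_smul_measure, meas,
      lintegral_withDensity_eq_lintegral_mul _ (measurable_dens A) hf, smul_eq_mul]
    simp only [Pi.mul_apply, mul_comm]
  -- covariances
  have hm2 : ∀ v : ι → ℝ, MemLp (fun φ => v ⬝ᵥ φ) 2 μ := fun v =>
    memLp_of_map_gaussianReal (by unfold dotProduct; fun_prop) (hlaw v)
  have hsq : ∀ v : ι → ℝ, ∫ φ, (v ⬝ᵥ φ) ^ 2 ∂μ = v ⬝ᵥ A⁻¹ *ᵥ v := fun v => by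
    rw [integral_sq_of_map_gaussianReal (by unfold dotProduct; fun_prop) (hlaw v),
      Real.coe_toNNReal _ (quad_nonneg hA.posDef.inv v)]
  have hco : ∀ i, MemLp (fun φ : ι → ℝ => φ i) 2 μ := fun i => by
    simpa using hm2 (Pi.single i 1)
  have hcov : ∫ φ, φ z * φ y ∂μ = A⁻¹ z y := by
    have h1 := hsq (Pi.single z 1 + Pi.single y 1)
    have h2 := hsq (Pi.single z 1 - Pi.single y 1)
    have i1 := (hm2 (Pi.single z 1 + Pi.single y 1)).integrable_sq
    have i2 := (hm2 (Pi.single z 1 - Pi.single y 1)).integrable_sq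
    have h3 : ∫ φ : ι → ℝ, φ z * φ y ∂μ = ∫ φ, (((Pi.single z 1 + Pi.single y 1) ⬝ᵥ φ) ^ 2 -
        ((Pi.single z 1 - Pi.single y 1) ⬝ᵥ φ) ^ 2) / 4 ∂μ := by
      refine integral_congr_ae (Eventually.of_forall fun φ => ?_)
      simp only [add_dotProduct, sub_dotProduct, single_dotProduct, one_mul]
      ring
    rw [h3, integral_div, integral_sub i1 i2, h1, h2]
    simp only [mulVec_add, mulVec_sub, add_dotProduct, sub_dotProduct, dotProduct_add,
      dotProduct_sub, single_dotProduct, mulVec_single, one_mul, MulOpposite.op_one, one_smul,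
      Matrix.col_apply]
    rw [inv_symm hA.posDef y z]
    ring
  -- symmetry
  have hneg : μ.map (fun φ => -φ) = μ := by
    refine ext_of_map_dotProduct fun v => ?_
    rw [Measure.map_map (by unfold dotProduct; fun_prop) (by fun_prop), hlaw v]
    have : ((fun φ => v ⬝ᵥ φ) ∘ fun φ : ι → ℝ => -φ) = fun φ => (-v) ⬝ᵥ φ := by
      funext φ; simp
    rw [this, hlaw (-v)]
    simp [mulVec_neg]
  have hsym : ∀ f : (ι → ℝ) → ℝ, Measurable f → ∫ φ, f (-φ) ∂μ = ∫ φ, f φ ∂μ := fun f hf => by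
    conv_rhs => rw [← hneg]
    rw [integral_map (by fun_prop) hf.aestronglyMeasurable]
  have hpos : ∀ i, MemLp (fun φ : ι → ℝ => max (φ i) 0) 2 μ := fun i => (hco i).pos_part
  have hnegp : ∀ i, MemLp (fun φ : ι → ℝ => max (-φ i) 0) 2 μ := fun i => (hco i).neg_part
  have ipp : Integrable (fun φ : ι → ℝ => max (φ z) 0 * max (φ y) 0) μ :=
    (hpos z).integrable_mul (hpos y)
  have ipn : Integrable (fun φ : ι → ℝ => max (φ z) 0 * max (-φ y) 0) μ :=
    (hpos z).integrable_mul (hnegp y)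
  have inp : Integrable (fun φ : ι → ℝ => max (-φ z) 0 * max (φ y) 0) μ :=
    (hnegp z).integrable_mul (hpos y)
  have inn : Integrable (fun φ : ι → ℝ => max (-φ z) 0 * max (-φ y) 0) μ :=
    (hnegp z).integrable_mul (hnegp y)
  have hdiff : ∫ φ, max (φ z) 0 * max (φ y) 0 ∂μ - ∫ φ, max (φ z) 0 * max (-φ y) 0 ∂μ =
      A⁻¹ z y / 2 := by
    have s1 := hsym (fun φ => max (φ z) 0 * max (φ y) 0) (by fun_prop)
    have s2 := hsym (fun φ => max (φ z) 0 * max (-φ y) 0) (by fun_prop)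
    simp only [Pi.neg_apply, neg_neg] at s1 s2
    have h3 : ∫ φ : ι → ℝ, φ z * φ y ∂μ =
        ∫ φ, (max (φ z) 0 * max (φ y) 0 - max (φ z) 0 * max (-φ y) 0) -
          (max (-φ z) 0 * max (φ y) 0 - max (-φ z) 0 * max (-φ y) 0) ∂μ := by
      refine integral_congr_ae (Eventually.of_forall fun φ => ?_)
      have a1 : φ z = max (φ z) 0 - max (-φ z) 0 := by
        rcases le_total 0 (φ z) with h | h <;> simp [h]
      have a2 : φ y = max (φ y) 0 - max (-φ y) 0 := by
        rcases le_total 0 (φ y) with h | h <;> simp [h]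
      change φ z * φ y = _
      conv_lhs => rw [a1, a2]
      ring
    have h4 : ∫ φ, (max (φ z) 0 * max (φ y) 0 - max (φ z) 0 * max (-φ y) 0) -
          (max (-φ z) 0 * max (φ y) 0 - max (-φ z) 0 * max (-φ y) 0) ∂μ =
        (∫ φ, max (φ z) 0 * max (φ y) 0 ∂μ - ∫ φ, max (φ z) 0 * max (-φ y) 0 ∂μ) -
        (∫ φ, max (-φ z) 0 * max (φ y) 0 ∂μ - ∫ φ, max (-φ z) 0 * max (-φ y) 0 ∂μ) := by
      rw [← integral_sub ipp ipn, ← integral_sub inp inn]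
      exact integral_sub (ipp.sub ipn) (inp.sub inn)
    rw [hcov, h4] at h3
    linarith
  have hP : ∫⁻ φ, ENNReal.ofReal (max (φ z) 0 * max (φ y) 0) ∂μ =
      ENNReal.ofReal (∫ φ, max (φ z) 0 * max (φ y) 0 ∂μ) :=
    (ofReal_integral_eq_lintegral_ofReal ipp (Eventually.of_forall fun φ =>
      mul_nonneg (le_max_right _ _) (le_max_right _ _))).symm
  have hN : ∫⁻ φ, ENNReal.ofReal (max (φ z) 0 * max (-φ y) 0) ∂μ =
      ENNReal.ofReal (∫ φ, max (φ z) 0 * max (-φ y) 0 ∂μ) :=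
    (ofReal_integral_eq_lintegral_ofReal ipn (Eventually.of_forall fun φ =>
      mul_nonneg (le_max_right _ _) (le_max_right _ _))).symm
  -- decomposition over the cluster
  have hdec : ∀ w : ℝ, 0 ≤ w → ∀ φ : ι → ℝ, ∑ K, ENNReal.ofReal (w * clProb (qE A φ) z K) * dens A φ =
      ENNReal.ofReal w * dens A φ := fun w hw φ => by
    rw [← Finset.sum_mul, ← ENNReal.ofReal_sum_of_nonneg fun K _ => mul_nonneg hw
      (clProb_nonneg (qE_nonneg A φ) (qE_le_one hA φ) z K), ← Finset.mul_sum, sum_clProb, mul_one]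
  have hPX : ∫⁻ φ, ENNReal.ofReal (max (φ z) 0 * max (φ y) 0) * dens A φ =
      (∑ K with y ∈ K, ∫⁻ φ, twoPt A z y K φ) + ∑ K with y ∉ K, ∫⁻ φ, twoPt A z y K φ := by
    rw [Finset.sum_filter_add_sum_filter_not Finset.univ (fun K => y ∈ K) fun K => ∫⁻ φ, twoPt A z y K φ,
      ← lintegral_finsetSum _ fun K _ => measurable_twoPt A z y K]
    exact lintegral_congr fun φ => (hdec _ (by positivity) φ).symm
  have hNX : ∫⁻ φ, ENNReal.ofReal (max (φ z) 0 * max (-φ y) 0) * dens A φ =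
      ∑ K with y ∉ K, ∫⁻ φ, twoPt A z y K φ := by
    have hzero : ∀ K : Finset ι, ∀ φ : ι → ℝ, ∀ v ∈ K, φ v ≤ 0 → ∀ w : ℝ,
        max (φ z) 0 * w * clProb (qE A φ) z K = 0 := fun K φ v hv hφ w => by
      by_cases hz : 0 < φ z
      · rw [clProb_eq_zero hz hv hφ, mul_zero]
      · rw [max_eq_right (not_lt.1 hz)]; ring
    have h1 : ∀ K, ∫⁻ φ, ENNReal.ofReal (max (φ z) 0 * max (-φ y) 0 * clProb (qE A φ) z K) * dens A φ =
        if y ∉ K then ∫⁻ φ, twoPt A z y K φ else 0 := by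
      intro K
      split_ifs with hy
      · rw [lintegral_eq_zero_iff (by fun_prop)]
        refine Eventually.of_forall fun φ => ?_
        simp only [Pi.zero_apply]
        by_cases h0 : φ y ≤ 0
        · rw [hzero K φ y hy h0]; simp
        · rw [max_eq_right (a := -φ y) (by linarith)]; simp
      · rw [← (measurePreserving_flipOff K).lintegral_comp (measurable_twoPt A z y K)]
        refine lintegral_congr fun φ => ?_
        by_cases hzK : z ∈ K
        swap
        · rw [twoPt, clProb_eq_zero' hzK, clProb_eq_zero' hzK]; simp
        by_cases hp : ∀ v ∈ K, 0 ≤ φ v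
        · have := clProb_mul_dens_flipOff hA z hp
          have e3 : flipOff K φ z = φ z := by simp [flipOff, hzK]
          have e4 : flipOff K φ y = -φ y := by simp [flipOff, hy]
          have hw : 0 ≤ max (φ z) 0 * max (-φ y) 0 := by positivity
          rw [twoPt, e3, e4, ENNReal.ofReal_mul hw, ENNReal.ofReal_mul hw, mul_assoc, mul_assoc,
            this]
        · push Not at hp
          obtain ⟨v, hv, hφv⟩ := hp
          rw [hzero K φ v hv hφv.le, twoPt_eq_zero hv (by simp [flipOff, hv, hφv.le])]
          simp
    rw [Finset.sum_filter]
    simp_rw [← h1]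
    rw [← lintegral_finsetSum _ fun K _ => by fun_prop]
    exact lintegral_congr fun φ => (hdec _ (by positivity) φ).symm
  have hc1 : c * ∫⁻ φ, dens A φ = 1 := by
    have := toμ (fun _ => 1) measurable_const
    simpa using this
  have hX : c * ∑ K with y ∈ K, ∫⁻ φ, twoPt A z y K φ = ENNReal.ofReal (A⁻¹ z y / 2) := by
    rw [← hNX] at hPX
    have h5 : c * _ = c * (_ + _) := congrArg (c * ·) hPX
    rw [mul_add, toμ _ (by fun_prop), toμ _ (by fun_prop), hP, hN] at h5
    rw [← hdiff, ENNReal.ofReal_sub _ (integral_nonneg fun φ =>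
      mul_nonneg (le_max_right _ _) (le_max_right _ _)), h5, ENNReal.add_sub_cancel_right ENNReal.ofReal_ne_top]
  have : c * ∑ K with y ∈ K, ∫⁻ φ, twoPt A z y K φ =
      c * (ENNReal.ofReal (A⁻¹ z y / 2) * ∫⁻ φ, dens A φ) := by
    rw [hX, mul_left_comm, hc1, mul_one]
  exact (ENNReal.mul_right_inj hc0 hct).1 this

/-- The two point function on the event that the cluster of `z` avoids `F` is controlled by the
Green function killed on `F`. -/
theorem sum_lintegral_twoPt_le (y z : ι) (F : Finset ι) (hy : y ∉ F) :
    ∀ {A : Matrix ι ι ℝ}, IsMMat A → ∀ U : ι → ℝ, (∀ x ∈ F, U x = 0) →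
      (∀ x ∉ F, (A *ᵥ U) x = Pi.single (M := fun _ => ℝ) y 1 x) →
      ∑ K with y ∈ K ∧ Disjoint K F, ∫⁻ φ, twoPt A z y K φ ≤
        ENNReal.ofReal (U z / 2) * ∫⁻ φ, dens A φ := by
  induction F using Finset.induction_on with
  | empty =>
    intro A hA U _ hU
    have : U z = A⁻¹ z y := by
      have h := inv_mulVec_mulVec hA.posDef U
      rw [show A *ᵥ U = Pi.single y 1 from funext fun x => hU x (by simp)] at h
      rw [← h]
      simp
    rw [this, ← sum_lintegral_twoPt hA]
    simp
  | insert v F hv ih =>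
    intro A hA U hU0 hU
    rw [Finset.mem_insert, not_or] at hy
    have hUv : Function.update U v 0 = U := by
      rw [← hU0 v (by simp), Function.update_eq_self]
    refine le_trans ?_ ((ih hy.2 (isMMat_decouple hA v) U (fun x hx => hU0 x (by simp [hx]))
      fun x hx => ?_).trans (mul_le_mul_right (lintegral_dens_decouple_le hA v) _))
    · calc ∑ K with y ∈ K ∧ Disjoint K (insert v F), ∫⁻ φ, twoPt A z y K φ
          ≤ ∑ K with y ∈ K ∧ Disjoint K (insert v F), ∫⁻ φ, twoPt (decouple A v) z y K φ :=
            Finset.sum_le_sum fun K hK => by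
              simp only [Finset.mem_filter, Finset.mem_univ, true_and,
                Finset.disjoint_insert_right] at hK
              exact lintegral_twoPt_le_decouple hA hK.1 hK.2.1
        _ ≤ _ := Finset.sum_le_sum_of_subset fun K hK => by
              simp only [Finset.mem_filter, Finset.mem_univ, true_and,
                Finset.disjoint_insert_right] at hK ⊢
              exact ⟨hK.1, hK.2.2⟩
    · by_cases hxv : x = v
      · subst hxv
        rw [decouple_mulVec_self, hU0 x (by simp), mul_zero, Pi.single_eq_of_ne (Ne.symm hy.1)]
      · rw [decouple_mulVec_ne hxv, hUv]
        exact hU x (by simp [hxv, hx])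

end GaussMat

namespace GaussMat

open Matrix FinPerc

variable {ι : Type*} [Fintype ι] [DecidableEq ι] {A : Matrix ι ι ℝ}

/-- Probability (up to normalisation) that `φ v` is positive and at most `t`. -/
def smallVal (A : Matrix ι ι ℝ) (v : ι) (t : ℝ) : ℝ≥0∞ :=
  ∫⁻ φ, if 0 < φ v ∧ φ v ≤ t then dens A φ else 0

lemma measurable_smallVal (A : Matrix ι ι ℝ) (v : ι) (t : ℝ) :
    Measurable fun φ : ι → ℝ => if 0 < φ v ∧ φ v ≤ t then dens A φ else 0 := by
  refine Measurable.ite ?_ (measurable_dens A) measurable_const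
  exact (measurableSet_lt measurable_const (measurable_pi_apply v)).inter
    (measurableSet_le (measurable_pi_apply v) measurable_const)

lemma clDens_le (hA : IsMMat A) {z y : ι} {K : Finset ι} (hy : y ∈ K) {ε : ℝ} (hε : 0 < ε)
    (φ : ι → ℝ) : clDens A z K φ ≤ (if (0 < φ z ∧ φ z ≤ ε) ∨ (0 < φ y ∧ φ y ≤ ε) then
      clDens A z K φ else 0) + ENNReal.ofReal (ε⁻¹ ^ 2) * twoPt A z y K φ := by
  split_ifs with h
  · exact le_self_add
  rw [zero_add]
  push Not at h
  unfold clDens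
  split_ifs with hz
  swap
  · simp
  by_cases hyp : φ y ≤ 0
  · rw [clProb_eq_zero hz hy hyp]; simp
  push Not at hyp
  have h1 := h.1 hz
  have h2 := h.2 hyp
  have hc := clProb_nonneg (qE_nonneg A φ) (qE_le_one hA φ) z K
  rw [twoPt, ← mul_assoc, ← ENNReal.ofReal_mul (by positivity), max_eq_left hz.le,
    max_eq_left hyp.le]
  gcongr
  have h3 : 1 ≤ ε⁻¹ ^ 2 * (φ z * φ y) := by
    have : ε * ε ≤ φ z * φ y := by gcongr
    calc (1 : ℝ) = ε⁻¹ ^ 2 * (ε * ε) := by field_simp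
      _ ≤ _ := by gcongr
  calc clProb (qE A φ) z K = 1 * clProb (qE A φ) z K := (one_mul _).symm
    _ ≤ ε⁻¹ ^ 2 * (φ z * φ y) * clProb (qE A φ) z K := by gcongr
    _ = _ := by ring

lemma sum_twoPt_le_of_law (hA : IsMMat A) {o y : ι} {s p η δ C₀ : ℝ} (hp : 0 < p) (hη : 0 ≤ η)
    {ρ : Finset ι → ℝ} (hρ : ∀ F, 0 ≤ ρ F) (hρ1 : ∑ F, ρ F = 1)
    (hK : ∀ K, capM A K < s → p ≤ ∑ F, ρ F * if Disjoint F K then 1 else 0)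
    {Q : Finset ι → Prop} (hbad : ∑ F, ρ F * (if Q F then 0 else 1) ≤ δ)
    (hgood : ∀ F, Q F → y ∉ F → gKill A F y o ≤ η) (hC : A⁻¹ o y ≤ C₀) :
    ∑ K with y ∈ K ∧ capM A K < s, ∫⁻ φ, twoPt A o y K φ ≤
      ENNReal.ofReal (p⁻¹ * (η + C₀ * δ)) * ∫⁻ φ, dens A φ := by
  have hC0 : 0 ≤ C₀ := (inv_nonneg' hA o y).trans hC
  set Z := ∫⁻ φ, dens A φ
  have hF : ∀ F, ∑ K with y ∈ K ∧ Disjoint K F, ∫⁻ φ, twoPt A o y K φ ≤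
      ENNReal.ofReal (η + C₀ * if Q F then 0 else 1) * Z := fun F => by
    by_cases hy : y ∈ F
    · rw [Finset.sum_eq_zero]
      · positivity
      · intro K hK
        simp only [Finset.mem_filter, Finset.mem_univ, true_and] at hK
        exact absurd hy (Finset.disjoint_left.1 hK.2 hK.1)
    refine (sum_lintegral_twoPt_le y o F hy hA (gKill A F y)
      (fun x hx => gKill_on hA.posDef y hx) (fun x hx => gKill_off hA.posDef y hx)).trans ?_
    gcongr
    have h0 := gKill_nonneg hA F y o
    split_ifs with hQ
    · linarith [hgood F hQ hy]
    · linarith [gKill_le hA F y o]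
  calc ∑ K with y ∈ K ∧ capM A K < s, ∫⁻ φ, twoPt A o y K φ
      ≤ ∑ K with y ∈ K ∧ capM A K < s, ENNReal.ofReal p⁻¹ * (∑ F, ENNReal.ofReal (ρ F) *
          (if Disjoint F K then 1 else 0)) * ∫⁻ φ, twoPt A o y K φ := by
        refine Finset.sum_le_sum fun K hK' => ?_
        simp only [Finset.mem_filter, Finset.mem_univ, true_and] at hK'
        refine le_mul_of_one_le_left (by positivity) ?_
        have h1 : (∑ F, ENNReal.ofReal (ρ F) * (if Disjoint F K then 1 else 0)) =
            ENNReal.ofReal (∑ F, ρ F * if Disjoint F K then 1 else 0) := by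
          rw [ENNReal.ofReal_sum_of_nonneg fun F _ => mul_nonneg (hρ F) (by positivity)]
          refine Finset.sum_congr rfl fun F _ => ?_
          split_ifs <;> simp
        rw [h1, ← ENNReal.ofReal_mul (by positivity), ← ENNReal.ofReal_one]
        refine ENNReal.ofReal_le_ofReal ?_
        rw [inv_mul_eq_div, one_le_div hp]
        exact hK K hK'.2
    _ ≤ ∑ K with y ∈ K, ENNReal.ofReal p⁻¹ * (∑ F, ENNReal.ofReal (ρ F) *
          (if Disjoint F K then 1 else 0)) * ∫⁻ φ, twoPt A o y K φ :=
        Finset.sum_le_sum_of_subset fun K hK => by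
          simp only [Finset.mem_filter, Finset.mem_univ, true_and] at hK ⊢
          exact hK.1
    _ = ENNReal.ofReal p⁻¹ * ∑ F, ENNReal.ofReal (ρ F) *
          ∑ K with y ∈ K ∧ Disjoint K F, ∫⁻ φ, twoPt A o y K φ := by
        simp_rw [mul_assoc, ← Finset.mul_sum, Finset.sum_mul, Finset.mul_sum]
        rw [Finset.sum_comm]
        refine Finset.sum_congr rfl fun F _ => ?_
        rw [← Finset.filter_filter, Finset.sum_filter (s := Finset.filter _ _)]
        refine Finset.sum_congr rfl fun K _ => ?_
        simp only [disjoint_comm (a := F)]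
        split_ifs <;> simp
    _ ≤ ENNReal.ofReal p⁻¹ * ∑ F, ENNReal.ofReal (ρ F) *
          (ENNReal.ofReal (η + C₀ * if Q F then 0 else 1) * Z) := by
        gcongr with F _
        exact hF F
    _ = ENNReal.ofReal (p⁻¹ * (η + C₀ * ∑ F, ρ F * if Q F then 0 else 1)) * Z := by
        simp_rw [← mul_assoc, ← Finset.sum_mul, ← ENNReal.ofReal_mul (hρ _)]
        rw [← ENNReal.ofReal_sum_of_nonneg fun F _ => mul_nonneg (hρ F) (by positivity),
          ← mul_assoc, ← ENNReal.ofReal_mul (by positivity)]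
        congr 3
        simp_rw [mul_add]
        rw [Finset.sum_add_distrib, ← Finset.sum_mul, hρ1, one_mul, Finset.mul_sum]
        congr 1
        exact Finset.sum_congr rfl fun F _ => by ring
    _ ≤ _ := by gcongr

theorem sum_clDens_arm_le (hA : IsMMat A) (o : ι) (T : Finset ι) {s ε p η δ C₀ : ℝ} (hs : 0 < s)
    (hε : 0 < ε) (hp : 0 < p) (hη : 0 ≤ η)
    {ρ : Finset ι → ℝ} (hρ : ∀ F, 0 ≤ ρ F) (hρ1 : ∑ F, ρ F = 1)
    (hK : ∀ K, capM A K < s → p ≤ ∑ F, ρ F * if Disjoint F K then 1 else 0)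
    {Q : Finset ι → Prop} (hbad : ∑ F, ρ F * (if Q F then 0 else 1) ≤ δ)
    (hgood : ∀ F, Q F → ∀ y ∈ T, y ∉ F → gKill A F y o ≤ η) (hC : ∀ y ∈ T, A⁻¹ o y ≤ C₀) :
    ∑ K with ¬Disjoint K T, ∫⁻ φ, clDens A o K φ ≤
      3 * smallVal A o (√s)⁻¹ + ∑ y ∈ T, (smallVal A o ε + smallVal A y ε +
        ENNReal.ofReal (ε⁻¹ ^ 2) * (ENNReal.ofReal (p⁻¹ * (η + C₀ * δ)) * ∫⁻ φ, dens A φ)) := by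
  have hy : ∀ y ∈ T, ∑ K with y ∈ K ∧ capM A K < s, ∫⁻ φ, clDens A o K φ ≤
      smallVal A o ε + smallVal A y ε +
        ENNReal.ofReal (ε⁻¹ ^ 2) * (ENNReal.ofReal (p⁻¹ * (η + C₀ * δ)) * ∫⁻ φ, dens A φ) := by
    intro y hy
    have hmeas : MeasurableSet {φ : ι → ℝ | (0 < φ o ∧ φ o ≤ ε) ∨ (0 < φ y ∧ φ y ≤ ε)} :=
      ((measurableSet_lt measurable_const (measurable_pi_apply o)).inter
        (measurableSet_le (measurable_pi_apply o) measurable_const)).union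
        ((measurableSet_lt measurable_const (measurable_pi_apply y)).inter
        (measurableSet_le (measurable_pi_apply y) measurable_const))
    have hm : ∀ K, Measurable fun φ : ι → ℝ => if (0 < φ o ∧ φ o ≤ ε) ∨ (0 < φ y ∧ φ y ≤ ε) then
        clDens A o K φ else 0 := fun K =>
      Measurable.ite hmeas (measurable_clDens A o K) measurable_const
    calc ∑ K with y ∈ K ∧ capM A K < s, ∫⁻ φ, clDens A o K φ
        ≤ ∑ K with y ∈ K ∧ capM A K < s, ((∫⁻ φ, if (0 < φ o ∧ φ o ≤ ε) ∨ (0 < φ y ∧ φ y ≤ ε) then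
          clDens A o K φ else 0) + ENNReal.ofReal (ε⁻¹ ^ 2) * ∫⁻ φ, twoPt A o y K φ) := by
          refine Finset.sum_le_sum fun K hK => ?_
          simp only [Finset.mem_filter, Finset.mem_univ, true_and] at hK
          rw [← lintegral_const_mul _ (measurable_twoPt A o y K), ← lintegral_add_left (hm K)]
          exact lintegral_mono fun φ => clDens_le hA hK.1 hε φ
      _ ≤ _ := by
          rw [Finset.sum_add_distrib, ← Finset.mul_sum]
          refine add_le_add ?_ (mul_le_mul_right (sum_twoPt_le_of_law hA hp hη hρ hρ1 hK hbad
            (fun F hF => hgood F hF y hy) (hC y hy)) _)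
          refine (Finset.sum_le_sum_of_subset (Finset.subset_univ _)).trans ?_
          rw [← lintegral_finsetSum _ fun K _ => hm K, smallVal, smallVal,
            ← lintegral_add_left (measurable_smallVal A o ε)]
          refine lintegral_mono fun φ => ?_
          by_cases h : (0 < φ o ∧ φ o ≤ ε) ∨ (0 < φ y ∧ φ y ≤ ε)
          · simp only [if_pos h]
            rw [sum_clDens hA]
            rcases h with h | h
            · rw [if_pos h, if_pos h.1]; exact le_self_add
            · rw [if_pos h]
              split_ifs <;> simp
          · simp [h]
  have h1 := sum_lintegral_clDens_le hA o hs
  calc ∑ K with ¬Disjoint K T, ∫⁻ φ, clDens A o K φ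
      ≤ ∑ K, ((if s ≤ capM A K then ∫⁻ φ, clDens A o K φ else 0) +
          ∑ y ∈ T, if y ∈ K ∧ capM A K < s then ∫⁻ φ, clDens A o K φ else 0) := by
        rw [Finset.sum_filter]
        refine Finset.sum_le_sum fun K _ => ?_
        by_cases hd : Disjoint K T
        · simp [hd]
        by_cases hc : s ≤ capM A K
        · rw [if_pos hd, if_pos hc]
          exact le_self_add
        · obtain ⟨y, hyK, hyT⟩ := Finset.not_disjoint_iff.1 hd
          rw [if_pos hd, if_neg hc, zero_add]
          refine le_trans ?_ (Finset.single_le_sum (f := fun y => if y ∈ K ∧ capM A K < s then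
            ∫⁻ φ, clDens A o K φ else 0) (fun _ _ => by positivity) hyT)
          rw [if_pos ⟨hyK, not_le.1 hc⟩]
    _ ≤ _ := by
        rw [Finset.sum_add_distrib, Finset.sum_comm, ← Finset.sum_filter]
        refine add_le_add h1 (Finset.sum_le_sum fun y hyT => ?_)
        rw [← Finset.sum_filter]
        exact hy y hyT

end GaussMat

namespace Model

open Matrix FinPerc GaussMat

variable (M : Model) {S : Finset M.V}

/-- An ordered representative of an edge. -/
def edgeRep (e : Sym2 S) : M.V × M.V := (e.out.1, e.out.2)

lemma edgeRep_cases (x y : S) :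
    M.edgeRep s(x, y) = ((x : M.V), (y : M.V)) ∨ M.edgeRep s(x, y) = ((y : M.V), (x : M.V)) := by
  have h : s((s(x, y) : Sym2 S).out.1, (s(x, y) : Sym2 S).out.2) = s(x, y) :=
    Quot.out_eq (s(x, y) : Sym2 S)
  rw [Sym2.eq_iff] at h
  unfold edgeRep
  rcases h with h | h
  · left; rw [h.1, h.2]
  · right; rw [h.1, h.2]

lemma edgeRep_inj {e f : Sym2 S} (h : M.edgeRep e = M.edgeRep f ∨
    M.edgeRep e = (M.edgeRep f).swap) : e = f := by
  induction e with | _ x y => ?_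
  induction f with | _ u v => ?_
  rw [Sym2.eq_iff]
  rcases M.edgeRep_cases x y with h1 | h1 <;> rcases M.edgeRep_cases u v with h2 | h2 <;>
  · rw [h1, h2] at h
    simp only [Prod.mk.injEq, Prod.swap_prod_mk, Subtype.coe_inj] at h
    tauto

/-- The open edges between distinct vertices of `S`. -/
def conf (S : Finset M.V) (ω : M.Ω) : Finset (Sym2 S) :=
  Finset.univ.filter fun e => ¬ e.IsDiag ∧ M.opn 0 ω (M.edgeRep e).1 (M.edgeRep e).2

/-- The conditional probability that an edge is closed. -/
def qω (S : Finset M.V) (ω : M.Ω) (e : Sym2 S) : ℝ :=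
  if e.IsDiag then 1 else Real.exp (-(2 * M.lam (M.edgeRep e).1 (M.edgeRep e).2 *
    max (M.φ ω (M.edgeRep e).1) 0 * max (M.φ ω (M.edgeRep e).2) 0))

lemma mem_conf {x y : S} (hxy : x ≠ y) (ω : M.Ω) : s(x, y) ∈ M.conf S ω ↔ M.opn 0 ω x y := by
  simp only [conf, Finset.mem_filter, Finset.mem_univ, true_and, Sym2.mk_isDiag_iff, hxy,
    not_false_eq_true]
  rcases M.edgeRep_cases x y with h | h <;> rw [h]
  exact ⟨M.opn_symm _ _ _ _, M.opn_symm _ _ _ _⟩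

lemma qω_mk {x y : S} (hxy : x ≠ y) (ω : M.Ω) : M.qω S ω s(x, y) =
    Real.exp (-(2 * M.lam x y * max (M.φ ω x) 0 * max (M.φ ω y) 0)) := by
  simp only [qω, Sym2.mk_isDiag_iff, hxy, if_false]
  rcases M.edgeRep_cases x y with h | h <;> rw [h]
  rw [M.lam_symm y x]
  congr 2; ring

lemma qω_nonneg (ω : M.Ω) (e : Sym2 S) : 0 ≤ M.qω S ω e := by
  unfold qω; split_ifs <;> positivity

lemma qω_le_one (ω : M.Ω) (e : Sym2 S) : M.qω S ω e ≤ 1 := by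
  unfold qω
  split_ifs
  · rfl
  · rw [Real.exp_le_one_iff, neg_nonpos]
    have := M.lam_nonneg (M.edgeRep e).1 (M.edgeRep e).2
    positivity

lemma measure_conf_eq (o : Finset (Sym2 S)) :
    M.P {ω | M.conf S ω = o} = ∫⁻ ω, ENNReal.ofReal (wt (M.qω S ω) o) ∂M.P := by
  by_cases hd : ∃ e ∈ o, e.IsDiag
  · obtain ⟨e, he, hed⟩ := hd
    have h1 : {ω | M.conf S ω = o} = ∅ := by
      ext ω
      simp only [Set.mem_ofPred_eq, Set.mem_empty_iff_false, iff_false]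
      rintro rfl
      simp [conf, hed] at he
    have h2 : ∀ ω, wt (M.qω S ω) o = 0 := fun ω =>
      Finset.prod_eq_zero (Finset.mem_univ e) (by simp [he, qω, hed])
    simp [h1, h2]
  push Not at hd
  set t : Finset (Sym2 S) := Finset.univ.filter fun e => ¬ e.IsDiag ∧ e ∉ o with ht
  have hdis : Disjoint o t := Finset.disjoint_left.2 fun e he het => by simp [ht, he] at het
  have hinj : Function.Injective (M.edgeRep (S := S)) := fun e f h => M.edgeRep_inj (Or.inl h)
  have hlaw := M.opn_law 0 (o.image M.edgeRep) (t.image M.edgeRep)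
    (by rwa [Finset.disjoint_image hinj]) (by
      intro e he f hf hef
      rw [← Finset.image_union, Finset.mem_image] at he hf
      obtain ⟨e, he, rfl⟩ := he
      obtain ⟨f, hf, rfl⟩ := hf
      exact fun h => hef (congrArg _ (M.edgeRep_inj (Or.inr h)))) Set.univ MeasurableSet.univ
  simp only [Set.mem_univ, Set.ofPred_true, Set.univ_inter, Measure.restrict_univ, sub_zero,
    Finset.prod_image fun a _ b _ h => hinj h, Finset.forall_mem_image] at hlaw
  have hset : {ω | M.conf S ω = o} = {ω | (∀ e ∈ o, M.opn 0 ω (M.edgeRep e).1 (M.edgeRep e).2) ∧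
      ∀ e ∈ t, ¬ M.opn 0 ω (M.edgeRep e).1 (M.edgeRep e).2} := by
    ext ω
    simp only [Set.mem_ofPred_eq, Finset.ext_iff, conf, Finset.mem_filter, Finset.mem_univ,
      true_and, ht]
    constructor
    · exact fun h => ⟨fun e he => ((h e).2 he).2, fun e he hop => he.2 ((h e).1 ⟨he.1, hop⟩)⟩
    · refine fun h e => ⟨fun he => by_contra fun heo => h.2 e ⟨he.1, heo⟩ he.2,
        fun he => ⟨hd e he, h.1 e he⟩⟩
  rw [hset, hlaw]
  refine lintegral_congr fun ω => ?_
  congr 1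
  unfold wt
  rw [← Finset.prod_filter_mul_prod_filter_not Finset.univ (fun e => e ∈ o)]
  congr 1
  · rw [Finset.filter_mem_eq_inter, Finset.univ_inter]
    exact Finset.prod_congr rfl fun e he => by simp [he, qω, hd e he]
  · conv_rhs => rw [← Finset.prod_filter_mul_prod_filter_not _ (fun e : Sym2 S => ¬ e.IsDiag),
      Finset.filter_filter, Finset.filter_filter]
    rw [show (Finset.univ.filter fun e : Sym2 S => e ∉ o ∧ ¬ e.IsDiag) = t by
      ext; simp [ht, and_comm]]
    rw [Finset.prod_eq_one (s := Finset.univ.filter fun e : Sym2 S => e ∉ o ∧ ¬ ¬ e.IsDiag), mul_one]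
    · refine Finset.prod_congr rfl fun e he => ?_
      simp only [ht, Finset.mem_filter, Finset.mem_univ, true_and] at he
      simp [he.2, qω, he.1]
    · intro e he
      simp only [not_not, Finset.mem_filter, Finset.mem_univ, true_and] at he
      simp [he.1, qω, he.2]

lemma map_restrict {A : Matrix S S ℝ} (hA : IsMMat A)
    (hG : ∀ x y : S, A⁻¹ x y = M.green x y) :
    ∃ c : ℝ≥0∞, c * ∫⁻ φ, dens A φ = 1 ∧ M.P.map (fun ω (x : S) => M.φ ω x) = c • meas A := by
  obtain ⟨c, _, _, hprob, hlaw⟩ := exists_law hA.posDef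
  have := M.Pprob
  have hm : Measurable fun ω (x : S) => M.φ ω x := measurable_pi_lambda _ fun x => M.φ_meas x
  refine ⟨c, ?_, ?_⟩
  · have h := hprob.measure_univ
    rw [Measure.smul_apply, meas, withDensity_apply _ MeasurableSet.univ, Measure.restrict_univ] at h
    exact h
  · have := Measure.isProbabilityMeasure_map (μ := M.P) hm.aemeasurable
    refine ext_of_map_dotProduct fun v => ?_
    rw [Measure.map_map (by unfold dotProduct; fun_prop) hm, hlaw v]
    have h := M.φ_gauss S (fun x => if h : x ∈ S then v ⟨x, h⟩ else 0)
    rw [← Finset.sum_coe_sort S] at h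
    have h1 : (fun φ => v ⬝ᵥ φ) ∘ (fun ω (x : S) => M.φ ω x) = fun ω => ∑ x ∈ S,
        (if h : x ∈ S then v ⟨x, h⟩ else 0) * M.φ ω x := by
      funext ω
      rw [← Finset.sum_coe_sort S]
      simp [dotProduct]
    rw [h1, h]
    congr 2
    refine Finset.sum_congr rfl fun x _ => ?_
    rw [← Finset.sum_coe_sort S, mulVec, dotProduct, Finset.mul_sum]
    refine Finset.sum_congr rfl fun y _ => ?_
    simp [hG]
    ring

theorem measure_reach_le {A : Matrix S S ℝ} (hA : IsMMat A)
    (hlam : ∀ x y : S, x ≠ y → M.lam x y ≤ -A x y) {c : ℝ≥0∞}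
    (hc : M.P.map (fun ω (x : S) => M.φ ω x) = c • meas A) (o : S) (T : Finset S) (hoT : o ∉ T) :
    M.P {ω | ∃ y ∈ T, Relation.ReflTransGen (fun u v : S => M.opn 0 ω u v) o y} ≤
      c * ∑ K with ¬Disjoint K T, ∫⁻ φ, clDens A o K φ := by
  set F : Finset (Sym2 S) → ℝ := fun O => if ¬ Disjoint (cl O o) T then 1 else 0 with hF
  have hFm : Monotone F := by
    intro O O' h
    simp only [hF]
    by_cases h1 : Disjoint (cl O o) T
    · rw [if_neg (not_not.2 h1)]
      split_ifs <;> norm_num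
    · obtain ⟨y, hy, hyT⟩ := Finset.not_disjoint_iff.1 h1
      have h2 : ¬ Disjoint (cl O' o) T := Finset.not_disjoint_iff.2 ⟨y, by
        simp only [cl, Finset.mem_filter, Finset.mem_univ, true_and] at hy ⊢
        exact reflTransGen_imp (fun _ _ h' => h h') hy, hyT⟩
      rw [if_pos h1, if_pos h2]
  have hsub : {ω | ∃ y ∈ T, Relation.ReflTransGen (fun u v : S => M.opn 0 ω u v) o y} ⊆
      ⋃ O ∈ Finset.univ.filter (fun O : Finset (Sym2 S) => ¬ Disjoint (cl O o) T),
        {ω | M.conf S ω = O} := by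
    rintro ω ⟨y, hyT, hy⟩
    simp only [Finset.mem_filter, Finset.mem_univ, true_and, Set.mem_iUnion, Set.mem_ofPred_eq,
      exists_prop, exists_eq_right']
    refine Finset.not_disjoint_iff.2 ⟨y, ?_, hyT⟩
    simp only [cl, Finset.mem_filter, Finset.mem_univ, true_and]
    clear hyT
    induction hy with
    | refl => exact .refl
    | @tail b d _ h2 ih =>
      by_cases hbd : b = d
      · rwa [← hbd]
      · exact ih.tail ((M.mem_conf hbd ω).2 h2)
  have hmeasφ : Measurable fun ω (x : S) => M.φ ω x :=
    measurable_pi_lambda _ fun x => M.φ_meas x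
  calc _ ≤ ∑ O with ¬ Disjoint (cl O o) T, M.P {ω | M.conf S ω = O} :=
        (measure_mono hsub).trans (measure_biUnion_finset_le _ _)
    _ = ∫⁻ ω, ENNReal.ofReal (mean (M.qω S ω) F) ∂M.P := by
        simp_rw [measure_conf_eq]
        have hqm : ∀ e : Sym2 S, Measurable fun ω => M.qω S ω e := fun e => by
          unfold qω
          have := M.φ_meas
          split_ifs <;> fun_prop
        rw [← lintegral_finsetSum _ fun O _ => ?_]
        · refine lintegral_congr fun ω => ?_
          rw [mean, ← ENNReal.ofReal_sum_of_nonneg fun O _ =>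
            wt_nonneg (M.qω_nonneg ω) (M.qω_le_one ω) O, Finset.sum_filter]
          congr 1
          exact Finset.sum_congr rfl fun O _ => by simp [hF]
        · unfold wt
          refine ENNReal.measurable_ofReal.comp (Finset.measurable_prod _ fun e _ => ?_)
          have := hqm e
          split_ifs <;> fun_prop
    _ ≤ ∫⁻ ω, (fun φ : S → ℝ => ∑ K with ¬Disjoint K T,
          if 0 < φ o then ENNReal.ofReal (clProb (qE A φ) o K) else 0)
          (fun x => M.φ ω x) ∂M.P := by
        refine lintegral_mono fun ω => ?_
        set φ : S → ℝ := fun x => M.φ ω x with hφ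
        have hq : ∀ e, qE A φ e ≤ M.qω S ω e := by
          intro e
          induction e with | _ x y => ?_
          by_cases hxy : x = y
          · subst hxy; simp [qE_mk, qω]
          rw [qE_mk, if_neg hxy, M.qω_mk hxy, Real.exp_le_exp]
          have h1 := hlam x y hxy
          have h2 := hlam y x (Ne.symm hxy)
          rw [M.lam_symm] at h2
          have h3 : 0 ≤ max (φ x) 0 * max (φ y) 0 := by positivity
          calc (A x y + A y x) * max (φ x) 0 * max (φ y) 0
              = (A x y + A y x) * (max (φ x) 0 * max (φ y) 0) := by ring
            _ ≤ (-(2 * M.lam x y)) * (max (φ x) 0 * max (φ y) 0) := by gcongr; linarith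
            _ = _ := by simp only [hφ]; ring
        refine (ENNReal.ofReal_le_ofReal
          (mean_antitone (qE_nonneg A φ) hq (M.qω_le_one ω) hFm)).trans ?_
        have hsum : mean (qE A φ) F = ∑ K with ¬ Disjoint K T, clProb (qE A φ) o K := by
          simp only [clProb, mean]
          rw [Finset.sum_comm]
          refine Finset.sum_congr rfl fun O _ => ?_
          rw [← Finset.mul_sum]
          congr 1
          rw [Finset.sum_ite_eq]
          simp [hF]
        rw [hsum, ENNReal.ofReal_sum_of_nonneg fun K _ =>
          clProb_nonneg (qE_nonneg A φ) (qE_le_one hA φ) o K]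
        refine Finset.sum_le_sum fun K hK => ?_
        split_ifs with ho
        · rfl
        · obtain ⟨y, hyK, hyT⟩ := Finset.not_disjoint_iff.1 (Finset.mem_filter.1 hK).2
          rw [nonpos_iff_eq_zero, ENNReal.ofReal_eq_zero]
          refine le_of_eq ?_
          by_cases hoK : o ∈ K
          · rw [clProb_eq, innerProb_eq_zero hoK hyK (fun h => hoT (h ▸ hyT)), mul_zero]
            intro x
            rw [qE_mk, max_eq_right (not_lt.1 ho)]
            simp
          · exact clProb_eq_zero' hoK
    _ = _ := by
        have hm : ∀ K : Finset S, Measurable fun φ : S → ℝ =>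
            if 0 < φ o then ENNReal.ofReal (clProb (qE A φ) o K) else 0 := fun K =>
          Measurable.ite (measurableSet_pos o) (by fun_prop) measurable_const
        rw [← lintegral_map (f := fun φ : S → ℝ => ∑ K with ¬Disjoint K T,
          if 0 < φ o then ENNReal.ofReal (clProb (qE A φ) o K) else 0)
          (Finset.measurable_sum _ fun K _ => hm K) hmeasφ, hc, lintegral_smul_measure,
          lintegral_finsetSum _ fun K _ => hm K, smul_eq_mul]
        congr 1
        refine Finset.sum_congr rfl fun K _ => ?_
        rw [meas, lintegral_withDensity_eq_lintegral_mul _ (measurable_dens A) (hm K)]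
        refine lintegral_congr fun φ => ?_
        rw [Pi.mul_apply, clDens, mul_ite, mul_zero, mul_comm]

end Model

namespace GaussMat
open Matrix

section Embed

variable {ι κ : Type*} [Fintype ι] [DecidableEq ι] [Fintype κ] [DecidableEq κ]

lemma capM_map {A : Matrix ι ι ℝ} {B : Matrix κ κ ℝ} (hA : IsMMat A) (hB : IsMMat B) (f : ι ↪ κ)
    (h : ∀ i j, B⁻¹ (f i) (f j) = A⁻¹ i j) (K : Finset ι) :
    capM B (K.map f) = capM A K := by
  set m : ι → ℝ := A *ᵥ eqPot A K
  set n : κ → ℝ := B *ᵥ eqPot B (K.map f)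
  have h1 : ∀ z ∈ K, ∑ x ∈ K, A⁻¹ z x * m x = 1 := fun z hz => by
    rw [← eqPot_eq_sum hA.posDef K z, eqPot_on hA.posDef hz]
  have h2 : ∀ z ∈ K, ∑ x ∈ K, A⁻¹ z x * n (f x) = 1 := fun z hz => by
    have := eqPot_eq_sum hB.posDef (K.map f) (f z)
    rw [eqPot_on hB.posDef (Finset.mem_map_of_mem f hz), Finset.sum_map] at this
    simpa only [h] using this.symm
  calc capM B (K.map f) = ∑ x ∈ K, n (f x) := by rw [capM, Finset.sum_map]
    _ = ∑ x ∈ K, n (f x) * ∑ y ∈ K, A⁻¹ x y * m y :=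
        Finset.sum_congr rfl fun x hx => by rw [h1 x hx, mul_one]
    _ = ∑ y ∈ K, m y * ∑ x ∈ K, A⁻¹ y x * n (f x) := by
        simp_rw [Finset.mul_sum]
        rw [Finset.sum_comm]
        refine Finset.sum_congr rfl fun y _ => Finset.sum_congr rfl fun x _ => ?_
        rw [inv_symm hA.posDef x y]
        ring
    _ = capM A K := Finset.sum_congr rfl fun x hx => by rw [h2 x hx, mul_one]

lemma eqPot_le_mul_capM {A : Matrix ι ι ℝ} (hA : IsMMat A) (K : Finset ι) (z : ι) {b : ℝ}
    (hb : ∀ x ∈ K, A⁻¹ z x ≤ b) : eqPot A K z ≤ b * capM A K := by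
  rw [eqPot_eq_sum hA.posDef, capM, Finset.mul_sum]
  exact Finset.sum_le_sum fun x hx => mul_le_mul_of_nonneg_right (hb x hx)
    (eqMeas_nonneg hA K x)

lemma exists_push_law {ρ : Finset κ → ℝ} (h0 : ∀ F, 0 ≤ ρ F) (f : ι ↪ κ) :
    ∃ ρ' : Finset ι → ℝ, (∀ F, 0 ≤ ρ' F) ∧ ∀ Φ : Finset ι → ℝ,
      ∑ F, ρ' F * Φ F = ∑ F, ρ F * Φ (F.preimage f f.injective.injOn) := by
  refine ⟨fun F => ∑ F' with F'.preimage f f.injective.injOn = F, ρ F',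
    fun F => Finset.sum_nonneg fun _ _ => h0 _, fun Φ => ?_⟩
  rw [← Finset.sum_fiberwise Finset.univ (fun F' : Finset κ => F'.preimage f f.injective.injOn)]
  refine Finset.sum_congr rfl fun F _ => ?_
  rw [Finset.sum_mul]
  exact Finset.sum_congr rfl fun F' hF' => by rw [(Finset.mem_filter.1 hF').2]

lemma disjoint_preimage_iff (f : ι ↪ κ) (F : Finset κ) (K : Finset ι) :
    Disjoint (F.preimage f f.injective.injOn) K ↔ Disjoint F (K.map f) := by
  simp only [Finset.disjoint_left, Finset.mem_preimage, Finset.mem_map]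
  constructor
  · rintro h _ hx ⟨i, hi, rfl⟩
    exact h hx hi
  · exact fun h x hx hK => h hx ⟨x, hK, rfl⟩

lemma map_preimage_inter (f : ι ↪ κ) (F : Finset κ) (K : Finset ι) :
    (F.preimage f f.injective.injOn ∩ K).map f = F ∩ K.map f := by
  ext x
  simp only [Finset.mem_map, Finset.mem_inter, Finset.mem_preimage]
  constructor
  · rintro ⟨i, ⟨h1, h2⟩, rfl⟩
    exact ⟨h1, i, h2, rfl⟩
  · rintro ⟨h1, i, h2, rfl⟩
    exact ⟨i, ⟨h1, h2⟩, rfl⟩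

end Embed
end GaussMat

namespace Model
open GaussMat
variable (M : Model) {S : Finset M.V}

lemma gaussianReal_Ioc_le {g : ℝ} (hg : 0 < g) {t : ℝ} :
    gaussianReal 0 g.toNNReal (Set.Ioc 0 t) ≤ ENNReal.ofReal (t / √g) := by
  have hg' : g.toNNReal ≠ 0 := by simpa using hg
  rw [gaussianReal_apply _ hg']
  calc _ ≤ ∫⁻ _ in Set.Ioc 0 t, ENNReal.ofReal (√g)⁻¹ := by
        refine lintegral_mono fun x => ?_
        rw [gaussianPDF]
        refine ENNReal.ofReal_le_ofReal ?_
        rw [gaussianPDFReal, Real.coe_toNNReal _ hg.le]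
        have h1 : rexp (-(x - 0) ^ 2 / (2 * g)) ≤ 1 := Real.exp_le_one_iff.2
          (div_nonpos_of_nonpos_of_nonneg (by nlinarith [sq_nonneg (x-0)]) (by positivity))
        calc _ ≤ (√(2 * π * g))⁻¹ * 1 := by gcongr
          _ ≤ (√g)⁻¹ := by
            rw [mul_one]
            refine inv_anti₀ (Real.sqrt_pos.2 hg) (Real.sqrt_le_sqrt ?_)
            nlinarith [Real.pi_gt_three]
    _ = _ := by
        rw [setLIntegral_const, Real.volume_Ioc, sub_zero, ← ENNReal.ofReal_mul (by positivity)]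
        congr 1
        ring

lemma smallVal_le {A : Matrix S S ℝ} {c : ℝ≥0∞}
    (hc : M.P.map (fun ω (x : S) => M.φ ω x) = c • meas A) (v : S) (hv : 0 < M.green v v) (t : ℝ) :
    c * smallVal A v t ≤ ENNReal.ofReal (t / √(M.green v v)) := by
  have hmeasφ : Measurable fun ω (x : S) => M.φ ω x :=
    measurable_pi_lambda _ fun x => M.φ_meas x
  have hs : MeasurableSet {φ : S → ℝ | 0 < φ v ∧ φ v ≤ t} :=
    (measurableSet_lt measurable_const (measurable_pi_apply v)).inter
      (measurableSet_le (measurable_pi_apply v) measurable_const)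
  have h1 : c * smallVal A v t = M.P {ω | 0 < M.φ ω v ∧ M.φ ω v ≤ t} := by
    have := congrArg (fun μ => μ {φ : S → ℝ | 0 < φ v ∧ φ v ≤ t}) hc
    simp only [Measure.smul_apply, smul_eq_mul, meas] at this
    rw [Measure.map_apply hmeasφ hs, withDensity_apply _ hs, ← lintegral_indicator hs] at this
    have h0 : (fun φ : S → ℝ => if 0 < φ v ∧ φ v ≤ t then dens A φ else 0) =
        {φ : S → ℝ | 0 < φ v ∧ φ v ≤ t}.indicator (dens A) := by
      funext φ
      simp [Set.indicator_apply]
    rw [smallVal, h0]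
    exact this.symm
  have h2 := M.φ_gauss {(v : M.V)} (fun _ => 1)
  simp only [Finset.sum_singleton, one_mul] at h2
  have h3 : M.P {ω | 0 < M.φ ω v ∧ M.φ ω v ≤ t} = gaussianReal 0 (M.green v v).toNNReal (Set.Ioc 0 t) := by
    rw [← h2, Measure.map_apply (M.φ_meas v) measurableSet_Ioc]
    rfl
  rw [h1, h3]
  exact gaussianReal_Ioc_le hv

end Model

namespace WGraph
variable (M : WGraph)

/-- The neighbours of a vertex. -/
def nbr (x : M.V) : Finset M.V := (M.locFin x).toFinset

lemma mem_nbr {x y : M.V} : y ∈ M.nbr x ↔ 0 < M.lam x y := by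
  simp only [nbr, Set.Finite.mem_toFinset, Function.mem_support]
  exact ⟨fun h => (M.lam_nonneg x y).lt_of_ne' h, fun h => h.ne'⟩

lemma lam_eq_zero {x y : M.V} (h : y ∉ M.nbr x) : M.lam x y = 0 := by
  by_contra h'
  exact h (M.mem_nbr.2 ((M.lam_nonneg x y).lt_of_ne' h'))

lemma lamTot_eq (x : M.V) : M.lamTot x = ∑ y ∈ M.nbr x, M.lam x y :=
  finsum_eq_sum _ _

lemma lamTot_nonneg (x : M.V) : 0 ≤ M.lamTot x := by
  rw [lamTot_eq]; exact Finset.sum_nonneg fun _ _ => M.lam_nonneg _ _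

lemma pstep_succ (n : ℕ) (x y : M.V) :
    M.pstep (n + 1) x y = ∑ z ∈ M.nbr x, M.p x z * M.pstep n z y := by
  rw [pstep]
  refine finsum_eq_sum_of_support_subset _ fun z hz => ?_
  by_contra h
  exact hz (by simp [p, M.lam_eq_zero h])

lemma pstep_one (x y : M.V) : M.pstep 1 x y = M.p x y := by
  rw [pstep_succ]
  by_cases h : y ∈ M.nbr x
  · rw [Finset.sum_eq_single_of_mem y h fun z _ hz => by simp [pstep, hz]]
    simp [pstep]
  · rw [Finset.sum_eq_zero fun z hz => ?_, p, M.lam_eq_zero h, zero_div]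
    have : z ≠ y := fun e => h (e ▸ hz)
    simp [pstep, this]

lemma pstep_succ' (n : ℕ) (x y : M.V) :
    M.pstep (n + 1) x y = ∑ z ∈ M.nbr y, M.pstep n x z * M.p z y := by
  induction n generalizing x with
  | zero =>
    rw [pstep_one]
    by_cases h : x ∈ M.nbr y
    · rw [Finset.sum_eq_single_of_mem x h fun z _ hz => by simp [pstep, hz.symm]]
      simp [pstep]
    · rw [Finset.sum_eq_zero fun z hz => ?_, p, M.lam_symm, M.lam_eq_zero h, zero_div]
      have : x ≠ z := fun e => h (e ▸ hz)
      simp [pstep, this]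
  | succ n ih =>
    rw [pstep_succ]
    simp_rw [ih, M.pstep_succ n x, Finset.mul_sum, Finset.sum_mul]
    rw [Finset.sum_comm]
    exact Finset.sum_congr rfl fun _ _ => Finset.sum_congr rfl fun _ _ => by ring

/-- The Laplacian. -/
def lap (h : M.V → ℝ) (x : M.V) : ℝ := M.lamTot x * h x - ∑ z ∈ M.nbr x, M.lam x z * h z

lemma lap_neg (h : M.V → ℝ) (x : M.V) : M.lap (fun v => -h v) x = -M.lap h x := by
  simp only [lap, mul_neg, Finset.sum_neg_distrib]; ring

lemma lap_one_sub (h : M.V → ℝ) (x : M.V) : M.lap (fun v => 1 - h v) x = -M.lap h x := by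
  simp only [lap, mul_sub, mul_one, Finset.sum_sub_distrib, ← lamTot_eq]; ring

lemma lap_sum {ι : Type*} (s : Finset ι) (a : ι → ℝ) (h : ι → M.V → ℝ) (x : M.V) :
    M.lap (fun v => ∑ i ∈ s, a i * h i v) x = ∑ i ∈ s, a i * M.lap (h i) x := by
  simp only [lap, mul_sub, Finset.sum_sub_distrib, Finset.mul_sum]
  rw [Finset.sum_comm]
  congr 1
  · exact Finset.sum_congr rfl fun _ _ => by ring
  · exact Finset.sum_congr rfl fun _ _ => Finset.sum_congr rfl fun _ _ => by ring

lemma nonneg_of_lap [Infinite M.V] {h : M.V → ℝ} {l : ℝ} (hl : 0 ≤ l)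
    (ht : Tendsto h cofinite (𝓝 l)) (hL : ∀ x, h x < 0 → 0 ≤ M.lap h x) (x : M.V) : 0 ≤ h x := by
  by_contra! hx
  have hfin : {y | h y ≤ h x}.Finite := by
    have := ht.eventually (lt_mem_nhds (hx.trans_le hl))
    rw [eventually_cofinite] at this
    simpa using this
  obtain ⟨x₁, hx₁, hmin⟩ := Set.exists_min_image _ h hfin ⟨x, show h x ≤ h x from le_rfl⟩
  have hx₁' : h x₁ ≤ h x := hx₁
  have hall : ∀ y, h x₁ ≤ h y := fun y => by
    by_cases hy : h y ≤ h x
    · exact hmin y hy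
    · exact hx₁'.trans (not_le.1 hy).le
  have hconst : ∀ y, h y = h x₁ := fun y => by
    have hy := M.connectedG x₁ y
    induction hy with
    | refl => rfl
    | @tail u v _ huv ih =>
      have h1 := hL u (by linarith)
      rw [lap, M.lamTot_eq, Finset.sum_mul, ← Finset.sum_sub_distrib] at h1
      have h2 : ∀ z ∈ M.nbr u, M.lam u z * h u - M.lam u z * h z ≤ 0 := fun z _ => by
        rw [ih]
        nlinarith [M.lam_nonneg u z, hall z]
      have h3 := (Finset.sum_eq_zero_iff_of_nonpos h2).1 (le_antisymm (Finset.sum_nonpos h2) h1) v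
        (M.mem_nbr.2 huv)
      rw [← mul_sub, mul_eq_zero] at h3
      rcases h3 with h3 | h3 <;> linarith
  refine Set.infinite_univ (α := M.V) (hfin.subset fun y _ => ?_)
  show h y ≤ h x
  rw [hconst y]; exact hx₁'

section Standing
variable {M}

lemma green_pos (hS : M.Standing) (x y : M.V) : 0 < M.green x y := by
  obtain ⟨c, hc, C, hC, h1, h2⟩ := hS.2.2
  by_cases h : x = y
  · subst h; exact hc.trans_le (h1 x).1
  · exact (mul_pos hc (Real.rpow_pos_of_pos (M.d_pos x y h) _)).trans_le (h2 x y h).1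

lemma lamTot_pos (hS : M.Standing) (x : M.V) : 0 < M.lamTot x := by
  refine (M.lamTot_nonneg x).lt_of_ne' fun h => ?_
  have := green_pos hS x x
  rw [green, h, div_zero] at this
  exact lt_irrefl _ this

lemma summable_pstep (hS : M.Standing) (x y : M.V) : Summable fun n => M.pstep n x y := by
  by_contra h
  have := green_pos hS x y
  rw [green, tsum_eq_zero_of_not_summable h, zero_div] at this
  exact lt_irrefl _ this

lemma pstep_symm (hS : M.Standing) (n : ℕ) (x y : M.V) :
    M.lamTot x * M.pstep n x y = M.lamTot y * M.pstep n y x := by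
  induction n generalizing x with
  | zero =>
    simp only [pstep]
    by_cases h : x = y
    · subst h; rfl
    · rw [if_neg h, if_neg (Ne.symm h)]; simp
  | succ n ih =>
    rw [pstep_succ, pstep_succ', Finset.mul_sum, Finset.mul_sum]
    refine Finset.sum_congr rfl fun z _ => ?_
    have h1 := (lamTot_pos hS x).ne'
    have h2 := (lamTot_pos hS z).ne'
    have h3 := ih z
    rw [p, p, M.lam_symm z x]
    field_simp
    linear_combination M.lam x z * h3

lemma green_symm (hS : M.Standing) (x y : M.V) : M.green x y = M.green y x := by
  rw [green, green, div_eq_div_iff (lamTot_pos hS y).ne' (lamTot_pos hS x).ne', mul_comm,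
    mul_comm _ (M.lamTot y), ← tsum_mul_left, ← tsum_mul_left]
  exact tsum_congr fun n => pstep_symm hS n x y

lemma lap_green (hS : M.Standing) (x v : M.V) :
    M.lap (fun z => M.green z v) x = if x = v then 1 else 0 := by
  have h1 := (summable_pstep hS x v).tsum_eq_zero_add
  have hx := (lamTot_pos hS x).ne'
  have hv := (lamTot_pos hS v).ne'
  have h2 : ∑' n, M.pstep (n + 1) x v = ∑ z ∈ M.nbr x, M.p x z * ∑' n, M.pstep n z v := by
    simp_rw [M.pstep_succ, ← tsum_mul_left]
    exact Summable.tsum_finsetSum fun z _ => (summable_pstep hS z v).mul_left _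
  rw [h2] at h1
  simp only [lap, green]
  rw [h1, pstep]
  have h3 : ∑ z ∈ M.nbr x, M.lam x z * ((∑' n, M.pstep n z v) / M.lamTot v) =
      M.lamTot x * ((∑ z ∈ M.nbr x, M.p x z * ∑' n, M.pstep n z v) / M.lamTot v) := by
    rw [Finset.sum_div, Finset.mul_sum]
    refine Finset.sum_congr rfl fun z _ => ?_
    rw [p]
    field_simp
  rw [h3, ← mul_sub, ← sub_div, add_sub_cancel_right]
  split_ifs with h
  · subst h; field_simp
  · simp

lemma one_le_lamTot_mul_green (hS : M.Standing) (x : M.V) : 1 ≤ M.lamTot x * M.green x x := by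
  have h := lap_green hS x x
  rw [if_pos rfl, lap] at h
  have : 0 ≤ ∑ z ∈ M.nbr x, M.lam x z * M.green z x :=
    Finset.sum_nonneg fun z _ => mul_nonneg (M.lam_nonneg _ _) (green_pos hS _ _).le
  linarith

lemma finite_ball (hS : M.Standing) (x : M.V) (r : ℝ) : (M.ball x r).Finite := by
  obtain ⟨c, hc, C, hC, h⟩ := hS.2.1
  have h1 := (h x (max r 1) (le_max_right _ _)).1
  have h2 : 0 < ∑ᶠ y ∈ M.ball x (max r 1), M.lamTot y := lt_of_lt_of_le (by positivity) h1
  have h3 : (Function.support fun y => ∑ᶠ (_ : y ∈ M.ball x (max r 1)), M.lamTot y).Finite := by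
    by_contra h4
    rw [finsum_of_infinite_support h4] at h2
    exact lt_irrefl _ h2
  refine h3.subset fun y hy => ?_
  have hy' : y ∈ M.ball x (max r 1) := by
    have : M.d x y ≤ r := hy
    exact show M.d x y ≤ _ from this.trans (le_max_left _ _)
  rw [Function.mem_support, finsum_eq_if, if_pos hy']
  exact (lamTot_pos hS y).ne'

lemma finsum_ball_eq {x : M.V} {r : ℝ} (h : (M.ball x r).Finite) :
    (∑ᶠ y ∈ M.ball x r, M.lamTot y) = ∑ y ∈ h.toFinset, M.lamTot y :=
  finsum_mem_eq_finite_toFinset_sum _ h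

lemma tendsto_green (hS : M.Standing) (hν : 0 < M.ν) (v : M.V) :
    Tendsto (fun x => M.green x v) cofinite (𝓝 0) := by
  obtain ⟨c, hc, C, hC, h1, h2⟩ := hS.2.2
  rw [Metric.tendsto_nhds]
  intro ε hε
  rw [eventually_cofinite]
  refine ((finite_ball hS v ((C / ε) ^ (M.ν)⁻¹)).union (Set.finite_singleton v)).subset fun x hx => ?_
  by_cases hxv : x = v
  · exact Or.inr hxv
  left
  have hx' : ε ≤ M.green x v := by
    have : ¬ dist (M.green x v) 0 < ε := hx
    rw [Real.dist_eq, sub_zero, abs_of_pos (green_pos hS x v), not_lt] at this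
    exact this
  have h3 := hx'.trans (h2 x v hxv).2
  have hd := M.d_pos x v hxv
  show M.d v x ≤ _
  rw [M.d_symm, ← Real.rpow_le_rpow_iff hd.le (by positivity) hν, ← Real.rpow_mul (by positivity),
    inv_mul_cancel₀ hν.ne', Real.rpow_one, le_div_iff₀ hε]
  rw [Real.rpow_neg hd.le] at h3
  have := Real.rpow_pos_of_pos hd M.ν
  calc M.d x v ^ M.ν * ε ≤ M.d x v ^ M.ν * (C * (M.d x v ^ M.ν)⁻¹) := by gcongr
    _ = C := by field_simp

lemma infinite_V (hS : M.Standing) (hα : 0 < M.α) : Infinite M.V := by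
  by_contra hfin
  have hfin := not_infinite_iff_finite.1 hfin
  obtain ⟨c, hc, C, hC, h⟩ := hS.2.1
  have := Fintype.ofFinite M.V
  have h1 : ∀ r : ℝ, 1 ≤ r → c * r ^ M.α ≤ ∑ y, M.lamTot y := fun r hr => by
    refine (h M.o r hr).1.trans ?_
    rw [finsum_ball_eq (finite_ball hS _ _)]
    exact Finset.sum_le_univ_sum_of_nonneg fun y => M.lamTot_nonneg y
  have h2 := ((tendsto_rpow_atTop hα).const_mul_atTop hc).eventually_gt_atTop (∑ y, M.lamTot y)
  obtain ⟨r, hr, hr1⟩ := (h2.and (eventually_ge_atTop 1)).exists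
  exact absurd (h1 r hr1) (not_le.2 hr)

end Standing
end WGraph

namespace GaussMat
open Matrix
variable {ι : Type*} [Fintype ι] [DecidableEq ι]

lemma IsMMat.of_isUnit {A : Matrix ι ι ℝ} (hu : IsUnit A) (hs : ∀ i j, A i j = A j i)
    (ho : ∀ i j, i ≠ j → A i j ≤ 0) (hr : ∀ i, 0 ≤ (A *ᵥ 1) i) : IsMMat A := by
  refine ⟨?_, ho, hr⟩
  have hpsd : A.PosSemidef := by
    refine .of_dotProduct_mulVec_nonneg (Matrix.IsHermitian.ext fun i j => by simp [hs i j])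
      fun u => ?_
    rw [star_trivial]
    have h1 : ∀ i, (A *ᵥ 1) i = ∑ j, A i j := fun i => by simp [mulVec, dotProduct]
    have h2 : u ⬝ᵥ A *ᵥ u = ∑ i, ∑ j, A i j * (u i * u j) := by
      simp only [dotProduct, mulVec, Finset.mul_sum]
      exact Finset.sum_congr rfl fun _ _ => Finset.sum_congr rfl fun _ _ => by ring
    have h3 : ∑ i, ∑ j, A i j * u j ^ 2 = ∑ i, ∑ j, A i j * u i ^ 2 := by
      rw [Finset.sum_comm]
      exact Finset.sum_congr rfl fun i _ => Finset.sum_congr rfl fun j _ => by rw [hs]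
    have h4 : 0 ≤ ∑ i, ∑ j, A i j * u i ^ 2 := Finset.sum_nonneg fun i _ => by
      rw [← Finset.sum_mul, ← h1]
      exact mul_nonneg (hr i) (sq_nonneg _)
    have h5 : 0 ≤ ∑ i, ∑ j, -A i j * (u i - u j) ^ 2 :=
      Finset.sum_nonneg fun i _ => Finset.sum_nonneg fun j _ => by
        by_cases h : i = j
        · simp [h]
        · exact mul_nonneg (by linarith [ho i j h]) (sq_nonneg _)
    have h6 : ∑ i, ∑ j, -A i j * (u i - u j) ^ 2 =
        2 * ∑ i, ∑ j, A i j * (u i * u j) - ∑ i, ∑ j, A i j * u i ^ 2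
          - ∑ i, ∑ j, A i j * u j ^ 2 := by
      rw [Finset.mul_sum, ← Finset.sum_sub_distrib, ← Finset.sum_sub_distrib]
      refine Finset.sum_congr rfl fun i _ => ?_
      rw [Finset.mul_sum, ← Finset.sum_sub_distrib, ← Finset.sum_sub_distrib]
      exact Finset.sum_congr rfl fun j _ => by ring
    rw [h2]
    linarith
  exact hpsd.posDef_iff_isUnit.2 hu

end GaussMat

namespace WGraph
open Matrix GaussMat
variable (M : WGraph) (S : Finset M.V)

/-- The Green's function restricted to a finite set. -/
def greenMat : Matrix S S ℝ := fun x y => M.green x y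

/-- The potential of a charge on a finite set. -/
def pot {S : Finset M.V} (a : S → ℝ) (x : M.V) : ℝ := ∑ i : S, a i * M.green x i

variable {M S}

lemma lap_pot (hS : M.Standing) (a : S → ℝ) (x : M.V) :
    M.lap (M.pot a) x = if h : x ∈ S then a ⟨x, h⟩ else 0 := by
  show M.lap (fun v => ∑ i : S, a i * M.green v i) x = _
  rw [M.lap_sum Finset.univ a (fun (i : S) v => M.green v i)]
  simp_rw [lap_green hS]
  split_ifs with h
  · rw [Finset.sum_eq_single_of_mem ⟨x, h⟩ (Finset.mem_univ _)]
    · simp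
    · intro b _ hb
      rw [if_neg (fun e => hb (Subtype.ext e.symm)), mul_zero]
  · refine Finset.sum_eq_zero fun i _ => ?_
    rw [if_neg (fun e => h (by rw [e]; exact i.2)), mul_zero]

lemma tendsto_pot (hS : M.Standing) (hν : 0 < M.ν) (a : S → ℝ) :
    Tendsto (M.pot a) cofinite (𝓝 0) := by
  have := tendsto_finsetSum (Finset.univ : Finset S)
    fun i _ => (tendsto_green hS hν (i : M.V)).const_mul (a i)
  simp only [mul_zero, Finset.sum_const_zero] at this
  exact this

lemma pot_mem (a : S → ℝ) (x : S) : M.pot a x = (M.greenMat S *ᵥ a) x := by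
  rw [pot, mulVec, dotProduct]
  exact Finset.sum_congr rfl fun i _ => mul_comm _ _

lemma isUnit_greenMat (hS : M.Standing) (hν : 0 < M.ν) (hα : 0 < M.α) : IsUnit (M.greenMat S) := by
  have := infinite_V hS hα
  rw [← mulVec_injective_iff_isUnit]
  refine (injective_iff_map_eq_zero (M.greenMat S).mulVecLin).2 fun a ha => ?_
  have hon : ∀ x ∈ S, M.pot a x = 0 := fun x hx => by
    rw [M.pot_mem a ⟨x, hx⟩]; exact congrFun ha _
  have h1 : ∀ x, 0 ≤ M.pot a x := M.nonneg_of_lap le_rfl (tendsto_pot hS hν a) fun x hx => by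
    rw [lap_pot hS, dif_neg fun h => by rw [hon x h] at hx; exact lt_irrefl _ hx]
  have h2 : ∀ x, 0 ≤ -M.pot a x := M.nonneg_of_lap le_rfl
    (by simpa using (tendsto_pot hS hν a).neg) fun x hx => by
      rw [lap_neg, lap_pot hS, dif_neg fun h => by rw [hon x h] at hx; simp at hx, neg_zero]
  have h3 : M.pot a = fun _ => 0 := funext fun x => le_antisymm (by linarith [h2 x]) (h1 x)
  funext x
  have h4 := lap_pot hS a x
  rw [dif_pos x.2, h3] at h4
  simpa [lap] using h4.symm

/-- The harmonic extension of a function on a finite set. -/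
lemma exists_harmonic_ext (hS : M.Standing) (hν : 0 < M.ν) (hα : 0 < M.α) (u : S → ℝ) :
    ∃ h : M.V → ℝ, Tendsto h cofinite (𝓝 0) ∧
    (∀ x : S, h x = u x) ∧ (∀ x ∉ S, M.lap h x = 0) ∧
    ∀ x : S, M.lap h x = ((M.greenMat S)⁻¹ *ᵥ u) x := by
  have hu := (isUnit_iff_isUnit_det _).1 (isUnit_greenMat (S := S) hS hν hα)
  refine ⟨M.pot ((M.greenMat S)⁻¹ *ᵥ u), tendsto_pot hS hν _, fun x => ?_, fun x hx => ?_,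
    fun x => ?_⟩
  · rw [pot_mem, mulVec_mulVec, mul_nonsing_inv _ hu, one_mulVec]
  · rw [lap_pot hS, dif_neg hx]
  · rw [lap_pot hS, dif_pos x.2]

lemma inv_inv_greenMat (hS : M.Standing) (hν : 0 < M.ν) (hα : 0 < M.α) :
    ((M.greenMat S)⁻¹)⁻¹ = M.greenMat S :=
  nonsing_inv_nonsing_inv _ ((isUnit_iff_isUnit_det _).1 (isUnit_greenMat hS hν hα))

lemma lam_le_neg_inv (hS : M.Standing) (hν : 0 < M.ν) (hα : 0 < M.α) (x y : S) (hxy : x ≠ y) :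
    M.lam x y ≤ -((M.greenMat S)⁻¹ x y) := by
  have := infinite_V hS hα
  obtain ⟨h, h1, h2, h3, h4⟩ := exists_harmonic_ext (S := S) hS hν hα (Pi.single y 1)
  have h5 : ∀ x : S, 0 ≤ h x := fun x => by
    rw [h2, Pi.single_apply]; split_ifs <;> norm_num
  have h6 : ∀ x, 0 ≤ h x := M.nonneg_of_lap le_rfl h1 fun x hx => by
    rw [h3 x fun hxS => not_lt.2 (h5 ⟨x, hxS⟩) hx]
  have h7 := h4 x
  rw [mulVec_single_one, col_apply, lap, h2 x, Pi.single_eq_of_ne hxy, mul_zero, zero_sub] at h7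
  rw [← h7, neg_neg]
  by_cases hn : (y : M.V) ∈ M.nbr x
  · calc M.lam x y = M.lam x y * h y := by rw [h2, Pi.single_eq_same, mul_one]
      _ ≤ _ := Finset.single_le_sum (f := fun z => M.lam x z * h z)
        (fun z _ => mul_nonneg (M.lam_nonneg _ _) (h6 z)) hn
  · rw [M.lam_eq_zero hn]
    exact Finset.sum_nonneg fun z _ => mul_nonneg (M.lam_nonneg _ _) (h6 z)

lemma isMMat_inv (hS : M.Standing) (hν : 0 < M.ν) (hα : 0 < M.α) : IsMMat ((M.greenMat S)⁻¹) := by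
  have := infinite_V hS hα
  refine .of_isUnit (isUnit_nonsing_inv_iff.2 (isUnit_greenMat hS hν hα)) (fun i j => ?_)
    (fun i j hij => ?_) fun i => ?_
  · have hT : (M.greenMat S)ᵀ = M.greenMat S := by
      ext i j; exact green_symm hS _ _
    conv_lhs => rw [← hT, ← transpose_nonsing_inv]
    rfl
  · have := lam_le_neg_inv hS hν hα i j hij
    linarith [M.lam_nonneg i j]
  · obtain ⟨h, h1, h2, h3, h4⟩ := exists_harmonic_ext (S := S) hS hν hα 1
    have h6 : ∀ x, 0 ≤ 1 - h x := M.nonneg_of_lap (l := 1 - 0) (by norm_num)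
      (h1.const_sub 1) fun x hx => by
        rw [lap_one_sub, h3 x fun hxS => by simp [h2 ⟨x, hxS⟩] at hx, neg_zero]
    rw [← h4 i, lap, h2 i, Pi.one_apply, mul_one, lamTot_eq, ← Finset.sum_sub_distrib]
    exact Finset.sum_nonneg fun z _ => by nlinarith [h6 z, M.lam_nonneg i z]

/-- At an interior vertex the restricted operator is the Laplacian. -/
lemma inv_mulVec_of_nbr (hS : M.Standing) (hν : 0 < M.ν) (hα : 0 < M.α) {x : S} (hx : M.nbr x ⊆ S)
    (h : M.V → ℝ) :
    
    ((M.greenMat S)⁻¹ *ᵥ fun y : S => h y) x = M.lap h x := by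
  obtain ⟨h', h1, h2, h3, h4⟩ := exists_harmonic_ext (S := S) hS hν hα fun y : S => h y
  rw [← h4 x, lap, lap, h2 x]
  congr 1
  exact Finset.sum_congr rfl fun z hz => by rw [h2 ⟨z, hx hz⟩]

end WGraph

namespace GaussMat
open Matrix
variable {ι : Type*} [Fintype ι] [DecidableEq ι]

lemma capM_mono {A : Matrix ι ι ℝ} (hA : IsMMat A) {K K' : Finset ι} (h : K ⊆ K') :
    capM A K ≤ capM A K' := by
  set m : ι → ℝ := A *ᵥ eqPot A K with hm
  set n : ι → ℝ := A *ᵥ eqPot A K' with hn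
  calc capM A K = ∑ x ∈ K, m x * eqPot A K' x :=
        Finset.sum_congr rfl fun x hx => by rw [eqPot_on hA.posDef (h hx), mul_one]
    _ = ∑ y ∈ K', n y * eqPot A K y := by
        simp_rw [eqPot_eq_sum hA.posDef K', eqPot_eq_sum hA.posDef K, Finset.mul_sum]
        rw [Finset.sum_comm]
        refine Finset.sum_congr rfl fun y _ => Finset.sum_congr rfl fun x _ => ?_
        rw [inv_symm hA.posDef x y, ← hm, ← hn]
        ring
    _ ≤ capM A K' := Finset.sum_le_sum fun y _ =>
        mul_le_of_le_one_right (eqMeas_nonneg hA K' y) (eqPot_le_one hA K y)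

end GaussMat

namespace WGraph
variable (M : WGraph)

/-- The ball as a finite set. -/
def fball (x : M.V) (r : ℝ) : Finset M.V :=
  if h : (M.ball x r).Finite then h.toFinset else ∅

/-- Uniform constants for a graph satisfying the standing assumptions. -/
structure Regular (c C D : ℝ) : Prop where
  c_pos : 0 < c
  c_le : c ≤ 1
  C_ge : 1 ≤ C
  D_ge : 1 ≤ D
  ν_ge : 1 ≤ M.ν
  α_ge : 2 * M.ν ≤ M.α
  standing : M.Standing
  diag : ∀ x, c ≤ M.green x x
  le : ∀ x y, M.green x y ≤ C
  ge_d : ∀ x y, x ≠ y → c * M.d x y ^ (-M.ν) ≤ M.green x y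
  le_d : ∀ x y, x ≠ y → M.green x y ≤ C * M.d x y ^ (-M.ν)
  card_ge : ∀ x r, 1 ≤ r → c * r ^ M.α ≤ (M.fball x r).card
  card_le : ∀ x r, 1 ≤ r → ((M.fball x r).card : ℝ) ≤ C * r ^ M.α
  nbr_le : ∀ x y, 0 < M.lam x y → M.d x y ≤ D

lemma lap_const_sub (a : ℝ) (h : M.V → ℝ) (x : M.V) :
    M.lap (fun v => a - h v) x = -M.lap h x := by
  simp only [lap, mul_sub, Finset.sum_sub_distrib, ← Finset.sum_mul, ← lamTot_eq]; ring

variable {M}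

lemma mem_fball (hS : M.Standing) {x y : M.V} {r : ℝ} : y ∈ M.fball x r ↔ M.d x y ≤ r := by
  rw [fball, dif_pos (finite_ball hS x r), Set.Finite.mem_toFinset]
  rfl

lemma green_le_diag (hS : M.Standing) (hν : 0 < M.ν) (hα : 0 < M.α) (x y : M.V) :
    M.green x y ≤ M.green y y := by
  have := infinite_V hS hα
  have h := M.nonneg_of_lap (h := fun x => M.green y y - M.green x y) (l := M.green y y - 0)
    (by rw [sub_zero]; exact (green_pos hS y y).le) ((tendsto_green hS hν y).const_sub _)
    (fun x hx => by
      rw [lap_const_sub, lap_green hS, if_neg, neg_zero]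
      rintro rfl
      simp at hx) x
  linarith

lemma exists_regular (hS : M.Standing) (hν : 1 ≤ M.ν) (hα : 2 * M.ν ≤ M.α) :
    ∃ c C D, M.Regular c C D := by
  obtain ⟨c₁, hc₁, C₁, hC₁, hV⟩ := hS.2.1
  obtain ⟨c₂, hc₂, C₂, hC₂, hg, hg'⟩ := hS.2.2
  obtain ⟨c₀, hc₀, hctrl⟩ := M.ctrl
  have hν0 : 0 < M.ν := by linarith
  have hα0 : 0 < M.α := by linarith
  have hlam1 : ∀ x, C₂⁻¹ ≤ M.lamTot x := fun x => by
    have h := one_le_lamTot_mul_green hS x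
    rw [inv_le_iff_one_le_mul₀ hC₂]
    exact h.trans (mul_le_mul_of_nonneg_left (hg x).2 (M.lamTot_nonneg x))
  have hVs : ∀ x r, 1 ≤ r → c₁ * r ^ M.α ≤ ∑ y ∈ M.fball x r, M.lamTot y ∧
      ∑ y ∈ M.fball x r, M.lamTot y ≤ C₁ * r ^ M.α := fun x r hr => by
    have := hV x r hr
    rwa [finsum_ball_eq (finite_ball hS x r), show (finite_ball hS x r).toFinset = M.fball x r by
      rw [fball, dif_pos (finite_ball hS x r)]] at this
  have hlam2 : ∀ x, M.lamTot x ≤ C₁ := fun x => by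
    have h := (hVs x 1 le_rfl).2
    rw [Real.one_rpow, mul_one] at h
    exact (Finset.single_le_sum (fun y _ => M.lamTot_nonneg y) ((mem_fball hS).2 (by
      rw [M.d_self]; norm_num))).trans h
  refine ⟨min 1 (min c₂ (c₁ / C₁)), max 1 (max C₂ (C₁ * C₂)),
    max 1 ((C₂ / (c₀ * c₂)) ^ (M.ν)⁻¹), ?_, min_le_left _ _, le_max_left _ _, le_max_left _ _, hν, hα,
    hS, fun x => ?_, fun x y => ?_, fun x y hxy => ?_, fun x y hxy => ?_, fun x r hr => ?_,
    fun x r hr => ?_, fun x y hxy => ?_⟩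
  · have : 0 < c₁ / C₁ := by positivity
    simp [hc₂, this]
  · exact ((min_le_right _ _).trans (min_le_left _ _)).trans (hg x).1
  · exact ((green_le_diag hS hν0 hα0 x y).trans (hg y).2).trans
      ((le_max_left _ _).trans (le_max_right _ _))
  · refine le_trans ?_ (hg' x y hxy).1
    have := M.d_pos x y hxy
    gcongr
    exact (min_le_right _ _).trans (min_le_left _ _)
  · refine (hg' x y hxy).2.trans ?_
    have := M.d_pos x y hxy
    gcongr
    exact (le_max_left _ _).trans (le_max_right _ _)
  · have h1 : ∑ y ∈ M.fball x r, M.lamTot y ≤ (M.fball x r).card * C₁ := by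
      rw [← nsmul_eq_mul]
      exact Finset.sum_le_card_nsmul _ _ _ fun y _ => hlam2 y
    have h2 := (hVs x r hr).1.trans h1
    calc _ ≤ c₁ / C₁ * r ^ M.α := by
          gcongr
          exact (min_le_right _ _).trans (min_le_right _ _)
      _ = c₁ * r ^ M.α / C₁ := by ring
      _ ≤ _ := by rw [div_le_iff₀ hC₁]; exact h2
  · have h1 : (M.fball x r).card * C₂⁻¹ ≤ ∑ y ∈ M.fball x r, M.lamTot y := by
      rw [← nsmul_eq_mul]
      exact Finset.card_nsmul_le_sum _ _ _ fun y _ => hlam1 y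
    have h2 := h1.trans (hVs x r hr).2
    rw [← div_eq_mul_inv, div_le_iff₀ hC₂] at h2
    calc _ ≤ C₁ * r ^ M.α * C₂ := h2
      _ = C₁ * C₂ * r ^ M.α := by ring
      _ ≤ _ := by
        gcongr
        exact (le_max_right _ _).trans (le_max_right _ _)
  · by_cases hxy' : x = y
    · subst hxy'; rw [M.d_self]; positivity
    refine le_trans ?_ (le_max_right _ _)
    have hd := M.d_pos x y hxy'
    have h1 := lap_green hS x y
    rw [if_neg hxy', lap, sub_eq_zero] at h1
    have h2 : M.lam x y * M.green y y ≤ M.lamTot x * M.green x y := by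
      rw [h1]
      exact Finset.single_le_sum (f := fun z => M.lam x z * M.green z y)
        (fun z _ => mul_nonneg (M.lam_nonneg _ _) (green_pos hS z y).le) (M.mem_nbr.2 hxy)
    have h3 : c₀ * M.lamTot x ≤ M.lam x y := hctrl x y hxy
    have h4 : c₀ * c₂ ≤ M.green x y := by
      refine le_of_mul_le_mul_left ?_ (lamTot_pos hS x)
      calc M.lamTot x * (c₀ * c₂) = c₀ * M.lamTot x * c₂ := by ring
        _ ≤ M.lam x y * M.green y y := mul_le_mul h3 (hg y).1 hc₂.le (M.lam_nonneg _ _)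
        _ ≤ _ := h2
    have h5 := h4.trans (hg' x y hxy').2
    rw [← Real.rpow_le_rpow_iff hd.le (by positivity) hν0, ← Real.rpow_mul (by positivity),
      inv_mul_cancel₀ hν0.ne', Real.rpow_one, le_div_iff₀ (by positivity)]
    rw [Real.rpow_neg hd.le] at h5
    have := Real.rpow_pos_of_pos hd M.ν
    calc M.d x y ^ M.ν * (c₀ * c₂) ≤ M.d x y ^ M.ν * (C₂ * (M.d x y ^ M.ν)⁻¹) := by gcongr
      _ = C₂ := by field_simp

end WGraph

namespace WGraph
variable {M : WGraph} {c C D : ℝ}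

lemma Regular.C_pos (hM : M.Regular c C D) : 0 < C := by linarith [hM.C_ge]
lemma Regular.ν_pos (hM : M.Regular c C D) : 0 < M.ν := by linarith [hM.ν_ge]
lemma Regular.α_pos (hM : M.Regular c C D) : 0 < M.α := by linarith [hM.ν_ge, hM.α_ge]
lemma Regular.mem_fball (hM : M.Regular c C D) {x y : M.V} {r : ℝ} :
    y ∈ M.fball x r ↔ M.d x y ≤ r := WGraph.mem_fball hM.standing

lemma sum_fball_two_pow (hM : M.Regular c C D) {K β : ℝ} (hK : 0 ≤ K) (hβ : 0 ≤ β) {w : M.V}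
    {f : M.V → ℝ} (h1 : ∀ v, f v ≤ K) (h2 : ∀ v, w ≠ v → f v ≤ K * M.d w v ^ (-β)) (n : ℕ) :
    ∑ v ∈ M.fball w (2 ^ n), f v ≤
      K * C * 2 ^ M.α * (1 + ∑ j ∈ Finset.range n, ((2 : ℝ) ^ (M.α - β)) ^ j) := by
  have hC := hM.C_pos
  have h2α : (1 : ℝ) ≤ 2 ^ M.α := Real.one_le_rpow (by norm_num) hM.α_pos.le
  induction n with
  | zero =>
    have h3 := hM.card_le w 1 le_rfl
    rw [Real.one_rpow, mul_one] at h3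
    rw [pow_zero, Finset.sum_range_zero, add_zero, mul_one]
    calc _ ≤ ((M.fball w 1).card : ℝ) * K := by
          rw [← nsmul_eq_mul]; exact Finset.sum_le_card_nsmul _ _ _ fun v _ => h1 v
      _ ≤ C * K := by gcongr
      _ = K * C * 1 := by ring
      _ ≤ _ := by gcongr
  | succ n ih =>
    have hsub : M.fball w (2 ^ n) ⊆ M.fball w (2 ^ (n + 1)) := fun v hv => by
      rw [hM.mem_fball] at hv ⊢
      exact hv.trans (pow_le_pow_right₀ (by norm_num) n.le_succ)
    rw [← Finset.sum_sdiff hsub, Finset.sum_range_succ]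
    have h4 : ∑ v ∈ M.fball w (2 ^ (n + 1)) \ M.fball w (2 ^ n), f v ≤
        K * C * 2 ^ M.α * ((2 : ℝ) ^ (M.α - β)) ^ n := by
      have h5 : ∀ v ∈ M.fball w (2 ^ (n + 1)) \ M.fball w (2 ^ n),
          f v ≤ K * ((2 : ℝ) ^ n) ^ (-β) := fun v hv => by
        rw [Finset.mem_sdiff, hM.mem_fball, hM.mem_fball, not_le] at hv
        have hwv : w ≠ v := by
          rintro rfl
          rw [M.d_self] at hv
          exact absurd hv.2 (not_lt.2 (by positivity))
        refine (h2 v hwv).trans (mul_le_mul_of_nonneg_left ?_ hK)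
        exact Real.rpow_le_rpow_of_nonpos (by positivity) hv.2.le (by linarith)
      calc _ ≤ ((M.fball w (2 ^ (n + 1)) \ M.fball w (2 ^ n)).card : ℝ) * (K * ((2 : ℝ) ^ n) ^ (-β)) := by
            rw [← nsmul_eq_mul]; exact Finset.sum_le_card_nsmul _ _ _ h5
        _ ≤ (C * (2 ^ (n + 1)) ^ M.α) * (K * ((2 : ℝ) ^ n) ^ (-β)) := by
            gcongr
            refine le_trans ?_ (hM.card_le w (2 ^ (n + 1)) (one_le_pow₀ (by norm_num)))
            exact_mod_cast Finset.card_le_card Finset.sdiff_subset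
        _ = _ := by
            rw [pow_succ, Real.mul_rpow (by positivity) (by norm_num), ← Real.rpow_natCast,
              ← Real.rpow_natCast, ← Real.rpow_mul (by norm_num), ← Real.rpow_mul (by norm_num),
              ← Real.rpow_mul (by norm_num),
              show (M.α - β) * (n : ℝ) = n * M.α + n * -β by ring, Real.rpow_add (by norm_num)]
            ring
    calc _ ≤ K * C * 2 ^ M.α * ((2 : ℝ) ^ (M.α - β)) ^ n +
          K * C * 2 ^ M.α * (1 + ∑ j ∈ Finset.range n, ((2 : ℝ) ^ (M.α - β)) ^ j) :=
          add_le_add h4 ih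
      _ = _ := by ring

lemma exists_two_pow {r : ℝ} (hr : 1 ≤ r) :
    ∃ n : ℕ, r ≤ 2 ^ n ∧ (2 : ℝ) ^ n ≤ 2 * r ∧ (n : ℝ) ≤ 1 + Real.log r / Real.log 2 := by
  have hl2 : 0 < Real.log 2 := Real.log_pos (by norm_num)
  have h0 : 0 ≤ Real.log r / Real.log 2 := div_nonneg (Real.log_nonneg hr) hl2.le
  have hc := Nat.ceil_lt_add_one h0
  have hle := Nat.le_ceil (Real.log r / Real.log 2)
  set n := ⌈Real.log r / Real.log 2⌉₊
  have hr0 : 0 < r := by linarith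
  refine ⟨n, ?_, ?_, by linarith⟩
  · rw [← Real.log_le_log_iff hr0 (by positivity), Real.log_pow]
    rwa [div_le_iff₀ hl2] at hle
  · rw [← Real.log_le_log_iff (by positivity) (by positivity), Real.log_pow,
      Real.log_mul (by norm_num) hr0.ne']
    have : (n : ℝ) * Real.log 2 ≤ (Real.log r / Real.log 2 + 1) * Real.log 2 := by gcongr
    rw [add_mul, div_mul_cancel₀ _ hl2.ne'] at this
    linarith

lemma sum_fball_le_rpow (hM : M.Regular c C D) {K β : ℝ} (hK : 0 ≤ K) (hβ : 0 ≤ β)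
    (hαβ : β < M.α) : ∃ K' > 0, ∀ (w : M.V) (f : M.V → ℝ), (∀ v, 0 ≤ f v) → (∀ v, f v ≤ K) →
      (∀ v, w ≠ v → f v ≤ K * M.d w v ^ (-β)) → ∀ r, 1 ≤ r →
        ∑ v ∈ M.fball w r, f v ≤ K' * r ^ (M.α - β) := by
  have hC := hM.C_pos
  set x : ℝ := (2 : ℝ) ^ (M.α - β) with hx
  have hx1 : 1 < x := Real.one_lt_rpow (by norm_num) (by linarith)
  refine ⟨K * C * 2 ^ M.α * (1 + 1 / (x - 1)) * x + 1, by
    have : 0 < x - 1 := by linarith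
    positivity, fun w f h0 h1 h2 r hr => ?_⟩
  obtain ⟨n, hn, hn', -⟩ := exists_two_pow hr
  have hx1' : 0 < x - 1 := by linarith
  have hxn : (1 : ℝ) ≤ x ^ n := one_le_pow₀ hx1.le
  have hxr : x ^ n ≤ x * r ^ (M.α - β) := by
    calc x ^ n = ((2 : ℝ) ^ n) ^ (M.α - β) := by
          rw [hx, ← Real.rpow_natCast, ← Real.rpow_natCast, ← Real.rpow_mul (by norm_num),
            ← Real.rpow_mul (by norm_num), mul_comm]
      _ ≤ (2 * r) ^ (M.α - β) := Real.rpow_le_rpow (by positivity) hn' (by linarith)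
      _ = _ := Real.mul_rpow (by norm_num) (by linarith)
  have hsub : M.fball w r ⊆ M.fball w (2 ^ n) := fun v hv => by
    rw [hM.mem_fball] at hv ⊢; exact hv.trans hn
  have hr' : 0 ≤ r ^ (M.α - β) := by positivity
  calc _ ≤ ∑ v ∈ M.fball w (2 ^ n), f v :=
        Finset.sum_le_sum_of_subset_of_nonneg hsub fun v _ _ => h0 v
    _ ≤ K * C * 2 ^ M.α * (1 + ∑ j ∈ Finset.range n, x ^ j) :=
        sum_fball_two_pow hM hK hβ h1 h2 n
    _ ≤ K * C * 2 ^ M.α * ((1 + 1 / (x - 1)) * x ^ n) := by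
        gcongr
        rw [geom_sum_eq hx1.ne', add_mul, one_mul, div_mul_eq_mul_div, one_mul]
        gcongr
        linarith
    _ ≤ K * C * 2 ^ M.α * ((1 + 1 / (x - 1)) * (x * r ^ (M.α - β))) := by gcongr
    _ ≤ _ := by nlinarith

lemma sum_fball_le_log (hM : M.Regular c C D) {K : ℝ} (hK : 0 ≤ K) :
    ∃ K' > 0, ∀ (w : M.V) (f : M.V → ℝ), (∀ v, 0 ≤ f v) → (∀ v, f v ≤ K) →
      (∀ v, w ≠ v → f v ≤ K * M.d w v ^ (-M.α)) → ∀ r, 1 ≤ r →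
        ∑ v ∈ M.fball w r, f v ≤ K' * (1 + Real.log r) := by
  have hC := hM.C_pos
  have hl2 : 0 < Real.log 2 := Real.log_pos (by norm_num)
  refine ⟨K * C * 2 ^ M.α * (2 + 1 / Real.log 2) + 1, by positivity, fun w f h0 h1 h2 r hr => ?_⟩
  obtain ⟨n, hn, -, hn'⟩ := exists_two_pow hr
  have hlr := Real.log_nonneg hr
  have hsub : M.fball w r ⊆ M.fball w (2 ^ n) := fun v hv => by
    rw [hM.mem_fball] at hv ⊢; exact hv.trans hn
  have h3 := sum_fball_two_pow hM hK hM.α_pos.le h1 h2 n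
  simp only [sub_self, Real.rpow_zero, one_pow, Finset.sum_const, Finset.card_range, nsmul_eq_mul,
    mul_one] at h3
  calc _ ≤ ∑ v ∈ M.fball w (2 ^ n), f v :=
        Finset.sum_le_sum_of_subset_of_nonneg hsub fun v _ _ => h0 v
    _ ≤ K * C * 2 ^ M.α * (1 + n) := h3
    _ ≤ K * C * 2 ^ M.α * ((2 + 1 / Real.log 2) * (1 + Real.log r)) := by
        gcongr
        have : Real.log r / Real.log 2 = 1 / Real.log 2 * Real.log r := by ring
        have h4 : 0 < 1 / Real.log 2 := by positivity
        nlinarith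
    _ ≤ _ := by nlinarith

/-- The logarithmic correction present at the critical exponent. -/
lemma sum_green_sq_le (hM : M.Regular c C D) : ∃ K > 0, ∀ (w : M.V) (r : ℝ), 1 ≤ r →
    ∑ v ∈ M.fball w r, M.green w v ^ 2 ≤
      K * (r ^ (M.α - 2 * M.ν) * (1 + Real.log r) ^ bTwo M.ν M.α) := by
  have hC := hM.C_pos
  have h0 : ∀ w v : M.V, 0 ≤ M.green w v ^ 2 := fun _ _ => sq_nonneg _
  have hpos := fun w v => (green_pos hM.standing w v).le
  have h1 : ∀ w v : M.V, M.green w v ^ 2 ≤ C ^ 2 := fun w v =>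
    pow_le_pow_left₀ (hpos w v) (hM.le w v) 2
  have h2 : ∀ w v : M.V, w ≠ v → M.green w v ^ 2 ≤ C ^ 2 * M.d w v ^ (-(2 * M.ν)) := by
    intro w v hwv
    have hd := M.d_pos w v hwv
    calc _ ≤ (C * M.d w v ^ (-M.ν)) ^ 2 := pow_le_pow_left₀ (hpos w v) (hM.le_d w v hwv) 2
      _ = C ^ 2 * M.d w v ^ (-(2 * M.ν)) := by
        rw [mul_pow, ← Real.rpow_natCast (M.d w v ^ (-M.ν)), ← Real.rpow_mul hd.le]
        congr 2
        push_cast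
        ring
  by_cases h : M.α = 2 * M.ν
  · obtain ⟨K, hK, H⟩ := sum_fball_le_log hM (sq_nonneg C)
    refine ⟨K, hK, fun w r hr => ?_⟩
    have := H w (fun v => M.green w v ^ 2) (h0 w) (h1 w) (by rw [h]; exact h2 w) r hr
    simpa [bTwo, h] using this
  · obtain ⟨K, hK, H⟩ := sum_fball_le_rpow hM (sq_nonneg C) (by linarith [hM.ν_pos] : 0 ≤ 2 * M.ν)
      (lt_of_le_of_ne hM.α_ge (Ne.symm h))
    refine ⟨K, hK, fun w r hr => ?_⟩
    have := H w (fun v => M.green w v ^ 2) (h0 w) (h1 w) (h2 w) r hr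
    simpa [bTwo, h] using this

lemma sum_green_le (hM : M.Regular c C D) : ∃ K > 0, ∀ (w : M.V) (r : ℝ), 1 ≤ r →
    ∑ v ∈ M.fball w r, M.green w v ≤ K * r ^ (M.α - M.ν) := by
  obtain ⟨K, hK, H⟩ := sum_fball_le_rpow hM hM.C_pos.le hM.ν_pos.le
    (by linarith [hM.α_ge, hM.ν_pos])
  exact ⟨K, hK, fun w => H w _ (fun v => (green_pos hM.standing w v).le) (hM.le w) (hM.le_d w)⟩

/-- There is a vertex at a distance comparable to, but larger than, a given radius. -/
lemma exists_far (hM : M.Regular c C D) : ∃ K > 0, ∀ (x : M.V) (r : ℝ), 1 ≤ r →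
    ∃ z, r < M.d x z ∧ M.d x z ≤ K * r := by
  have hC := hM.C_pos
  have hc := hM.c_pos
  have hα := hM.α_pos
  set K : ℝ := (2 * C / c) ^ (M.α)⁻¹ with hK
  have hKα : K ^ M.α = 2 * C / c := by
    rw [hK, ← Real.rpow_mul (by positivity), inv_mul_cancel₀ hα.ne', Real.rpow_one]
  have hK1 : 1 ≤ K := Real.one_le_rpow (by
    rw [le_div_iff₀ hc]; linarith [hM.c_le, hM.C_ge]) (by positivity)
  refine ⟨K, by positivity, fun x r hr => ?_⟩
  by_contra! hcon
  have hsub : M.fball x (K * r) ⊆ M.fball x r := fun z hz => by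
    rw [hM.mem_fball] at hz ⊢
    by_contra! h
    exact absurd hz (not_le.2 (hcon z h))
  have h1 : ((M.fball x (K * r)).card : ℝ) ≤ (M.fball x r).card := by
    exact_mod_cast Finset.card_le_card hsub
  have h2 := hM.card_ge x (K * r) (by nlinarith)
  have h3 := hM.card_le x r hr
  rw [Real.mul_rpow (by positivity) (by positivity), hKα] at h2
  have hr' : 0 < r ^ M.α := by positivity
  have h4 : c * (2 * C / c * r ^ M.α) = 2 * (C * r ^ M.α) := by field_simp
  rw [h4] at h2
  have : 0 < C * r ^ M.α := by positivity
  linarith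

end WGraph

namespace GaussMat
open Matrix
variable {ι : Type*} [Fintype ι] [DecidableEq ι]

lemma capM_mul_le_one {A : Matrix ι ι ℝ} (hA : IsMMat A) {K : Finset ι} {x : ι} (hx : x ∈ K) {g : ℝ}
    (hg : ∀ y ∈ K, g ≤ A⁻¹ x y) : g * capM A K ≤ 1 := by
  rw [← eqPot_on hA.posDef hx, eqPot_eq_sum hA.posDef, capM, Finset.mul_sum]
  exact Finset.sum_le_sum fun y hy => mul_le_mul_of_nonneg_right (hg y hy) (eqMeas_nonneg hA K y)

end GaussMat

namespace WGraph
open GaussMat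
variable {M : WGraph} {c C D : ℝ}

/-- The ball as a finite subset of a finite vertex set. -/
def sball (U : Finset M.V) (w : M.V) (r : ℝ) : Finset U :=
  Finset.univ.filter fun x => M.d w x ≤ r

lemma mem_sball {U : Finset M.V} {w : M.V} {r : ℝ} {x : U} : x ∈ M.sball U w r ↔ M.d w x ≤ r := by
  simp [sball]

lemma map_sball (hM : M.Regular c C D) {U : Finset M.V} {w : M.V} {r : ℝ} (h : M.fball w r ⊆ U) :
    (M.sball U w r).map (Function.Embedding.subtype _) = M.fball w r := by
  ext x
  simp only [Finset.mem_map, mem_sball, Function.Embedding.coe_subtype, hM.mem_fball]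
  exact ⟨fun ⟨y, hy, e⟩ => e ▸ hy, fun hx => ⟨⟨x, h (hM.mem_fball.2 hx)⟩, hx, rfl⟩⟩

lemma sum_sball_le (hM : M.Regular c C D) {U : Finset M.V} {w : M.V} {r : ℝ} {v : M.V}
    (hv : M.d w v ≤ r) {f : M.V → ℝ} (hf : ∀ x, 0 ≤ f x) :
    ∑ x ∈ M.sball U w r, f x ≤ ∑ x ∈ M.fball v (2 * r), f x := by
  rw [show ∑ x ∈ M.sball U w r, f x =
    ∑ x ∈ (M.sball U w r).map (Function.Embedding.subtype _), f x by rw [Finset.sum_map]; rfl]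
  refine Finset.sum_le_sum_of_subset_of_nonneg (fun x hx => ?_) fun x _ _ => hf x
  simp only [Finset.mem_map, mem_sball, Function.Embedding.coe_subtype] at hx
  obtain ⟨y, hy, rfl⟩ := hx
  rw [hM.mem_fball]
  have := M.d_triangle v w y
  rw [M.d_symm v w] at this
  linarith

theorem range_law_ball (hM : M.Regular c C D) {K₁ : ℝ} (hK₁ : 0 < K₁) :
    ∃ c₁ > 0, ∃ c₂ > 0, ∀ (U : Finset M.V) (z : U) (w : M.V) (L R : ℝ), 1 ≤ L → 0 < R →
      M.fball w L ⊆ U → (∀ v, M.d w v ≤ L → R ≤ M.d z v ∧ M.d z v ≤ K₁ * R) →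
      ∀ ρ : Finset U → ℝ, (∀ F, 0 ≤ ρ F) → ∑ F, ρ F = 1 →
        (∀ K, (∑ F, ρ F * if Disjoint F K then 1 else 0) = 1 - eqPot (M.greenMat U)⁻¹ K z) →
        c₁ * (L / R) ^ M.ν ≤ ∑ F, ρ F *
          if c₂ * (L ^ M.ν / (1 + Real.log (2 * L)) ^ bTwo M.ν M.α) ≤
            capM (M.greenMat U)⁻¹ (F ∩ M.sball U w L) then 1 else 0 := by
  obtain ⟨k₁, hk₁, H₁⟩ := sum_green_le hM
  obtain ⟨k₂, hk₂, H₂⟩ := sum_green_sq_le hM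
  have hC := hM.C_pos
  have hc := hM.c_pos
  set k : ℝ := K₁ ^ (-M.ν) with hk
  have hk0 : 0 < k := by positivity
  set t₁ : ℝ := 2 ^ (M.α - M.ν) with ht₁
  set t₂ : ℝ := 2 ^ (M.α - 2 * M.ν) with ht₂
  set t₃ : ℝ := 2 ^ M.ν with ht₃
  have ht₁0 : 0 < t₁ := by positivity
  have ht₂0 : 0 < t₂ := by positivity
  have ht₃0 : 0 < t₃ := by positivity
  refine ⟨c ^ 5 * k ^ 2 / (8 * C ^ 3 * k₁ * t₁), by positivity,
    c ^ 6 * k ^ 2 / (8 * C ^ 4 * k₂ * t₂ * t₃), by positivity,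
    fun U z w L R hL hR hsub hz ρ h0 h1 h2 => ?_⟩
  have hA := isMMat_inv (S := U) hM.standing hM.ν_pos hM.α_pos
  have hG : ∀ x y : U, ((M.greenMat U)⁻¹)⁻¹ x y = M.green x y := fun x y => by
    rw [inv_inv_greenMat hM.standing hM.ν_pos hM.α_pos]; rfl
  set X : ℝ := R ^ (-M.ν) with hX
  set W : ℝ := L ^ M.ν with hW
  set Y : ℝ := L ^ (M.α - 2 * M.ν) with hY
  set ℓ : ℝ := (1 + Real.log (2 * L)) ^ bTwo M.ν M.α with hℓ
  have hL0 : 0 < L := by linarith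
  have hX0 : 0 < X := by positivity
  have hW0 : 0 < W := by positivity
  have hY0 : 0 < Y := by positivity
  have hlog : 0 ≤ Real.log (2 * L) := Real.log_nonneg (by linarith)
  have hℓ0 : 0 < ℓ := Real.rpow_pos_of_pos (by linarith) _
  have hYW : L ^ (M.α - M.ν) = Y * W := by rw [hY, hW, ← Real.rpow_add hL0]; ring_nf
  have hYWW : L ^ M.α = Y * W * W := by rw [hY, hW, ← Real.rpow_add hL0, ← Real.rpow_add hL0]; ring_nf
  have hWX : (L / R) ^ M.ν = W * X := by
    rw [Real.div_rpow hL0.le hR.le, hX, Real.rpow_neg hR.le]; rfl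
  have h2L1 : (2 * L) ^ (M.α - M.ν) = t₁ * (Y * W) := by
    rw [Real.mul_rpow (by norm_num) hL0.le, hYW]
  have h2L2 : (2 * L) ^ (M.α - 2 * M.ν) = t₂ * Y := by rw [Real.mul_rpow (by norm_num) hL0.le]
  have h2L3 : (2 * L) ^ M.ν = t₃ * W := by rw [Real.mul_rpow (by norm_num) hL0.le]
  have hcard : c * (Y * W * W) ≤ ((M.sball U w L).card : ℝ) := by
    rw [← hYWW, ← Finset.card_map (Function.Embedding.subtype _), map_sball hM hsub]
    exact hM.card_ge w L hL
  set n : ℝ := ((M.sball U w L).card : ℝ) with hn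
  have hn0 : 0 < n := lt_of_lt_of_le (by positivity) hcard
  have hne : (M.sball U w L).Nonempty := by
    rw [← Finset.card_pos]; exact Nat.cast_pos.1 hn0
  have hb : ∀ v ∈ M.sball U w L, c * (k * X) ≤ ((M.greenMat U)⁻¹)⁻¹ z v ∧
      ((M.greenMat U)⁻¹)⁻¹ z v ≤ C * X := fun v hv => by
    have hzv := hz v (mem_sball.1 hv)
    have hzv' : (z : M.V) ≠ v := fun e => by
      rw [e, M.d_self] at hzv; linarith [hzv.1]
    rw [hG]
    constructor
    · refine le_trans ?_ (hM.ge_d z v hzv')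
      rw [hk, hX, ← Real.mul_rpow hK₁.le hR.le]
      exact mul_le_mul_of_nonneg_left (Real.rpow_le_rpow_of_nonpos (M.d_pos z v hzv') hzv.2
        (by linarith [hM.ν_pos])) hc.le
    · refine (hM.le_d z v hzv').trans ?_
      exact mul_le_mul_of_nonneg_left (Real.rpow_le_rpow_of_nonpos hR hzv.1
        (by linarith [hM.ν_pos])) hC.le
  have hcap : capM (M.greenMat U)⁻¹ (M.sball U w L) ≤ t₃ * W / c := by
    obtain ⟨x, hx⟩ := hne
    have := capM_mul_le_one hA hx (g := c / (t₃ * W)) fun y hy => by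
      rw [hG, ← h2L3]
      by_cases hxy : (x : M.V) = y
      · rw [hxy]
        exact (div_le_self hc.le (Real.one_le_rpow (by linarith) hM.ν_pos.le)).trans (hM.diag y)
      · refine le_trans ?_ (hM.ge_d x y hxy)
        rw [div_eq_mul_inv, ← Real.rpow_neg (by positivity)]
        refine mul_le_mul_of_nonneg_left (Real.rpow_le_rpow_of_nonpos (M.d_pos x y hxy) ?_
          (by linarith [hM.ν_pos])) hc.le
        have := M.d_triangle x w y
        rw [M.d_symm x w] at this
        linarith [mem_sball.1 hx, mem_sball.1 hy]
    rw [le_div_iff₀ hc]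
    rw [div_mul_eq_mul_div, div_le_one (by positivity)] at this
    linarith
  have hH : eqPot (M.greenMat U)⁻¹ (M.sball U w L) z ≤ C * X * (t₃ * W / c) :=
    (eqPot_le_mul_capM hA _ z fun x hx => (hb x hx).2).trans
      (mul_le_mul_of_nonneg_left hcap (by positivity))
  have key := range_law_cap hA h0 h1 h2 (M.sball U w L) (c₀ := c) (C₀ := C) (a := c * (k * X))
    (b := C * X) (S₁ := k₁ * (t₁ * (Y * W))) (S₂ := k₂ * (t₂ * Y * ℓ)) (H := C * X * (t₃ * W / c))
    (κ := c ^ 6 * k ^ 2 / (8 * C ^ 4 * k₂ * t₂ * t₃) * (W / ℓ)) hc hC (by positivity) (by positivity)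
    (fun v _ => by rw [hG]; exact ⟨hM.diag v, hM.le v v⟩) hb (fun v hv => by
      simp only [hG]
      rw [← h2L1]
      exact (sum_sball_le hM (mem_sball.1 hv) fun x => (green_pos hM.standing v x).le).trans
        (H₁ v (2 * L) (by linarith))) (fun v hv => by
      simp only [hG]
      rw [← h2L2]
      exact (sum_sball_le hM (f := fun x => M.green v x ^ 2) (mem_sball.1 hv)
        fun x => sq_nonneg _).trans (H₂ v (2 * L) (by linarith))) hH hne (by
      rw [← hn]
      calc _ = (c * (k * X) / C) ^ 2 * (c * (Y * W * W)) * n := by field_simp; ring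
        _ ≤ (c * (k * X) / C) ^ 2 * n * n := by gcongr
        _ = _ := by ring)
  rw [← hn] at key
  rw [hWX]
  set P : ℝ := ∑ F, ρ F * if c ^ 6 * k ^ 2 / (8 * C ^ 4 * k₂ * t₂ * t₃) * (W / ℓ) ≤
    capM (M.greenMat U)⁻¹ (F ∩ M.sball U w L) then 1 else 0 with hP
  have key2 : (c * (k * X) / C) ^ 2 * n ≤ 4 * (2 * (C * X) / c ^ 2 * (k₁ * (t₁ * (Y * W)))) * P := by
    refine le_of_mul_le_mul_left ?_ hn0
    calc _ = (c * (k * X) / C * n) ^ 2 := by ring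
      _ ≤ _ := key
      _ = _ := by ring
  have key3 := (mul_le_mul_of_nonneg_left hcard (sq_nonneg (c * (k * X) / C))).trans key2
  have h5 : 0 < 4 * (2 * (C * X) / c ^ 2 * (k₁ * (t₁ * (Y * W)))) := by positivity
  refine le_of_mul_le_mul_left (le_trans (le_of_eq ?_) key3) h5
  field_simp
  ring

end WGraph

namespace WGraph
open GaussMat
variable {M : WGraph} {c C D : ℝ}

lemma inv_mulVec_congr (hM : M.Regular c C D) {S : Finset M.V} {x : S} (hx : M.nbr x ⊆ S)
    {u v : S → ℝ} (h0 : u x = v x) (h : ∀ y : S, 0 < M.lam x y → u y = v y) :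
    ((M.greenMat S)⁻¹.mulVec u) x = ((M.greenMat S)⁻¹.mulVec v) x := by
  have key : ∀ w : S → ℝ, ((M.greenMat S)⁻¹.mulVec w) x =
      M.lap (fun z => if hz : z ∈ S then w ⟨z, hz⟩ else 0) x := fun w => by
    rw [← inv_mulVec_of_nbr hM.standing hM.ν_pos hM.α_pos hx]
    simp
  rw [key, key, lap, lap]
  simp only [x.2, dif_pos, Subtype.coe_eta]
  rw [h0]
  congr 1
  refine Finset.sum_congr rfl fun z hz => ?_
  rw [dif_pos (hx hz), dif_pos (hx hz), h ⟨z, hx hz⟩ ((M.mem_nbr).1 hz)]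

/-- An obstacle of large capacity near `w` lowers the killed Green's function at `w`. -/
lemma gKill_contract (hM : M.Regular c C D) {C₂ : ℝ} (hC₂ : 2 ≤ C₂)
    (hC₂' : C * (C₂ - 1) ^ (-M.ν) ≤ c / 2) {S : Finset M.V} {F : Finset S} {y w : S} {L κ m : ℝ}
    (hL : 1 ≤ L) (hS : M.fball w (C₂ * L + D) ⊆ S) (hy : C₂ * L + D < M.d w y) (hm : 0 ≤ m)
    (hκ : κ ≤ capM (M.greenMat S)⁻¹ (F ∩ M.sball S w L))
    (hv : ∀ x : S, M.d w x ≤ C₂ * L + D → gKill (M.greenMat S)⁻¹ F y x ≤ m) :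
    gKill (M.greenMat S)⁻¹ F y w ≤ m * (1 - c / 2 * κ * L ^ (-M.ν)) := by
  have hA := isMMat_inv (S := S) hM.standing hM.ν_pos hM.α_pos
  have hG : ∀ x y : S, ((M.greenMat S)⁻¹)⁻¹ x y = M.green x y := fun x y => by
    rw [inv_inv_greenMat hM.standing hM.ν_pos hM.α_pos]; rfl
  have hD := hM.D_ge
  have hL0 : 0 < L := by linarith
  have hC := hM.C_pos
  have hc := hM.c_pos
  set A := (M.greenMat S)⁻¹ with hAdef
  set F' := F ∩ M.sball S w L with hF'
  set u := eqPot A F' with hu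
  set v := gKill A F y with hvdef
  set τ : ℝ := c * L ^ (-M.ν) * capM A F' with hτ
  have hcap : 0 ≤ capM A F' := capM_nonneg hA F'
  have hW : 0 < L ^ (-M.ν) := Real.rpow_pos_of_pos hL0 _
  have hτ0 : 0 ≤ τ := by positivity
  have hmemF' : ∀ f ∈ F', M.d w f ≤ L := fun f hf => mem_sball.1 (Finset.mem_inter.1 hf).2
  have hu_far : ∀ x : S, C₂ * L < M.d w x → u x ≤ τ / 2 := fun x hx => by
    have hb : ∀ f ∈ F', A⁻¹ x f ≤ c / 2 * L ^ (-M.ν) := fun f hf => by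
      have h1 : (C₂ - 1) * L < M.d x f := by
        have := M.d_triangle w f x
        rw [M.d_symm f x] at this
        have := hmemF' f hf
        linarith
      have h2 : 0 < (C₂ - 1) * L := by nlinarith
      have hne : (x : M.V) ≠ f := fun e => by
        rw [e, M.d_self] at h1; linarith
      rw [hG]
      calc M.green x f ≤ C * M.d x f ^ (-M.ν) := hM.le_d x f hne
        _ ≤ C * ((C₂ - 1) * L) ^ (-M.ν) := mul_le_mul_of_nonneg_left
            (Real.rpow_le_rpow_of_nonpos h2 h1.le (by linarith [hM.ν_pos])) hC.le
        _ = C * (C₂ - 1) ^ (-M.ν) * L ^ (-M.ν) := by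
            rw [Real.mul_rpow (by linarith) hL0.le]; ring
        _ ≤ _ := mul_le_mul_of_nonneg_right hC₂' hW.le
    refine (eqPot_le_mul_capM hA F' x hb).trans (le_of_eq ?_)
    rw [hτ]; ring
  have hu_w : τ ≤ u w := by
    rw [hu, eqPot_eq_sum hA.posDef, hτ, capM, Finset.mul_sum]
    refine Finset.sum_le_sum fun f hf => mul_le_mul_of_nonneg_right ?_ (eqMeas_nonneg hA F' f)
    rw [hG]
    by_cases hwf : (w : M.V) = f
    · rw [← hwf]
      refine le_trans ?_ (hM.diag w)
      exact mul_le_of_le_one_right hc.le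
        (Real.rpow_le_one_of_one_le_of_nonpos hL (by linarith [hM.ν_pos]))
    · exact (mul_le_mul_of_nonneg_left (Real.rpow_le_rpow_of_nonpos (M.d_pos w f hwf)
        (hmemF' f hf) (by linarith [hM.ν_pos])) hc.le).trans (hM.ge_d w f hwf)
  set h₀ : S → ℝ := fun x => m * (1 + τ / 2 - u x) - v x with hh₀
  set h : S → ℝ := fun x => if M.d w x ≤ C₂ * L + D then h₀ x else 0 with hh
  have hmain : 0 ≤ h w := by
    refine max_principle hA (fun x => ?_) w
    by_cases hx : M.d w x ≤ C₂ * L + D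
    swap
    · left; simp [hh, hx]
    by_cases hx1 : M.d w x ≤ C₂ * L
    swap
    · left
      rw [hh]; simp only [hx, if_true, hh₀]
      have h1 := hu_far x (not_le.1 hx1)
      have h2 := hv x hx
      nlinarith
    by_cases hxF : x ∈ F
    · left
      rw [hh]; simp only [hx, if_true, hh₀]
      have h1 : u x ≤ 1 := eqPot_le_one hA F' x
      have h2 : v x = 0 := gKill_on hA.posDef y hxF
      rw [h2]
      have : 0 ≤ m * (1 + τ / 2 - u x) := mul_nonneg hm (by linarith)
      linarith
    right
    have hnd : ∀ z, 0 < M.lam x z → M.d w z ≤ C₂ * L + D := fun z hz => by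
      have := M.d_triangle w x z
      have := hM.nbr_le x z hz
      linarith
    have hxS : M.nbr x ⊆ S := fun z hz => hS (hM.mem_fball.2 (hnd z (M.mem_nbr.1 hz)))
    rw [inv_mulVec_congr hM hxS (v := h₀) (by simp [hh, hx])
      fun z hz => by simp [hh, hnd z hz]]
    have e : h₀ = (m * (1 + τ / 2)) • (fun y : S => (fun _ : M.V => (1 : ℝ)) y) - m • u - v := by
      ext x; simp [hh₀]; ring
    have h1 : (A.mulVec fun y : S => (fun _ : M.V => (1 : ℝ)) y) x = 0 := by
      refine (inv_mulVec_of_nbr hM.standing hM.ν_pos hM.α_pos hxS fun _ => 1).trans ?_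
      rw [lap, lamTot_eq]
      simp
    have h2 : (A.mulVec u) x = 0 :=
      eqPot_off hA.posDef fun hxF' => hxF (Finset.mem_inter.1 hxF').1
    have h3 : (A.mulVec v) x = 0 := by
      rw [hvdef, gKill_off hA.posDef y hxF]
      refine Pi.single_eq_of_ne (fun e => ?_) _
      rw [e] at hx; linarith
    rw [e, Matrix.mulVec_sub, Matrix.mulVec_sub, Matrix.mulVec_smul, Matrix.mulVec_smul]
    simp only [Pi.sub_apply, Pi.smul_apply, smul_eq_mul]
    rw [h1, h2, h3]; simp
  have hww : M.d w w ≤ C₂ * L + D := by rw [M.d_self]; nlinarith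
  rw [hh] at hmain
  simp only [hww, if_true, hh₀] at hmain
  have h4 : c / 2 * κ * L ^ (-M.ν) ≤ τ / 2 := by
    rw [hτ]
    calc _ = c / 2 * L ^ (-M.ν) * κ := by ring
      _ ≤ c / 2 * L ^ (-M.ν) * capM A F' := mul_le_mul_of_nonneg_left hκ (by positivity)
      _ = _ := by ring
  nlinarith

/-- Iterating the contraction along a sequence of obstacles. -/
lemma gKill_le_exp (hM : M.Regular c C D) {C₂ : ℝ} (hC₂ : 2 ≤ C₂)
    (hC₂' : C * (C₂ - 1) ^ (-M.ν) ≤ c / 2) {S : Finset M.V} {F : Finset S} {y o : S} {L κ R : ℝ}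
    (hL : 1 ≤ L) (hS : M.fball o (R + D) ⊆ S) (hy : R < M.d o y)
    (hq1 : c / 2 * κ * L ^ (-M.ν) ≤ 1)
    (hκ : ∀ w : S, M.d o w ≤ R - (C₂ * L + D) →
      κ ≤ capM (M.greenMat S)⁻¹ (F ∩ M.sball S w L)) (k : ℕ) (hk : k * (C₂ * L + D) ≤ R) :
    gKill (M.greenMat S)⁻¹ F y o ≤ C * Real.exp (-(c / 2 * κ * L ^ (-M.ν) * k)) := by
  have hA := isMMat_inv (S := S) hM.standing hM.ν_pos hM.α_pos
  have hG : ∀ x y : S, ((M.greenMat S)⁻¹)⁻¹ x y = M.green x y := fun x y => by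
    rw [inv_inv_greenMat hM.standing hM.ν_pos hM.α_pos]; rfl
  set q := c / 2 * κ * L ^ (-M.ν) with hq
  have hC := hM.C_pos
  have key : ∀ j : ℕ, ∀ x : S, M.d o x ≤ R - j * (C₂ * L + D) →
      gKill (M.greenMat S)⁻¹ F y x ≤ C * (1 - q) ^ j := by
    intro j
    induction j with
    | zero =>
      intro x _
      refine (gKill_le hA F y x).trans ?_
      rw [hG]; simpa using hM.le x y
    | succ j ih =>
      intro x hx
      push_cast at hx
      have hD := hM.D_ge
      have hr : 0 ≤ C₂ * L + D := by nlinarith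
      have hj : 0 ≤ (j : ℝ) * (C₂ * L + D) := by positivity
      rw [pow_succ, ← mul_assoc]
      refine gKill_contract hM hC₂ hC₂' hL (fun z hz => hS ?_) ?_
        (mul_nonneg hC.le (pow_nonneg (by linarith) j)) (hκ x (by linarith)) fun z hz => ih z ?_
      · rw [hM.mem_fball] at hz ⊢
        have := M.d_triangle o x z
        linarith
      · have := M.d_triangle o x y
        linarith
      · have := M.d_triangle o x z
        linarith
  refine (key k o (by rw [M.d_self]; linarith)).trans (mul_le_mul_of_nonneg_left ?_ hC.le)
  calc (1 - q) ^ k ≤ Real.exp (-q) ^ k :=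
        pow_le_pow_left₀ (by linarith) (by linarith [Real.add_one_le_exp (-q)]) k
    _ = _ := by rw [← Real.exp_nat_mul]; ring_nf

lemma exists_contract_const (hM : M.Regular c C D) :
    ∃ C₂ : ℝ, 2 ≤ C₂ ∧ C * (C₂ - 1) ^ (-M.ν) ≤ c / 2 := by
  have h : Tendsto (fun t : ℝ => C * t ^ (-M.ν)) atTop (𝓝 (C * 0)) :=
    (tendsto_rpow_neg_atTop hM.ν_pos).const_mul C
  rw [mul_zero] at h
  have hc := hM.c_pos
  obtain ⟨t, ht, h1⟩ := ((h.eventually (Iic_mem_nhds (show 0 < c / 2 by linarith))).and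
    (eventually_ge_atTop 1)).exists
  exact ⟨t + 1, by linarith, by simpa using ht⟩

end WGraph

namespace WGraph
open GaussMat
variable {M : WGraph} {c C D : ℝ}

/-- A random obstacle which is everywhere dense in capacity, yet often avoids sets of small
capacity: a union of ranges of independent walks started far away. -/
theorem exists_obstacle_law (hM : M.Regular c C D) :
    ∃ c₁ > 0, ∃ c₂ > 0, ∀ (o : M.V) (L r R : ℝ) (N : ℕ), 1 ≤ L → L ≤ r → 1 ≤ R → D ≤ R →
      c₁ * (L / R) ^ M.ν ≤ 1 → ∃ ρ : Finset (M.fball o (R + D)) → ℝ, (∀ F, 0 ≤ ρ F) ∧ ∑ F, ρ F = 1 ∧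
        (∀ K, C * R ^ (-M.ν) * capM (M.greenMat (M.fball o (R + D)))⁻¹ K ≤ 1 →
          (1 - C * R ^ (-M.ν) * capM (M.greenMat (M.fball o (R + D)))⁻¹ K) ^ N ≤
            ∑ F, ρ F * if Disjoint F K then 1 else 0) ∧
        ∃ Q : Finset (M.fball o (R + D)) → Prop,
          (∀ F, Q F → ∀ w : M.fball o (R + D), M.d o w ≤ R - r →
            c₂ * (L ^ M.ν / (1 + Real.log (2 * L)) ^ bTwo M.ν M.α) ≤
              capM (M.greenMat (M.fball o (R + D)))⁻¹ (F ∩ M.sball (M.fball o (R + D)) w L)) ∧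
          (∑ F, ρ F * if Q F then 0 else 1) ≤
            (M.fball o (R + D)).card * (1 - c₁ * (L / R) ^ M.ν) ^ N := by
  obtain ⟨K₀, hK₀, hfar⟩ := exists_far hM
  obtain ⟨c₁, hc₁, c₂, hc₂, hball⟩ := range_law_ball hM (K₁ := 3 * K₀ + 1) (by positivity)
  refine ⟨c₁, hc₁, c₂, hc₂, fun o L r R N hL hr hR hDR hP0 => ?_⟩
  have hD := hM.D_ge
  have hC := hM.C_pos
  obtain ⟨z, hz1, hz2⟩ := hfar o (3 * R) (by linarith)
  set S := M.fball o (R + D) with hS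
  set U := insert z S with hU
  set κ : ℝ := c₂ * (L ^ M.ν / (1 + Real.log (2 * L)) ^ bTwo M.ν M.α) with hκ
  let zU : U := ⟨z, Finset.mem_insert_self z S⟩
  let f : S ↪ U := ⟨fun x => ⟨x, Finset.mem_insert_of_mem x.2⟩, fun x y h =>
    Subtype.ext (congrArg (fun u : U => (u : M.V)) h)⟩
  have hA := isMMat_inv (S := S) hM.standing hM.ν_pos hM.α_pos
  have hB := isMMat_inv (S := U) hM.standing hM.ν_pos hM.α_pos
  have hGA : ∀ x y : S, ((M.greenMat S)⁻¹)⁻¹ x y = M.green x y := fun x y => by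
    rw [inv_inv_greenMat hM.standing hM.ν_pos hM.α_pos]; rfl
  have hGB : ∀ x y : U, ((M.greenMat U)⁻¹)⁻¹ x y = M.green x y := fun x y => by
    rw [inv_inv_greenMat hM.standing hM.ν_pos hM.α_pos]; rfl
  have hcap : ∀ K : Finset S, capM (M.greenMat U)⁻¹ (K.map f) = capM (M.greenMat S)⁻¹ K :=
    capM_map hA hB f fun i j => by rw [hGA, hGB]; rfl
  obtain ⟨ρ₁, h0, h1, h2⟩ := exists_range_law hB zU
  obtain ⟨ρN, g0, g1, g2, g3⟩ := exists_union_law h0 h1 N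
  obtain ⟨ρ, r0, hr'⟩ := exists_push_law g0 f
  have hsum : ∑ F, ρ F = 1 := by simpa [g1] using hr' fun _ => 1
  obtain ⟨Q, hQ⟩ : ∃ Q : Finset S → Prop, ∀ F, Q F ↔ ∀ w : S, M.d o w ≤ R - r →
      κ ≤ capM (M.greenMat S)⁻¹ (F ∩ M.sball S w L) := ⟨_, fun _ => Iff.rfl⟩
  refine ⟨ρ, r0, hsum, fun K hK => ?_, Q, fun F => (hQ F).1, ?_⟩
  · have e : (∑ F, ρ F * if Disjoint F K then 1 else 0) =
        (1 - eqPot (M.greenMat U)⁻¹ (K.map f) zU) ^ N := by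
      rw [hr' fun F => if Disjoint F K then 1 else 0, ← h2, ← g2]
      simp only [disjoint_preimage_iff]
    rw [e]
    refine pow_le_pow_left₀ (by linarith) (sub_le_sub_left ?_ 1) N
    rw [← hcap]
    refine eqPot_le_mul_capM hB _ _ fun x hx => ?_
    obtain ⟨y, -, rfl⟩ := Finset.mem_map.1 hx
    have hy : M.d o y ≤ R + D := hM.mem_fball.1 y.2
    have h3 : R ≤ M.d z y := by
      have := M.d_triangle o y z
      rw [M.d_symm y z] at this
      linarith
    have hne : z ≠ y := fun e => by rw [e, M.d_self] at h3; linarith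
    rw [hGB]
    exact (hM.le_d z y hne).trans (mul_le_mul_of_nonneg_left
      (Real.rpow_le_rpow_of_nonpos (by linarith) h3 (by linarith [hM.ν_pos])) hC.le)
  · set W : Finset S := Finset.univ.filter fun w => M.d o w ≤ R - r with hW
    have hone : ∀ w ∈ W, (∑ F, ρ F * if κ ≤ capM (M.greenMat S)⁻¹ (F ∩ M.sball S w L) then 0 else 1)
        ≤ (1 - c₁ * (L / R) ^ M.ν) ^ N := fun w hw => by
      have hw' : M.d o w ≤ R - r := (Finset.mem_filter.1 hw).2
      have hsub : M.fball w L ⊆ S := fun v hv => by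
        rw [hM.mem_fball] at hv; rw [hS, hM.mem_fball]
        have := M.d_triangle o w v
        linarith
      have hzv : ∀ v, M.d w v ≤ L → R ≤ M.d z v ∧ M.d z v ≤ (3 * K₀ + 1) * R := fun v hv => by
        have a1 := M.d_triangle o w v
        have a2 := M.d_triangle o v z
        have a3 := M.d_triangle z o v
        rw [M.d_symm v z] at a2
        rw [M.d_symm z o] at a3
        constructor <;> nlinarith
      have hmap : (M.sball S w L).map f = M.sball U w L := by
        ext x
        simp only [Finset.mem_map, mem_sball]
        refine ⟨?_, fun hx => ?_⟩
        · rintro ⟨y, hy, rfl⟩; exact hy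
        · exact ⟨⟨x, hsub (hM.mem_fball.2 hx)⟩, hx, rfl⟩
      rw [hr' fun F => if κ ≤ capM (M.greenMat S)⁻¹ (F ∩ M.sball S w L) then 0 else 1]
      have e : ∀ F : Finset U, capM (M.greenMat S)⁻¹ (F.preimage f f.injective.injOn ∩ M.sball S w L)
          = capM (M.greenMat U)⁻¹ (F ∩ M.sball U w L) := fun F => by
        rw [← hcap, map_preimage_inter, hmap]
      simp only [e]
      refine (g3 (fun F => κ ≤ capM (M.greenMat U)⁻¹ (F ∩ M.sball U w L)) fun F F' hF h =>
        h.trans (capM_mono hB (Finset.inter_subset_inter_right hF))).trans ?_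
      have hkey := hball U zU w L R hL (by linarith)
        (hsub.trans (Finset.subset_insert _ _)) hzv ρ₁ h0 h1 h2
      have e2 : (∑ F, ρ₁ F * if κ ≤ capM (M.greenMat U)⁻¹ (F ∩ M.sball U w L) then 0 else 1) =
          1 - ∑ F, ρ₁ F * if κ ≤ capM (M.greenMat U)⁻¹ (F ∩ M.sball U w L) then 1 else 0 := by
        rw [eq_sub_iff_add_eq, ← Finset.sum_add_distrib]
        exact (Finset.sum_congr rfl fun F _ => by split_ifs <;> ring).trans h1
      refine pow_le_pow_left₀ (Finset.sum_nonneg fun F _ => mul_nonneg (h0 F) ?_) ?_ N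
      · split_ifs <;> norm_num
      · rw [e2]; linarith
    calc _ ≤ ∑ F, ρ F * ∑ w ∈ W,
          if κ ≤ capM (M.greenMat S)⁻¹ (F ∩ M.sball S w L) then 0 else (1 : ℝ) := by
          refine Finset.sum_le_sum fun F _ => mul_le_mul_of_nonneg_left ?_ (r0 F)
          have hnn : ∀ w ∈ W, 0 ≤
              if κ ≤ capM (M.greenMat S)⁻¹ (F ∩ M.sball S w L) then 0 else (1 : ℝ) := fun w _ => by
            split_ifs <;> norm_num
          split_ifs with h
          · exact Finset.sum_nonneg hnn
          · rw [hQ] at h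
            push Not at h
            obtain ⟨w, hw, hlt⟩ := h
            refine le_trans (le_of_eq ?_) (Finset.single_le_sum hnn
              (show w ∈ W from Finset.mem_filter.2 ⟨Finset.mem_univ _, hw⟩))
            rw [if_neg (not_le.2 hlt)]
      _ = ∑ w ∈ W, ∑ F, ρ F *
          if κ ≤ capM (M.greenMat S)⁻¹ (F ∩ M.sball S w L) then 0 else 1 := by
          simp_rw [Finset.mul_sum]; exact Finset.sum_comm
      _ ≤ ∑ w ∈ W, (1 - c₁ * (L / R) ^ M.ν) ^ N := Finset.sum_le_sum hone
      _ = W.card * (1 - c₁ * (L / R) ^ M.ν) ^ N := by rw [Finset.sum_const, nsmul_eq_mul]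
      _ ≤ _ := by
          refine mul_le_mul_of_nonneg_right (Nat.cast_le.2 ?_) (pow_nonneg (by linarith) N)
          exact (Finset.card_le_univ W).trans (by rw [Fintype.card_coe])

end WGraph

namespace Model
open GaussMat WGraph
variable {M : Model} {c C D : ℝ}

lemma armEvent_subset (hM : M.toWGraph.Regular c C D) {o : M.V} {R : ℝ}
    {S : Finset M.V} (hS : M.fball o (R + D) ⊆ S) {oS : S} (ho : (oS : M.V) = o) (hR : 0 ≤ R) :
    M.armEvent o R ⊆ {ω | ∃ y ∈ Finset.univ.filter (fun y : S => R < M.d o y),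
      Relation.ReflTransGen (fun u v : S => M.opn 0 ω u v) oS y} := by
  rintro ω ⟨y, hy, hconn⟩
  have key : (∃ y ∈ Finset.univ.filter (fun y : S => R < M.d o y),
      Relation.ReflTransGen (fun u v : S => M.opn 0 ω u v) oS y) ∨ (M.d o y ≤ R ∧ ∃ h : y ∈ S,
        Relation.ReflTransGen (fun u v : S => M.opn 0 ω u v) oS ⟨y, h⟩) := by
    clear hy
    change Relation.ReflTransGen (fun u v => M.opn 0 ω u v) o y at hconn
    induction hconn with
    | refl =>
      refine Or.inr ⟨by rw [M.d_self]; exact hR, ho ▸ oS.2, ?_⟩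
      have e : oS = ⟨o, ho ▸ oS.2⟩ := Subtype.ext ho
      rw [← e]
    | @tail a b _ hab ih =>
      rcases ih with ih | ⟨ha, haS, hr⟩
      · exact Or.inl ih
      have h1 := hM.nbr_le a b (M.opn_edge 0 ω a b hab)
      have h2 := M.d_triangle o a b
      have hb : b ∈ S := hS (hM.mem_fball.2 (by linarith))
      have hrb : Relation.ReflTransGen (fun u v : S => M.opn 0 ω u v) oS ⟨b, hb⟩ := hr.tail hab
      by_cases hbR : M.d o b ≤ R
      · exact Or.inr ⟨hbR, hb, hrb⟩
      · exact Or.inl ⟨⟨b, hb⟩, Finset.mem_filter.2 ⟨Finset.mem_univ _, not_le.1 hbR⟩, hrb⟩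
  rcases key with h | h
  · exact h
  · exact absurd h.1 (not_le.2 hy)

theorem prob_armEvent_le (hM : M.toWGraph.Regular c C D) {o : M.V} {R : ℝ} (hR : 0 ≤ R)
    {S : Finset M.V} (hS : M.fball o (R + D) ⊆ S) {oS : S} (ho : (oS : M.V) = o)
    {s ε p η δ : ℝ} (hs : 0 < s) (hε : 0 < ε) (hp : 0 < p) (hη : 0 ≤ η)
    {ρ : Finset S → ℝ} (hρ : ∀ F, 0 ≤ ρ F) (hρ1 : ∑ F, ρ F = 1)
    (hK : ∀ K, capM (M.greenMat S)⁻¹ K < s → p ≤ ∑ F, ρ F * if Disjoint F K then 1 else 0)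
    {Q : Finset S → Prop} (hbad : ∑ F, ρ F * (if Q F then 0 else 1) ≤ δ)
    (hgood : ∀ F, Q F → ∀ y : S, R < M.d o y → gKill (M.greenMat S)⁻¹ F y oS ≤ η) :
    M.prob (M.armEvent o R) ≤ 3 * ((√s)⁻¹ / √c) +
      S.card * (2 * (ε / √c) + ε⁻¹ ^ 2 * (p⁻¹ * (η + C * δ))) := by
  have hA := isMMat_inv (S := S) hM.standing hM.ν_pos hM.α_pos
  have hG : ∀ x y : S, ((M.greenMat S)⁻¹)⁻¹ x y = M.green x y := fun x y => by
    rw [inv_inv_greenMat hM.standing hM.ν_pos hM.α_pos]; rfl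
  have hC := hM.C_pos
  have hc := hM.c_pos
  have hδ : 0 ≤ δ := le_trans (Finset.sum_nonneg fun F _ => mul_nonneg (hρ F)
    (by split_ifs <;> norm_num)) hbad
  obtain ⟨k, hk1, hk2⟩ := M.map_restrict hA hG
  set T := Finset.univ.filter (fun y : S => R < M.d o y) with hT
  have hoT : oS ∉ T := by
    rw [hT, Finset.mem_filter, ho, M.d_self]; simp [hR]
  have hsmall : ∀ (v : S) (t : ℝ), 0 ≤ t →
      k * smallVal (M.greenMat S)⁻¹ v t ≤ ENNReal.ofReal (t / √c) := fun v t ht => by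
    refine (M.smallVal_le hk2 v (hc.trans_le (hM.diag v)) t).trans (ENNReal.ofReal_le_ofReal ?_)
    exact div_le_div_of_nonneg_left ht (Real.sqrt_pos.2 hc) (Real.sqrt_le_sqrt (hM.diag v))
  have hmain := (measure_mono (armEvent_subset hM hS ho hR)).trans
    ((M.measure_reach_le hA (fun x y hxy => lam_le_neg_inv hM.standing hM.ν_pos hM.α_pos x y hxy)
      hk2 oS T hoT).trans (mul_le_mul_right (sum_clDens_arm_le hA oS T hs hε hp hη hρ hρ1 hK hbad
        (fun F hF y hy _ => hgood F hF y (Finset.mem_filter.1 hy).2)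
        (fun y _ => (hG oS y).trans_le (hM.le oS y))) k))
  have hη' : 0 ≤ η + C * δ := by positivity
  have hterm : ∀ y ∈ T, k * (smallVal (M.greenMat S)⁻¹ oS ε + smallVal (M.greenMat S)⁻¹ y ε +
      ENNReal.ofReal (ε⁻¹ ^ 2) * (ENNReal.ofReal (p⁻¹ * (η + C * δ)) *
        ∫⁻ φ, dens (M.greenMat S)⁻¹ φ)) ≤
      ENNReal.ofReal (2 * (ε / √c) + ε⁻¹ ^ 2 * (p⁻¹ * (η + C * δ))) := fun y _ => by
    rw [mul_add, mul_add]
    have e : k * (ENNReal.ofReal (ε⁻¹ ^ 2) * (ENNReal.ofReal (p⁻¹ * (η + C * δ)) *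
        ∫⁻ φ, dens (M.greenMat S)⁻¹ φ)) = ENNReal.ofReal (ε⁻¹ ^ 2 * (p⁻¹ * (η + C * δ))) := by
      rw [ENNReal.ofReal_mul (p := ε⁻¹ ^ 2) (by positivity)]
      generalize ENNReal.ofReal (p⁻¹ * (η + C * δ)) = a
      rw [← mul_one (ENNReal.ofReal (ε⁻¹ ^ 2) * a), ← hk1]
      ring
    rw [e, two_mul, ENNReal.ofReal_add (by positivity) (by positivity),
      ENNReal.ofReal_add (by positivity) (by positivity)]
    gcongr
    · exact hsmall oS ε hε.le
    · exact hsmall y ε hε.le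
  have htot : M.P (M.armEvent o R) ≤ ENNReal.ofReal (3 * ((√s)⁻¹ / √c) +
      S.card * (2 * (ε / √c) + ε⁻¹ ^ 2 * (p⁻¹ * (η + C * δ)))) := by
    refine hmain.trans ?_
    rw [mul_add, ENNReal.ofReal_add (by positivity) (by positivity), Finset.mul_sum]
    refine add_le_add ?_ ((Finset.sum_le_sum hterm).trans ?_)
    · rw [ENNReal.ofReal_mul (by norm_num), ENNReal.ofReal_ofNat, mul_left_comm]
      gcongr
      exact hsmall oS _ (by positivity)
    · rw [Finset.sum_const, nsmul_eq_mul, ENNReal.ofReal_mul (by positivity), ENNReal.ofReal_natCast]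
      gcongr
      exact (Finset.card_le_univ T).trans (by rw [Fintype.card_coe])
  refine ENNReal.toReal_le_of_le_ofReal (by positivity) htot

theorem exists_prob_armEvent_le (hM : M.toWGraph.Regular c C D) :
    ∃ c₁ > 0, ∃ c₂ > 0, ∃ C₂ > 0, ∀ (o : M.V) (L R s ε κ : ℝ) (N k : ℕ), 1 ≤ L → 1 ≤ R → D ≤ R →
      c₁ * (L / R) ^ M.ν ≤ 1 → κ ≤ c₂ * (L ^ M.ν / (1 + Real.log (2 * L)) ^ bTwo M.ν M.α) →
      c / 2 * κ * L ^ (-M.ν) ≤ 1 → k * (C₂ * L + D) ≤ R →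
      0 < s → 0 < ε → C * R ^ (-M.ν) * s < 1 →
      M.prob (M.armEvent o R) ≤ 3 * ((√s)⁻¹ / √c) + (M.fball o (R + D)).card *
        (2 * (ε / √c) + ε⁻¹ ^ 2 * (((1 - C * R ^ (-M.ν) * s) ^ N)⁻¹ *
          (C * Real.exp (-(c / 2 * κ * L ^ (-M.ν) * k)) +
            C * ((M.fball o (R + D)).card * (1 - c₁ * (L / R) ^ M.ν) ^ N)))) := by
  obtain ⟨c₁, hc₁, c₂, hc₂, hlaw⟩ := exists_obstacle_law hM
  obtain ⟨C₂, hC₂, hC₂'⟩ := exists_contract_const hM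
  have hC := hM.C_pos
  have hc := hM.c_pos
  have hD := hM.D_ge
  refine ⟨c₁, hc₁, c₂, hc₂, C₂, by linarith, fun o L R s ε κ N k hL hR hDR hP0 hκ hq hk hs hε hb => ?_⟩
  obtain ⟨ρ, h0, h1, h2, Q, h3, h4⟩ := hlaw o L (C₂ * L + D) R N hL (by nlinarith) hR hDR hP0
  have hR0 : 0 < R := by linarith
  have hB : 0 < C * R ^ (-M.ν) := mul_pos hC (Real.rpow_pos_of_pos hR0 _)
  have hoS : o ∈ M.fball o (R + D) := hM.mem_fball.2 (by rw [M.d_self]; linarith)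
  generalize hS : M.fball o (R + D) = S at hoS ρ h0 h1 h2 Q h3 h4 ⊢
  have hK : ∀ K, capM (M.greenMat S)⁻¹ K < s →
      (1 - C * R ^ (-M.ν) * s) ^ N ≤ ∑ F, ρ F * if Disjoint F K then 1 else 0 := fun K hK => by
    have h5 := mul_le_mul_of_nonneg_left hK.le hB.le
    exact (pow_le_pow_left₀ (by linarith) (by linarith) N).trans (h2 K (by linarith))
  have hgood := fun F (hF : Q F) (y : S) hy =>
    gKill_le_exp (F := F) (y := y) (o := ⟨o, hoS⟩) hM hC₂ hC₂' hL hS.le hy hq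
      (fun w hw => hκ.trans (h3 F hF w hw)) k hk
  have hη : 0 ≤ C * Real.exp (-(c / 2 * κ * L ^ (-M.ν) * k)) := by positivity
  have hp : 0 < (1 - C * R ^ (-M.ν) * s) ^ N := pow_pos (by linarith) N
  generalize C * Real.exp (-(c / 2 * κ * L ^ (-M.ν) * k)) = η at *
  generalize (1 - C * R ^ (-M.ν) * s) ^ N = p at *
  generalize S.card * (1 - c₁ * (L / R) ^ M.ν) ^ N = δ at *
  exact prob_armEvent_le hM hR0.le hS.le (oS := ⟨o, hoS⟩) rfl hs hε hp hη h0 h1 hK h4 hgood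

end Model

lemma exp_neg_le_one_sub_pow {x : ℝ} (hx : x ≤ 1 / 2) (h0 : 0 ≤ x) (N : ℕ) :
    Real.exp (-(2 * x * N)) ≤ (1 - x) ^ N := by
  have h1 : 0 < 1 - x := by linarith
  have h2 : (1 - x)⁻¹ ≤ Real.exp (2 * x) := by
    refine le_trans ?_ (Real.add_one_le_exp _)
    rw [inv_le_iff_one_le_mul₀ h1]
    nlinarith
  have h3 : Real.exp (-(2 * x)) ≤ 1 - x := by
    rw [Real.exp_neg]
    exact inv_le_of_inv_le₀ h1 h2
  calc Real.exp (-(2 * x * N)) = Real.exp (-(2 * x)) ^ N := by rw [← Real.exp_nat_mul]; ring_nf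
    _ ≤ _ := pow_le_pow_left₀ (Real.exp_pos _).le h3 N

lemma one_sub_pow_le_exp_neg {x : ℝ} (hx : x ≤ 1) (N : ℕ) : (1 - x) ^ N ≤ Real.exp (-(x * N)) := by
  calc (1 - x) ^ N ≤ Real.exp (-x) ^ N :=
        pow_le_pow_left₀ (by linarith) (by linarith [Real.add_one_le_exp (-x)]) N
    _ = _ := by rw [← Real.exp_nat_mul]; ring_nf

/-- Bound for the error terms when all exponential factors are at most `R ^ (-E)`. -/
lemma error_terms_le {R α ν c C K n p e₁ e₂ : ℝ} (hR : 1 ≤ R) (hα : 0 ≤ α) (hC : 0 ≤ C) (hc : 0 < c)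
    (hK : 1 ≤ K) (hn0 : 0 ≤ n) (hn : n ≤ K * R ^ α) (hp : R ^ (-1 : ℝ) ≤ p)
    (h₁ : e₁ ≤ R ^ (-(4 * α + 3 * ν + 1))) (h₂0 : 0 ≤ e₂)
    (h₂ : e₂ ≤ R ^ (-(4 * α + 3 * ν + 1))) :
    n * (2 * (R ^ (-(α + ν)) / √c) + (R ^ (-(α + ν)))⁻¹ ^ 2 * (p⁻¹ * (C * e₁ + C * (n * e₂)))) ≤
      (2 * K / √c + 2 * C * K ^ 2) * R ^ (-ν) := by
  have hR0 : 0 < R := by linarith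
  have hc' : 0 < √c := Real.sqrt_pos.2 hc
  set a := R ^ α with ha
  set v := R ^ ν with hv
  have ha1 : 1 ≤ a := Real.one_le_rpow hR hα
  have ha0 : 0 < a := by linarith
  have hv0 : 0 < v := Real.rpow_pos_of_pos hR0 _
  have e1 : R ^ (-(α + ν)) = (a * v)⁻¹ := by
    rw [Real.rpow_neg hR0.le, Real.rpow_add hR0]
  have e2 : R ^ (-(4 * α + 3 * ν + 1)) = (a ^ 4 * v ^ 3 * R)⁻¹ := by
    rw [Real.rpow_neg hR0.le, Real.rpow_add hR0, Real.rpow_add hR0, Real.rpow_one,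
      mul_comm 4 α, mul_comm 3 ν, Real.rpow_mul hR0.le, Real.rpow_mul hR0.le]
    norm_cast
  have hp' : p⁻¹ ≤ R := by
    rw [Real.rpow_neg_one] at hp
    exact inv_le_of_inv_le₀ hR0 hp
  have hp0 : 0 < p := lt_of_lt_of_le (Real.rpow_pos_of_pos hR0 _) hp
  rw [e2] at h₁ h₂
  set x := (a ^ 4 * v ^ 3 * R)⁻¹ with hx
  have hx0 : 0 < x := by positivity
  rw [e1, inv_inv, Real.rpow_neg hR0.le]
  have h3 : C * e₁ + C * (n * e₂) ≤ 2 * C * (K * a) * x := by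
    have h4 : n * e₂ ≤ K * a * x := mul_le_mul hn h₂ h₂0 (by positivity)
    have h5 : e₁ ≤ K * a * x := h₁.trans (le_mul_of_one_le_left hx0.le (by nlinarith))
    nlinarith
  calc _ ≤ (K * a) * (2 * ((a * v)⁻¹ / √c) + (a * v) ^ 2 * (R * (2 * C * (K * a) * x))) := by
        refine (mul_le_mul_of_nonneg_left (add_le_add le_rfl (mul_le_mul_of_nonneg_left
          (mul_le_mul_of_nonneg_left h3 (by positivity)) (by positivity))) hn0).trans ?_
        gcongr
    _ = _ := by rw [hx]; field_simp; exact hv.symm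

set_option maxHeartbeats 1000000 in
/-- Choice of the scale `L` and of the remaining free parameters in terms of the radius `R`. -/
lemma exists_scale_parameters {c C D α ν b c₁ c₂ C₂ : ℝ} (hc : 0 < c) (hcle : c ≤ 1) (hC1 : 1 ≤ C)
    (hD : 1 ≤ D) (hα : 0 < α) (hν : 1 ≤ ν) (hb0 : 0 ≤ b) (hb1 : b ≤ 1) (hc₁ : 0 < c₁) (hc₂ : 0 < c₂)
    (hC₂ : 0 < C₂) :
    ∃ θ > 0, ∃ R₀ : ℝ, 2 ≤ R₀ ∧ ∀ R : ℝ, R₀ ≤ R → ∃ (L s κ : ℝ) (N k : ℕ), 1 ≤ Real.log R ∧ D ≤ R ∧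
      1 ≤ L ∧ c₁ * (L / R) ^ ν ≤ 1 ∧ κ ≤ c₂ * (L ^ ν / (1 + Real.log (2 * L)) ^ b) ∧
      c / 2 * κ * L ^ (-ν) ≤ 1 ∧ k * (C₂ * L + D) ≤ R ∧ 0 < s ∧ C * R ^ (-ν) * s < 1 ∧
      R ^ (-1 : ℝ) ≤ (1 - C * R ^ (-ν) * s) ^ N ∧
      Real.exp (-(c / 2 * κ * L ^ (-ν) * k)) ≤ R ^ (-(4 * α + 3 * ν + 1)) ∧
      (1 - c₁ * (L / R) ^ ν) ^ N ≤ R ^ (-(4 * α + 3 * ν + 1)) ∧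
      (√s)⁻¹ = (√θ)⁻¹ * (R ^ (-(ν / 2)) * Real.log R ^ (ν * (1 + b) / 2)) := by
  have hC : 0 < C := by linarith
  obtain ⟨c₃, hc₃⟩ : ∃ x, x = min c₂ 1 := ⟨_, rfl⟩
  have hc₃0 : 0 < c₃ := hc₃ ▸ lt_min hc₂ one_pos
  obtain ⟨E, hE⟩ : ∃ x : ℝ, x = 4 * α + 3 * ν + 1 := ⟨_, rfl⟩
  have hE1 : 1 ≤ E := by linarith
  obtain ⟨m, hm⟩ : ∃ x : ℝ, x = 2 * (C₂ + 1) + 8 * (C₂ + 1) * E / (c * c₃) + c₁ := ⟨_, rfl⟩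
  have hm1 : 2 * (C₂ + 1) ≤ m := by
    have : 0 < 8 * (C₂ + 1) * E / (c * c₃) := by positivity
    linarith
  have hm2 : 8 * (C₂ + 1) * E / (c * c₃) ≤ m := by linarith
  have hm3 : c₁ ≤ m := by
    have : 0 < 8 * (C₂ + 1) * E / (c * c₃) := by positivity
    linarith
  have hm0 : 0 < m := by linarith
  have hm20 : 2 ≤ m := by linarith
  obtain ⟨θ, hθ⟩ : ∃ x : ℝ, x = c₁ / (4 * C * E * m ^ ν) := ⟨_, rfl⟩
  have hmν0 : 0 < m ^ ν := Real.rpow_pos_of_pos hm0 _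
  have hθ0 : 0 < θ := by rw [hθ]; positivity
  have hev : ∀ᶠ R : ℝ in atTop, 1 ≤ Real.log R ∧ D ≤ R ∧ m * D * Real.log R ^ (1 + b) ≤ R := by
    refine (Real.tendsto_log_atTop.eventually_ge_atTop 1).and ((eventually_ge_atTop D).and ?_)
    have h := (isLittleO_log_rpow_rpow_atTop (1 + b) one_pos).bound
      (show 0 < (m * D)⁻¹ by positivity)
    filter_upwards [h, eventually_ge_atTop 1] with R h1 h2
    rw [Real.rpow_one, Real.norm_of_nonneg (by linarith : (0 : ℝ) ≤ R), Real.norm_of_nonneg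
      (Real.rpow_nonneg (Real.log_nonneg h2) _)] at h1
    have hmD : 0 < m * D := by positivity
    calc _ ≤ m * D * ((m * D)⁻¹ * R) := mul_le_mul_of_nonneg_left h1 hmD.le
      _ = R := by field_simp
  obtain ⟨R₁, hR₁⟩ := eventually_atTop.1 hev
  refine ⟨θ, hθ0, max R₁ 2, le_max_right _ _, fun R hR => ?_⟩
  have hR2 : 2 ≤ R := (le_max_right _ _).trans hR
  have hR0 : 0 < R := by linarith
  obtain ⟨hl, hDR, hmD⟩ := hR₁ R ((le_max_left _ _).trans hR)
  obtain ⟨l, hldef⟩ : ∃ x, x = Real.log R := ⟨_, rfl⟩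
  rw [← hldef] at hl hmD ⊢
  clear hev hR₁
  have hl0 : 0 < l := by linarith
  obtain ⟨X, hX⟩ : ∃ x, x = l ^ (1 + b) := ⟨_, rfl⟩
  rw [← hX] at hmD
  have hX1 : 1 ≤ X := by rw [hX]; exact Real.one_le_rpow hl (by linarith)
  have hX0 : 0 < X := by linarith
  have hlb : 0 < l ^ b := Real.rpow_pos_of_pos hl0 _
  have hXl : X = l * l ^ b := by rw [hX, Real.rpow_add hl0, Real.rpow_one]
  have hmX : 1 ≤ m * X := one_le_mul_of_one_le_of_one_le (by linarith) hX1
  obtain ⟨L, hL⟩ : ∃ x, x = R / (m * X) := ⟨_, rfl⟩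
  have hDL : D ≤ L := by rw [hL, le_div_iff₀ (by positivity)]; linarith
  have hL0 : 0 < L := by linarith
  have hLR : L / R = (m * X)⁻¹ := by rw [hL]; field_simp
  obtain ⟨P, hP⟩ : ∃ x, x = c₁ * (L / R) ^ ν := ⟨_, rfl⟩
  have hmXν : 0 < (m * X) ^ ν := Real.rpow_pos_of_pos (by positivity) _
  have hPeq : P = c₁ / (m * X) ^ ν := by
    rw [hP, hLR, Real.inv_rpow (by positivity)]; rfl
  have hP0 : 0 < P := by rw [hPeq]; positivity
  have hP1 : P ≤ 1 := by
    rw [hPeq, div_le_one hmXν]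
    calc c₁ ≤ m * X := hm3.trans (le_mul_of_one_le_right hm0.le hX1)
      _ = (m * X) ^ (1 : ℝ) := (Real.rpow_one _).symm
      _ ≤ _ := Real.rpow_le_rpow_of_exponent_le hmX hν
  obtain ⟨ℓ, hℓ⟩ : ∃ x, x = (1 + Real.log (2 * L)) ^ b := ⟨_, rfl⟩
  have hlog0 : 0 ≤ Real.log (2 * L) := Real.log_nonneg (by linarith)
  have hℓ1 : 1 ≤ ℓ := by rw [hℓ]; exact Real.one_le_rpow (by linarith) hb0
  have hℓ2 : ℓ ≤ 2 * l ^ b := by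
    have h1 : Real.log (2 * L) ≤ l := by
      rw [hldef]
      refine Real.log_le_log (by linarith) ?_
      rw [hL, mul_div_assoc', div_le_iff₀ (by positivity)]
      have h2 : 2 ≤ m * X := hm20.trans (le_mul_of_one_le_right hm0.le hX1)
      linarith [mul_le_mul_of_nonneg_left h2 hR0.le]
    calc ℓ = (1 + Real.log (2 * L)) ^ b := hℓ
      _ ≤ (2 * l) ^ b := Real.rpow_le_rpow (by linarith) (by linarith) hb0
      _ = 2 ^ b * l ^ b := Real.mul_rpow (by norm_num) hl0.le
      _ ≤ 2 ^ (1 : ℝ) * l ^ b := by gcongr; norm_num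
      _ = _ := by rw [Real.rpow_one]
  obtain ⟨κ, hκ⟩ : ∃ x, x = c₃ * (L ^ ν / ℓ) := ⟨_, rfl⟩
  have hLν : 0 < L ^ ν := Real.rpow_pos_of_pos hL0 _
  have hκle : κ ≤ c₂ * (L ^ ν / ℓ) := by
    rw [hκ, hc₃]; gcongr; exact min_le_left _ _
  have hq : c / 2 * κ * L ^ (-ν) = c * c₃ / (2 * ℓ) := by
    rw [hκ, Real.rpow_neg hL0.le]; field_simp
  have hq1 : c / 2 * κ * L ^ (-ν) ≤ 1 := by
    rw [hq, div_le_one (by positivity)]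
    have : c₃ ≤ 1 := hc₃ ▸ min_le_right _ _
    nlinarith
  obtain ⟨k, hk⟩ : ∃ x, x = ⌊R / (C₂ * L + D)⌋₊ := ⟨_, rfl⟩
  have hden : 0 < C₂ * L + D := by positivity
  have hkle : k * (C₂ * L + D) ≤ R := by
    rw [← le_div_iff₀ hden]
    rw [hk]; exact Nat.floor_le (by positivity)
  have hkge : m * X / (2 * (C₂ + 1)) ≤ k := by
    have h1 : m * X / (C₂ + 1) ≤ R / (C₂ * L + D) := by
      rw [div_le_div_iff₀ (by positivity) hden]
      have : m * X * L = R := by rw [hL]; field_simp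
      calc m * X * (C₂ * L + D) ≤ m * X * (C₂ * L + L) := by gcongr
        _ = (m * X * L) * (C₂ + 1) := by ring
        _ = _ := by rw [this]
    have h2 := Nat.lt_floor_add_one (R / (C₂ * L + D))
    rw [← hk] at h2
    have h3 : 2 ≤ m * X / (C₂ + 1) := by
      rw [le_div_iff₀ (by positivity)]; nlinarith
    have h4 : m * X / (2 * (C₂ + 1)) = m * X / (C₂ + 1) / 2 := by field_simp
    rw [h4]; linarith
  have hqk : E * l ≤ c / 2 * κ * L ^ (-ν) * k := by
    rw [hq]
    have h1 : c * c₃ / (4 * l ^ b) ≤ c * c₃ / (2 * ℓ) := by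
      apply div_le_div_of_nonneg_left (by positivity) (by positivity); linarith
    calc E * l = c * c₃ / (4 * l ^ b) * (8 * (C₂ + 1) * E / (c * c₃) * X / (2 * (C₂ + 1))) := by
          rw [hXl]; field_simp; norm_num
      _ ≤ c * c₃ / (2 * ℓ) * (m * X / (2 * (C₂ + 1))) := by gcongr
      _ ≤ _ := by gcongr
  obtain ⟨N, hN⟩ : ∃ x, x = ⌈E * l / P⌉₊ := ⟨_, rfl⟩
  have hN1 : E * l ≤ P * N := by
    rw [mul_comm P, ← div_le_iff₀ hP0]; rw [hN]; exact Nat.le_ceil _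
  have hN2 : (N : ℝ) ≤ 2 * (E * l / P) := by
    have h1 : 1 ≤ E * l / P := by rw [le_div_iff₀ hP0]; nlinarith
    have h2 := Nat.ceil_lt_add_one (show 0 ≤ E * l / P by positivity)
    rw [← hN] at h2; linarith
  obtain ⟨s, hs⟩ : ∃ x, x = θ * (R ^ ν / X ^ ν) := ⟨_, rfl⟩
  have hRν : 0 < R ^ ν := Real.rpow_pos_of_pos hR0 _
  have hXν : 0 < X ^ ν := Real.rpow_pos_of_pos hX0 _
  have hs0 : 0 < s := by rw [hs]; positivity
  have hx : C * R ^ (-ν) * s = P / (4 * E) := by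
    rw [hs, hθ, hPeq, Real.rpow_neg hR0.le, Real.mul_rpow hm0.le hX0.le]; field_simp
  have hx0 : 0 ≤ C * R ^ (-ν) * s := by rw [hx]; positivity
  have hx2 : C * R ^ (-ν) * s ≤ 1 / 2 := by
    rw [hx, div_le_iff₀ (by positivity)]; linarith
  have hexp : ∀ t : ℝ, R ^ t = Real.exp (l * t) := fun t => hldef ▸ Real.rpow_def_of_pos hR0 t
  have hp : R ^ (-1 : ℝ) ≤ (1 - C * R ^ (-ν) * s) ^ N := by
    refine le_trans ?_ (exp_neg_le_one_sub_pow hx2 hx0 N)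
    rw [hexp, Real.exp_le_exp, hx]
    have : 2 * (P / (4 * E)) * N ≤ l := by
      calc 2 * (P / (4 * E)) * N ≤ 2 * (P / (4 * E)) * (2 * (E * l / P)) := by gcongr
        _ = l := by field_simp; norm_num
    linarith
  have he₁ : Real.exp (-(c / 2 * κ * L ^ (-ν) * k)) ≤ R ^ (-E) := by
    rw [hexp, Real.exp_le_exp]; linarith
  have he₂ : (1 - P) ^ N ≤ R ^ (-E) := by
    refine (one_sub_pow_le_exp_neg hP1 N).trans ?_
    rw [hexp, Real.exp_le_exp]; linarith
  have hsqrt : (√s)⁻¹ = (√θ)⁻¹ * (R ^ (-(ν / 2)) * l ^ (ν * (1 + b) / 2)) := by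
    have e1 : √(R ^ ν) = R ^ (ν / 2) := by
      rw [Real.sqrt_eq_rpow, ← Real.rpow_mul hR0.le]; ring_nf
    have e2 : √(X ^ ν) = l ^ (ν * (1 + b) / 2) := by
      rw [Real.sqrt_eq_rpow, ← Real.rpow_mul hX0.le, hX, ← Real.rpow_mul hl0.le]; ring_nf
    rw [hs, Real.sqrt_mul hθ0.le, Real.sqrt_div hRν.le, e1, e2, Real.rpow_neg hR0.le, mul_inv, inv_div]
    ring
  refine ⟨L, s, κ, N, k, hl, hDR, by linarith, hP ▸ hP1, hℓ ▸ hκle, hq1, hkle, hs0, by linarith, hp,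
    hE ▸ he₁, hP ▸ hE ▸ he₂, hsqrt⟩

namespace Model
open GaussMat WGraph
variable {M : Model} {c C D : ℝ}

theorem prob_armEvent_le_log (hM : M.toWGraph.Regular c C D) :
    ∃ B > 0, ∃ R₀ : ℝ, 2 ≤ R₀ ∧ ∀ (o : M.V) (R : ℝ), R₀ ≤ R → M.prob (M.armEvent o R) ≤
      B * R ^ (-(M.ν / 2)) * Real.log R ^ (M.ν * (1 + bTwo M.ν M.α) / 2) := by
  obtain ⟨c₁, hc₁, c₂, hc₂, C₂, hC₂, hbound⟩ := exists_prob_armEvent_le hM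
  have hC := hM.C_pos
  have hC1 := hM.C_ge
  have hc := hM.c_pos
  have hcle := hM.c_le
  have hD := hM.D_ge
  have hν := hM.ν_ge
  have hα := hM.α_pos
  set b := bTwo M.ν M.α with hb
  have hb0 : 0 ≤ b := by rw [hb, bTwo]; split_ifs <;> norm_num
  have hb1 : b ≤ 1 := by rw [hb, bTwo]; split_ifs <;> norm_num
  obtain ⟨θ, hθ0, R₀, hR₀, hpar⟩ := exists_scale_parameters hc hcle hC1 hD hα hν hb0 hb1 hc₁ hc₂ hC₂
  set K : ℝ := C * 2 ^ M.α with hK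
  have hK1 : 1 ≤ K := by
    have : (1 : ℝ) ≤ 2 ^ M.α := Real.one_le_rpow (by norm_num) hα.le
    nlinarith
  refine ⟨3 * ((√θ)⁻¹ / √c) + (2 * K / √c + 2 * C * K ^ 2), by positivity, R₀, hR₀, fun o R hR => ?_⟩
  have hR2 : 2 ≤ R := hR₀.trans hR
  have hR0 : 0 < R := by linarith
  obtain ⟨L, s, κ, N, k, hl, hDR, hL1, hP1, hκle, hq1, hkle, hs0, hs1, hp, he₁, he₂, hsqrt⟩ :=
    hpar R hR
  have hcard : ((M.fball o (R + D)).card : ℝ) ≤ K * R ^ M.α := by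
    refine (hM.card_le o (R + D) (by linarith)).trans ?_
    rw [hK, mul_assoc, ← Real.mul_rpow (by norm_num) hR0.le]
    refine mul_le_mul_of_nonneg_left (Real.rpow_le_rpow (by linarith) (by linarith) hα.le) hC.le
  have hmain := hbound o L R s (R ^ (-(M.α + M.ν))) κ N k hL1 (by linarith) hDR hP1 hκle
    hq1 hkle hs0 (Real.rpow_pos_of_pos hR0 _) hs1
  have herr := error_terms_le (ν := M.ν) (by linarith : 1 ≤ R) hα.le hC.le hc hK1 (Nat.cast_nonneg _)
    hcard hp he₁ (pow_nonneg (by linarith) N) he₂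
  have hY : R ^ (-M.ν) ≤ R ^ (-(M.ν / 2)) * Real.log R ^ (M.ν * (1 + b) / 2) := by
    calc R ^ (-M.ν) ≤ R ^ (-(M.ν / 2)) :=
          Real.rpow_le_rpow_of_exponent_le (by linarith) (by linarith)
      _ ≤ _ := le_mul_of_one_le_right (by positivity) (Real.one_le_rpow hl (by positivity))
  calc _ ≤ _ := hmain
    _ ≤ _ := add_le_add le_rfl herr
    _ ≤ 3 * ((√s)⁻¹ / √c) + (2 * K / √c + 2 * C * K ^ 2) *
        (R ^ (-(M.ν / 2)) * Real.log R ^ (M.ν * (1 + b) / 2)) :=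
      add_le_add le_rfl (mul_le_mul_of_nonneg_left hY (by positivity))
    _ = _ := by rw [hsqrt]; ring

end Model

/-- **Remark 4.4 (simpler one-arm bound).** -/
theorem one_arm_simple_upper_bound (M : Model) (hS : M.toWGraph.Standing)
    (hν1 : 1 ≤ M.ν) (hνα : M.ν ≤ M.α / 2) :
    ∃ C > (0:ℝ), ∀ (x : M.V) (R : ℝ), 2 ≤ R →
      M.prob (M.armEvent x R) ≤
        C * R ^ (-(M.ν / 2)) * Real.log R ^ ((M.ν + bTwo M.ν M.α * (M.ν + 1)) / 2) := by
  obtain ⟨c, C, D, hM⟩ := WGraph.exists_regular hS hν1 (by linarith)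
  obtain ⟨B, hB, R₀, hR₀, h⟩ := Model.prob_armEvent_le_log hM
  have hb0 : 0 ≤ bTwo M.ν M.α := by rw [bTwo]; split_ifs <;> norm_num
  set b := bTwo M.ν M.α
  set β := (M.ν + b * (M.ν + 1)) / 2 with hβ
  have hlog2 : 0 < Real.log 2 := Real.log_pos (by norm_num)
  have hβ0 : 0 ≤ β := by positivity
  set B' : ℝ := B * Real.log 2 ^ (-(b / 2)) + R₀ ^ (M.ν / 2) * Real.log 2 ^ (-β) with hB'
  refine ⟨B', by positivity, fun x R hR => ?_⟩
  have hR0 : 0 < R := by linarith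
  have hl : Real.log 2 ≤ Real.log R := Real.log_le_log (by norm_num) hR
  have hl0 : 0 < Real.log R := hlog2.trans_le hl
  have hfac : 0 < R ^ (-(M.ν / 2)) * Real.log R ^ β := by positivity
  rw [hB', mul_assoc, add_mul]
  have hn1 : 0 ≤ B * Real.log 2 ^ (-(b / 2)) * (R ^ (-(M.ν / 2)) * Real.log R ^ β) := by positivity
  have hn2 : 0 ≤ R₀ ^ (M.ν / 2) * Real.log 2 ^ (-β) * (R ^ (-(M.ν / 2)) * Real.log R ^ β) := by
    positivity
  by_cases hRR : R₀ ≤ R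
  · refine le_trans ?_ (le_add_of_nonneg_right hn2)
    refine (h x R hRR).trans (le_of_eq_of_le (b := B * (R ^ (-(M.ν / 2)) *
      (Real.log R ^ (-(b / 2)) * Real.log R ^ β))) ?_ ?_)
    · rw [← Real.rpow_add hl0, hβ]; ring_nf
    · calc _ = B * Real.log R ^ (-(b / 2)) * (R ^ (-(M.ν / 2)) * Real.log R ^ β) := by ring
        _ ≤ _ := by
          refine mul_le_mul_of_nonneg_right (mul_le_mul_of_nonneg_left ?_ hB.le) hfac.le
          exact Real.rpow_le_rpow_of_nonpos hlog2 hl (by linarith)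
  · refine le_trans ?_ (le_add_of_nonneg_left hn1)
    have := M.Pprob
    have h1 : M.prob (M.armEvent x R) ≤ 1 :=
      ENNReal.toReal_le_of_le_ofReal zero_le_one (by rw [ENNReal.ofReal_one]; exact prob_le_one)
    refine h1.trans ?_
    have h2 : R₀ ^ (-(M.ν / 2)) ≤ R ^ (-(M.ν / 2)) :=
      Real.rpow_le_rpow_of_nonpos hR0 (not_le.1 hRR).le (by linarith)
    have h3 : Real.log 2 ^ β ≤ Real.log R ^ β := Real.rpow_le_rpow hlog2.le hl hβ0
    have hR₀0 : 0 < R₀ := by linarith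
    calc (1 : ℝ) = R₀ ^ (M.ν / 2) * Real.log 2 ^ (-β) * (R₀ ^ (-(M.ν / 2)) * Real.log 2 ^ β) := by
          rw [Real.rpow_neg hR₀0.le, Real.rpow_neg hlog2.le]; field_simp
      _ ≤ _ := by gcongr
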